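/- Let ℝ^n_+ = {x = (x',x_n) ∈ ℝ^n : x_n > 0} and e_n = (0,…,0,1). Let u be a C^{2,1} function on ℝ^n_+ × [0,T] satisfying, for some constant M > 0, |Δu(x,t) + ∂_t u(x,t)| ≤ M(|u(x,t)| + |∇u(x,t)|) and |u(x,t)| ≤ M e^{M|x|^2} for all (x,t) ∈ ℝ^n_+ × [0,T]. If the L^2-norm of u(·,0) over the ball B_1(4e_n) is positive, then there is a constant N > 0 such that for every real y ≥ N one has ‖u(·,0)‖_{L^2(B_{y/2}(y e_n))} ≥ e^{-N y^2} and ‖u(·,0)‖_{L^2(B_1(y e_n))} ≥ e^{-N y^2 log y}. -/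

import Mathlib

open MeasureTheory Real Set Metric

/-- The spatial Laplacian of `f : ℝⁿ → ℝ`. -/
noncomputable def slap {n : ℕ} (f : EuclideanSpace ℝ (Fin n) → ℝ)
    (x : EuclideanSpace ℝ (Fin n)) : ℝ :=
  ∑ i : Fin n, fderiv ℝ (fun y => fderiv ℝ f y (EuclideanSpace.single i 1)) x
    (EuclideanSpace.single i 1)

open Filter Topology

section Calculus

variable {d : ℕ}

/-- The partial derivative in the `i`-th coordinate direction. -/
noncomputable def pd (i : Fin d) (f : EuclideanSpace ℝ (Fin d) → ℝ)
    (x : EuclideanSpace ℝ (Fin d)) : ℝ :=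
  fderiv ℝ f x (EuclideanSpace.single i 1)

/-- The squared length of the gradient. -/
noncomputable def gsq (f : EuclideanSpace ℝ (Fin d) → ℝ) (x : EuclideanSpace ℝ (Fin d)) : ℝ :=
  ∑ i, pd i f x ^ 2

variable {f g : EuclideanSpace ℝ (Fin d) → ℝ} {x : EuclideanSpace ℝ (Fin d)} {i : Fin d}

lemma slap_eq_sum_pd : slap f x = ∑ i, pd i (pd i f) x := rfl

lemma gsq_nonneg : 0 ≤ gsq f x := Finset.sum_nonneg fun _ _ => sq_nonneg _

lemma HasFDerivAt.pd_eq {f' : EuclideanSpace ℝ (Fin d) →L[ℝ] ℝ} (h : HasFDerivAt f f' x) :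
    pd i f x = f' (EuclideanSpace.single i 1) := by
  rw [pd, h.fderiv]

lemma pd_congr (h : f =ᶠ[𝓝 x] g) : pd i f x = pd i g x := by rw [pd, pd, h.fderiv_eq]

lemma pd_add (hf : DifferentiableAt ℝ f x) (hg : DifferentiableAt ℝ g x) :
    pd i (fun y => f y + g y) x = pd i f x + pd i g x := by
  rw [(hf.hasFDerivAt.fun_add hg.hasFDerivAt).pd_eq]; rfl

lemma pd_sub (hf : DifferentiableAt ℝ f x) (hg : DifferentiableAt ℝ g x) :
    pd i (fun y => f y - g y) x = pd i f x - pd i g x := by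
  rw [(hf.hasFDerivAt.fun_sub hg.hasFDerivAt).pd_eq]; rfl

lemma pd_const (c : ℝ) : pd i (fun _ : EuclideanSpace ℝ (Fin d) => c) x = 0 := by
  rw [(hasFDerivAt_const c x).pd_eq]; rfl

lemma pd_mul (hf : DifferentiableAt ℝ f x) (hg : DifferentiableAt ℝ g x) :
    pd i (fun y => f y * g y) x = pd i f x * g x + f x * pd i g x := by
  rw [(hf.hasFDerivAt.fun_mul hg.hasFDerivAt).pd_eq]
  simp [pd]; ring

lemma pd_const_mul (c : ℝ) (hf : DifferentiableAt ℝ f x) :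
    pd i (fun y => c * f y) x = c * pd i f x := by
  rw [(hf.hasFDerivAt.const_mul c).pd_eq]; simp [pd]

lemma pd_sum {ι : Type*} (s : Finset ι) {F : ι → EuclideanSpace ℝ (Fin d) → ℝ}
    (hF : ∀ j ∈ s, DifferentiableAt ℝ (F j) x) :
    pd i (fun y => ∑ j ∈ s, F j y) x = ∑ j ∈ s, pd i (F j) x := by
  rw [(HasFDerivAt.fun_sum fun j hj => (hF j hj).hasFDerivAt).pd_eq]
  simp [pd]

lemma pd_comp {φ : ℝ → ℝ} {φ' : ℝ} (hφ : HasDerivAt φ φ' (f x)) (hf : DifferentiableAt ℝ f x) :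
    pd i (fun y => φ (f y)) x = φ' * pd i f x := by
  have := (hφ.comp_hasFDerivAt x hf.hasFDerivAt).pd_eq (i := i)
  simpa [pd, Function.comp_def] using this

lemma pd_coord (c : EuclideanSpace ℝ (Fin d)) (j : Fin d) :
    pd i (fun y : EuclideanSpace ℝ (Fin d) => y j - c j) x = if j = i then 1 else 0 := by
  have h : HasFDerivAt (fun y : EuclideanSpace ℝ (Fin d) => y j - c j)
      (EuclideanSpace.proj j : EuclideanSpace ℝ (Fin d) →L[ℝ] ℝ) x :=
    ((EuclideanSpace.proj j : EuclideanSpace ℝ (Fin d) →L[ℝ] ℝ).hasFDerivAt).sub_const _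
  rw [h.pd_eq]
  simp

lemma contDiff_coord (c : EuclideanSpace ℝ (Fin d)) (j : Fin d) {k : WithTop ℕ∞} :
    ContDiff ℝ k (fun y : EuclideanSpace ℝ (Fin d) => y j - c j) :=
  ((EuclideanSpace.proj j : EuclideanSpace ℝ (Fin d) →L[ℝ] ℝ).contDiff).sub contDiff_const

lemma ContDiff.pd {k m : WithTop ℕ∞} (hf : ContDiff ℝ k f) (hk : m + 1 ≤ k) :
    ContDiff ℝ m (pd i f) :=
  (hf.fderiv_right hk).clm_apply contDiff_const

lemma ContDiff.pd_one (hf : ContDiff ℝ 2 f) : ContDiff ℝ 1 (_root_.pd i f) :=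
  ContDiff.pd hf (by norm_num)

lemma ContDiff.continuous_pd (hf : ContDiff ℝ 1 f) : Continuous (_root_.pd i f) :=
  (ContDiff.pd (m := 0) hf (by norm_num)).continuous

lemma ContDiff.continuous_gsq (hf : ContDiff ℝ 1 f) : Continuous (gsq f) :=
  continuous_finsetSum _ fun _ _ => hf.continuous_pd.pow 2

lemma ContDiff.continuous_slap (hf : ContDiff ℝ 2 f) : Continuous (slap f) :=
  continuous_finsetSum _ fun _ _ => hf.pd_one.continuous_pd

lemma pd_eq_zero_of_notMem_tsupport (hx : x ∉ tsupport f) : pd i f x = 0 := by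
  rw [pd, image_eq_zero_of_notMem_tsupport (fun h => hx (tsupport_fderiv_subset ℝ h))]; rfl

lemma tsupport_pd_subset : tsupport (pd i f) ⊆ tsupport f :=
  closure_minimal (fun x hx => by
    by_contra h; exact hx (pd_eq_zero_of_notMem_tsupport h)) (isClosed_tsupport f)

lemma HasCompactSupport.pd (hf : HasCompactSupport f) : HasCompactSupport (pd i f) :=
  IsCompact.of_isClosed_subset hf (isClosed_tsupport _) tsupport_pd_subset

lemma gsq_eq_norm_gradient_sq (f : EuclideanSpace ℝ (Fin d) → ℝ) (x) :
    gsq f x = ‖gradient f x‖ ^ 2 := by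
  rw [EuclideanSpace.norm_sq_eq, gsq]
  refine Finset.sum_congr rfl fun i _ => ?_
  have : fderiv ℝ f x (EuclideanSpace.single i 1) =
      inner ℝ (gradient f x) (EuclideanSpace.single i 1) := by
    rw [gradient, InnerProductSpace.toDual_symm_apply]
  rw [pd, this, EuclideanSpace.inner_single_right]
  simp

/-- Integration by parts in the `i`-th direction. -/
lemma integral_mul_pd (hf : ContDiff ℝ 1 f) (hg : ContDiff ℝ 1 g) (hs : HasCompactSupport f) :
    ∫ x, f x * pd i g x = - ∫ x, pd i f x * g x := by
  refine integral_mul_fderiv_eq_neg_fderiv_mul_of_integrable ?_ ?_ ?_ ?_ ?_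
  · exact (hf.continuous_pd.mul hg.continuous).integrable_of_hasCompactSupport hs.pd.mul_right
  · exact (hf.continuous.mul hg.continuous_pd).integrable_of_hasCompactSupport hs.mul_right
  · exact (hf.continuous.mul hg.continuous).integrable_of_hasCompactSupport hs.mul_right
  · exact fun x _ => hf.contDiffAt.differentiableAt (by norm_num)
  · exact fun x _ => hg.contDiffAt.differentiableAt (by norm_num)

lemma slap_mul (hf : ContDiff ℝ 2 f) (hg : ContDiff ℝ 2 g) :
    slap (fun y => f y * g y) x =
      slap f x * g x + 2 * ∑ i, pd i f x * pd i g x + f x * slap g x := by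
  have df : Differentiable ℝ f := hf.differentiable (by norm_num)
  have dg : Differentiable ℝ g := hg.differentiable (by norm_num)
  have h : ∀ i, pd i (pd i (fun y => f y * g y)) x =
      pd i (pd i f) x * g x + 2 * (pd i f x * pd i g x) + f x * pd i (pd i g) x := by
    intro i
    have e : pd i (fun y => f y * g y) = fun y => pd i f y * g y + f y * pd i g y :=
      funext fun y => pd_mul (df y) (dg y)
    have dpf : Differentiable ℝ (pd i f) := hf.pd_one.differentiable (by norm_num)
    have dpg : Differentiable ℝ (pd i g) := hg.pd_one.differentiable (by norm_num)
    rw [e, pd_add ((dpf x).fun_mul (dg x)) ((df x).fun_mul (dpg x)), pd_mul (dpf x) (dg x),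
      pd_mul (df x) (dpg x)]
    ring
  simp only [slap_eq_sum_pd, h, Finset.sum_add_distrib, Finset.sum_mul, Finset.mul_sum]

lemma slap_add (hf : ContDiff ℝ 2 f) (hg : ContDiff ℝ 2 g) :
    slap (fun y => f y + g y) x = slap f x + slap g x := by
  have df : Differentiable ℝ f := hf.differentiable (by norm_num)
  have dg : Differentiable ℝ g := hg.differentiable (by norm_num)
  simp only [slap_eq_sum_pd, ← Finset.sum_add_distrib]
  refine Finset.sum_congr rfl fun i _ => ?_
  rw [show pd i (fun y => f y + g y) = fun y => pd i f y + pd i g y from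
    funext fun y => pd_add (df y) (dg y), pd_add]
  · exact hf.pd_one.differentiable (by norm_num) x
  · exact hg.pd_one.differentiable (by norm_num) x

lemma slap_const_mul (c : ℝ) (hf : ContDiff ℝ 2 f) :
    slap (fun y => c * f y) x = c * slap f x := by
  have df : Differentiable ℝ f := hf.differentiable (by norm_num)
  simp only [slap_eq_sum_pd, Finset.mul_sum]
  refine Finset.sum_congr rfl fun i _ => ?_
  rw [show pd i (fun y => c * f y) = fun y => c * pd i f y from
    funext fun y => pd_const_mul c (df y), pd_const_mul]
  exact hf.pd_one.differentiable (by norm_num) x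

lemma slap_comp {φ φ' : ℝ → ℝ} {φ'' : ℝ} (h1 : ∀ z, HasDerivAt φ (φ' z) z)
    (h2 : HasDerivAt φ' φ'' (f x)) (hf : ContDiff ℝ 2 f) :
    slap (fun y => φ (f y)) x = φ'' * gsq f x + φ' (f x) * slap f x := by
  have df : Differentiable ℝ f := hf.differentiable (by norm_num)
  simp only [slap_eq_sum_pd, gsq, Finset.mul_sum, ← Finset.sum_add_distrib]
  refine Finset.sum_congr rfl fun i _ => ?_
  have hc : DifferentiableAt ℝ (fun y => φ' (f y)) x :=
    h2.differentiableAt.fun_comp' x (df x)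
  rw [show pd i (fun y => φ (f y)) = fun y => φ' (f y) * pd i f y from
    funext fun y => pd_comp (h1 _) (df y), pd_mul hc (hf.pd_one.differentiable (by norm_num) x),
    pd_comp h2 (df x)]
  ring

/-- The squared distance to `c` in coordinates. -/
lemma norm_sub_sq_eq_sum (c : EuclideanSpace ℝ (Fin d)) :
    ‖x - c‖ ^ 2 = ∑ j, (x j - c j) ^ 2 := by
  rw [EuclideanSpace.norm_sq_eq]; simp

lemma contDiff_norm_sub_sq (c : EuclideanSpace ℝ (Fin d)) {k : WithTop ℕ∞} :
    ContDiff ℝ k (fun y : EuclideanSpace ℝ (Fin d) => ‖y - c‖ ^ 2) := by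
  exact (contDiff_id.sub contDiff_const).norm_sq ℝ

lemma pd_norm_sub_sq (c : EuclideanSpace ℝ (Fin d)) :
    pd i (fun y : EuclideanSpace ℝ (Fin d) => ‖y - c‖ ^ 2) x = 2 * (x i - c i) := by
  have hd : ∀ j, DifferentiableAt ℝ (fun y : EuclideanSpace ℝ (Fin d) => y j - c j) x := fun j =>
    (contDiff_coord c j (k := 1)).contDiffAt.differentiableAt (by norm_num)
  simp only [norm_sub_sq_eq_sum]
  simp only [pow_two]
  rw [pd_sum _ fun j _ => (hd j).fun_mul (hd j)]
  simp only [pd_mul (hd _) (hd _), pd_coord]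
  simp [Finset.sum_add_distrib]; ring

lemma gsq_norm_sub_sq (c : EuclideanSpace ℝ (Fin d)) :
    gsq (fun y : EuclideanSpace ℝ (Fin d) => ‖y - c‖ ^ 2) x = 4 * ‖x - c‖ ^ 2 := by
  simp only [gsq, pd_norm_sub_sq]
  rw [norm_sub_sq_eq_sum, Finset.mul_sum]
  exact Finset.sum_congr rfl fun _ _ => by ring

lemma slap_norm_sub_sq (c : EuclideanSpace ℝ (Fin d)) :
    slap (fun y : EuclideanSpace ℝ (Fin d) => ‖y - c‖ ^ 2) x = 2 * d := by
  have h : ∀ i, pd i (pd i (fun y : EuclideanSpace ℝ (Fin d) => ‖y - c‖ ^ 2)) x = 2 := by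
    intro i
    rw [show pd i (fun y : EuclideanSpace ℝ (Fin d) => ‖y - c‖ ^ 2) =
      fun y => 2 * (y i - c i) from funext fun y => pd_norm_sub_sq c, pd_const_mul, pd_coord]
    · simp
    · exact (contDiff_coord c i (k := 1)).contDiffAt.differentiableAt (by norm_num)
  simp [slap_eq_sum_pd, h, mul_comm]

end Calculus

section LeftDerivatives

/-- If every point of `(a, b]` has a point to its left with no larger value,
then `P a ≤ P b`. -/
lemma le_of_forall_exists_left {P : ℝ → ℝ} {a b : ℝ} (hab : a ≤ b)
    (hP : ContinuousOn P (Icc a b)) (h : ∀ t ∈ Ioc a b, ∃ s ∈ Ico a t, P s ≤ P t) :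
    P a ≤ P b := by
  have hc : IsCompact (Icc a b ∩ P ⁻¹' Iic (P b)) :=
    isCompact_Icc.of_isClosed_subset (hP.preimage_isClosed_of_isClosed isClosed_Icc isClosed_Iic)
      inter_subset_left
  obtain ⟨t, ⟨ht, htb⟩, hmin⟩ := hc.exists_isLeast ⟨b, right_mem_Icc.2 hab, le_refl (P b)⟩
  rcases ht.1.eq_or_lt with rfl | hlt
  · exact htb
  obtain ⟨s, hs, hst⟩ := h t ⟨hlt, ht.2⟩
  exact absurd (hmin ⟨⟨hs.1, hs.2.le.trans ht.2⟩, hst.trans htb⟩) (not_le.2 hs.2)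

lemma hasDerivWithinAt_Ioi_comp_neg {g : ℝ → ℝ} {g' t : ℝ}
    (h : HasDerivWithinAt g g' (Iio (-t)) (-t)) :
    HasDerivWithinAt (fun s => g (-s)) (-g') (Ioi t) t := by
  have h1 : HasDerivWithinAt (fun s : ℝ => -s) (-1) (Ioi t) t := (hasDerivAt_neg t).hasDerivWithinAt
  have := HasDerivWithinAt.comp t h h1 (fun s hs => by simpa using hs)
  simpa [Function.comp_def] using this

/-- The fundamental inequality of calculus for left derivatives. -/
lemma integral_le_sub_of_hasDeriv_left {g g' φ : ℝ → ℝ} {a b : ℝ} (hab : a ≤ b)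
    (hcont : ContinuousOn g (Icc a b))
    (hderiv : ∀ x ∈ Ioo a b, HasDerivWithinAt g (g' x) (Iio x) x)
    (φint : IntegrableOn φ (Icc a b)) (hφg : ∀ x ∈ Ioo a b, φ x ≤ g' x) :
    (∫ y in a..b, φ y) ≤ g b - g a := by
  have hneg : MapsTo (fun s : ℝ => -s) (Icc (-b) (-a)) (Icc a b) := fun s hs =>
    ⟨by linarith [hs.2], by linarith [hs.1]⟩
  have h1 := intervalIntegral.sub_le_integral_of_hasDeriv_right_of_le (a := -b) (b := -a)
    (g := fun s => g (-s)) (g' := fun s => -g' (-s)) (φ := fun s => - φ (-s)) (by linarith)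
    (hcont.comp continuous_neg.continuousOn hneg)
    (fun x hx => hasDerivWithinAt_Ioi_comp_neg (hderiv (-x) ⟨by linarith [hx.2], by linarith [hx.1]⟩))
    ?_ (fun x hx => by
      have := hφg (-x) ⟨by linarith [hx.2], by linarith [hx.1]⟩
      linarith)
  · simp only [neg_neg, intervalIntegral.integral_neg, intervalIntegral.integral_comp_neg] at h1
    linarith
  · rw [← intervalIntegrable_iff_integrableOn_Icc_of_le (by linarith)]
    rw [← intervalIntegrable_iff_integrableOn_Icc_of_le hab] at φint
    have := (IntervalIntegrable.iff_comp_neg).1 φint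
    exact this.symm.neg

/-- A nonnegative left derivative is integrable. -/
lemma integrableOn_deriv_left_of_nonneg {g g' : ℝ → ℝ} {a b : ℝ} (hab : a ≤ b)
    (hcont : ContinuousOn g (Icc a b))
    (hderiv : ∀ x ∈ Ioo a b, HasDerivWithinAt g (g' x) (Iio x) x)
    (hpos : ∀ x ∈ Ioo a b, 0 ≤ g' x) : IntegrableOn g' (Icc a b) := by
  have hneg : MapsTo (fun s : ℝ => -s) (Icc (-b) (-a)) (Icc a b) := fun s hs =>
    ⟨by linarith [hs.2], by linarith [hs.1]⟩
  have h1 := intervalIntegral.integrableOn_deriv_right_of_nonneg (a := -b) (b := -a)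
    (g := fun s => -g (-s)) (g' := fun s => g' (-s))
    (hcont.comp continuous_neg.continuousOn hneg).neg
    (fun x hx => by
      have hx' : -x ∈ Ioo a b := ⟨by linarith [hx.2], by linarith [hx.1]⟩
      simpa only [neg_neg] using (hasDerivWithinAt_Ioi_comp_neg (hderiv (-x) hx')).fun_neg)
    (fun x hx => hpos (-x) ⟨by linarith [hx.2], by linarith [hx.1]⟩)
  rw [← intervalIntegrable_iff_integrableOn_Icc_of_le hab]
  rw [← intervalIntegrable_iff_integrableOn_Ioc_of_le (by linarith)] at h1
  have := (IntervalIntegrable.iff_comp_neg).1 h1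
  simpa using this.symm

/-- `LD K F F' t`: on `K`, the family `F x` is left differentiable at `t`
with derivative `F' x`, with uniformly bounded difference quotients and values. -/
structure LD {X : Type*} (K : Set X) (F : X → ℝ → ℝ) (F' : X → ℝ) (t : ℝ) : Prop where
  deriv : ∀ x ∈ K, HasDerivWithinAt (F x) (F' x) (Iio t) t
  dom : ∃ B, ∀ᶠ s in 𝓝[<] t, ∀ x ∈ K, |F x s - F x t| ≤ B * (t - s)
  bdd : ∃ B, ∀ x ∈ K, |F x t| ≤ B

variable {X : Type*} {K : Set X} {F G : X → ℝ → ℝ} {F' G' : X → ℝ} {t : ℝ}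

lemma LD.add (hF : LD K F F' t) (hG : LD K G G' t) :
    LD K (fun x s => F x s + G x s) (fun x => F' x + G' x) t := by
  obtain ⟨B1, h1⟩ := hF.dom
  obtain ⟨B2, h2⟩ := hG.dom
  obtain ⟨C1, c1⟩ := hF.bdd
  obtain ⟨C2, c2⟩ := hG.bdd
  refine ⟨fun x hx => (hF.deriv x hx).add (hG.deriv x hx), ⟨B1 + B2, ?_⟩, ⟨C1 + C2, fun x hx =>
    (abs_add_le _ _).trans (add_le_add (c1 x hx) (c2 x hx))⟩⟩
  filter_upwards [h1, h2] with s a b x hx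
  rw [show F x s + G x s - (F x t + G x t) = (F x s - F x t) + (G x s - G x t) by ring, add_mul]
  exact (abs_add_le _ _).trans (add_le_add (a x hx) (b x hx))

lemma LD.mul (hF : LD K F F' t) (hG : LD K G G' t) :
    LD K (fun x s => F x s * G x s) (fun x => F' x * G x t + F x t * G' x) t := by
  obtain ⟨B1, h1⟩ := hF.dom
  obtain ⟨B2, h2⟩ := hG.dom
  obtain ⟨C1, c1⟩ := hF.bdd
  obtain ⟨C2, c2⟩ := hG.bdd
  refine ⟨fun x hx => (hF.deriv x hx).mul (hG.deriv x hx),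
    ⟨|B1| * (|C2| + |B2|) + |C1| * |B2|, ?_⟩, ⟨|C1| * |C2|, fun x hx => ?_⟩⟩
  · have h3 : ∀ᶠ s in 𝓝[<] t, s ∈ Ioo (t - 1) t := Ioo_mem_nhdsLT (by linarith)
    filter_upwards [h1, h2, h3] with s a b hs x hx
    have hts : 0 < t - s := sub_pos.2 hs.2
    have a' : |F x s - F x t| ≤ |B1| * (t - s) :=
      (a x hx).trans (mul_le_mul_of_nonneg_right (le_abs_self _) hts.le)
    have b' : |G x s - G x t| ≤ |B2| * (t - s) :=
      (b x hx).trans (mul_le_mul_of_nonneg_right (le_abs_self _) hts.le)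
    have c1' : |F x t| ≤ |C1| := (c1 x hx).trans (le_abs_self _)
    have c2' : |G x s| ≤ |C2| + |B2| := by
      have : |G x s| ≤ |G x t| + |G x s - G x t| := by
        simpa using abs_add_le (G x t) (G x s - G x t)
      have h5 : |B2| * (t - s) ≤ |B2| := by
        nlinarith [abs_nonneg B2, hs.1]
      linarith [(c2 x hx).trans (le_abs_self _)]
    rw [show F x s * G x s - F x t * G x t =
      (F x s - F x t) * G x s + F x t * (G x s - G x t) by ring]
    refine (abs_add_le _ _).trans ?_
    rw [abs_mul, abs_mul]
    have e1 : |F x s - F x t| * |G x s| ≤ (|B1| * (t - s)) * (|C2| + |B2|) := by gcongr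
    have e2 : |F x t| * |G x s - G x t| ≤ |C1| * (|B2| * (t - s)) := by gcongr
    linarith
  · rw [abs_mul]
    have := (c1 x hx).trans (le_abs_self _)
    have := (c2 x hx).trans (le_abs_self _)
    gcongr

lemma LD.of_const {c : X → ℝ} (hc : ∃ B, ∀ x ∈ K, |c x| ≤ B) :
    LD K (fun x _ => c x) (fun _ => 0) t :=
  ⟨fun x _ => hasDerivWithinAt_const _ _ _, ⟨0, by simp⟩, hc⟩

lemma LD.const_mul {c : X → ℝ} (hc : ∃ B, ∀ x ∈ K, |c x| ≤ B) (hF : LD K F F' t) :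
    LD K (fun x s => c x * F x s) (fun x => c x * F' x) t := by
  simpa using (LD.of_const (t := t) hc).mul hF

lemma LD.sum {ι : Type*} {S : Finset ι} {F : ι → X → ℝ → ℝ} {F' : ι → X → ℝ}
    (h : ∀ i ∈ S, LD K (F i) (F' i) t) :
    LD K (fun x s => ∑ i ∈ S, F i x s) (fun x => ∑ i ∈ S, F' i x) t := by
  classical
  induction S using Finset.induction_on with
  | empty => simpa using LD.of_const (K := K) (t := t) (c := fun _ => 0) ⟨0, by simp⟩
  | insert a S ha ih =>
    simp only [Finset.sum_insert ha]
    exact (h a (by simp)).add (ih fun i hi => h i (by simp [hi]))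

lemma LD.mono {K' : Set X} (h : LD K F F' t) (hK : K' ⊆ K) : LD K' F F' t := by
  obtain ⟨B, hB⟩ := h.dom
  obtain ⟨C, hC⟩ := h.bdd
  exact ⟨fun x hx => h.deriv x (hK hx), ⟨B, hB.mono fun s hs x hx => hs x (hK hx)⟩,
    ⟨C, fun x hx => hC x (hK hx)⟩⟩

/-- Criterion by a bounded derivative. -/
lemma LD.of_deriv_bound {F' : X → ℝ → ℝ} {δ B : ℝ} (hδ : 0 < δ)
    (hd : ∀ x ∈ K, ∀ s ∈ Icc (t - δ) t, HasDerivWithinAt (F x) (F' x s) (Icc (t - δ) t) s)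
    (hB : ∀ x ∈ K, ∀ s ∈ Icc (t - δ) t, |F' x s| ≤ B) (hb : ∃ C, ∀ x ∈ K, |F x t| ≤ C) :
    LD K F (fun x => F' x t) t := by
  refine ⟨fun x hx => ?_, ⟨B, ?_⟩, hb⟩
  · exact (hd x hx t ⟨by linarith, le_rfl⟩).mono_of_mem_nhdsWithin
      (mem_of_superset (Ioo_mem_nhdsLT (by linarith : t - δ < t)) Ioo_subset_Icc_self)
  · filter_upwards [Ioo_mem_nhdsLT (by linarith : t - δ < t)] with s hs x hx
    have := (convex_Icc (t - δ) t).norm_image_sub_le_of_norm_hasDerivWithin_le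
      (hd x hx) (hB x hx) ⟨by linarith, le_rfl⟩ (Ioo_subset_Icc_self hs)
    rwa [Real.norm_eq_abs, Real.norm_eq_abs, abs_of_nonpos (by linarith [hs.2] : s - t ≤ 0),
      neg_sub] at this

/-- Differentiation from the left under the integral sign. -/
lemma LD.hasDerivWithinAt_integral [MeasurableSpace X] {μ : Measure X}
    (h : LD K F F' t) (hK : MeasurableSet K) (hKμ : μ K ≠ ⊤)
    (hsupp : ∀ s, ∀ x ∉ K, F x s = 0) (hsupp' : ∀ x ∉ K, F' x = 0)
    (hint : ∀ᶠ s in 𝓝[<] t, Integrable (fun x => F x s) μ) (hint' : Integrable (fun x => F x t) μ) :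
    HasDerivWithinAt (fun s => ∫ x, F x s ∂μ) (∫ x, F' x ∂μ) (Iio t) t := by
  obtain ⟨B, hB⟩ := h.dom
  rw [hasDerivWithinAt_iff_tendsto_slope' (by simp)]
  have key : Tendsto (fun s => ∫ x, slope (F x) t s ∂μ) (𝓝[<] t) (𝓝 (∫ x, F' x ∂μ)) := by
    refine tendsto_integral_filter_of_dominated_convergence (K.indicator fun _ => B) ?_ ?_ ?_ ?_
    · filter_upwards [hint] with s hs
      simp only [slope_def_field]
      exact ((hs.sub hint').div_const _).aestronglyMeasurable
    · filter_upwards [hB, self_mem_nhdsWithin] with s hs hst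
      have hst' : 0 < t - s := sub_pos.2 hst
      refine ae_of_all _ fun x => ?_
      by_cases hx : x ∈ K
      · rw [indicator_of_mem hx, slope_def_field, norm_div, Real.norm_eq_abs, Real.norm_eq_abs,
          abs_sub_comm s t, abs_of_pos hst', div_le_iff₀ hst']
        exact hs x hx
      · simp [slope_def_field, hsupp _ x hx, hx]
    · exact (integrable_indicator_iff hK).2 (integrableOn_const hKμ)
    · refine ae_of_all _ fun x => ?_
      by_cases hx : x ∈ K
      · exact (hasDerivWithinAt_iff_tendsto_slope' (by simp)).1 (h.deriv x hx)
      · simp [slope_def_field, hsupp _ x hx, hsupp' x hx]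
  refine key.congr' ?_
  filter_upwards [hint] with s hs
  simp only [slope_def_field]
  rw [integral_div, integral_sub hs hint']

/-- The left derivative of an integrable family dominated on a set of finite measure is
integrable. -/
lemma LD.integrable_deriv [MeasurableSpace X] {μ : Measure X}
    (h : LD K F F' t) (hK : MeasurableSet K) (hKμ : μ K ≠ ⊤)
    (hsupp' : ∀ x ∉ K, F' x = 0) (hsupp : ∀ s, ∀ x ∉ K, F x s = 0)
    (hint : ∀ᶠ s in 𝓝[<] t, Integrable (fun x => F x s) μ) (hint' : Integrable (fun x => F x t) μ) :
    Integrable F' μ := by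
  obtain ⟨B, hB⟩ := h.dom
  have hlim : ∀ x, Tendsto (fun s => slope (F x) t s) (𝓝[<] t) (𝓝 (F' x)) := fun x => by
    by_cases hx : x ∈ K
    · exact (hasDerivWithinAt_iff_tendsto_slope' (by simp)).1 (h.deriv x hx)
    · simp [slope_def_field, hsupp _ x hx, hsupp' x hx]
  obtain ⟨v, hv⟩ := exists_seq_tendsto (𝓝[<] t)
  obtain ⟨N, hN⟩ := eventually_atTop.1 (hv.eventually hint)
  have hv' : Tendsto (fun n => v (n + N)) atTop (𝓝[<] t) := (tendsto_add_atTop_iff_nat N).2 hv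
  have hm : AEStronglyMeasurable F' μ := by
    refine aestronglyMeasurable_of_tendsto_ae atTop (f := fun n x => slope (F x) t (v (n + N)))
      (fun n => ?_) (ae_of_all _ fun x => (hlim x).comp hv')
    simp only [slope_def_field]
    exact (((hN (n + N) (by omega)).sub hint').div_const _).aestronglyMeasurable
  refine Integrable.mono' (g := K.indicator fun _ => B)
    ((integrable_indicator_iff hK).2 (integrableOn_const hKμ)) hm (ae_of_all _ fun x => ?_)
  by_cases hx : x ∈ K
  · rw [indicator_of_mem hx]
    refine le_of_tendsto (hlim x).norm ?_
    filter_upwards [hB, self_mem_nhdsWithin] with s hs hst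
    have hst' : 0 < t - s := sub_pos.2 hst
    rw [slope_def_field, norm_div, Real.norm_eq_abs, Real.norm_eq_abs,
      abs_sub_comm s t, abs_of_pos hst', div_le_iff₀ hst']
    exact hs x hx
  · simp [hsupp' x hx, hx]

/-- A left-differentiable function that increases at the points of a closed set `Y` and across its
gaps is increasing. -/
lemma sub_le_of_gaps {f f' : ℝ → ℝ} {Y : Set ℝ} {s t B : ℝ} (hY : IsClosed Y) (hst : s ≤ t)
    (htY : t ∈ Y) (hf : ContinuousOn f (Icc s t))
    (hd : ∀ τ ∈ Y, τ ∈ Ioc s t → HasDerivWithinAt f (f' τ) (Iio τ) τ ∧ |f' τ| < B)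
    (hgap : ∀ g τ, s ≤ g → g < τ → τ ≤ t → τ ∈ Y → (∀ r ∈ Ioo g τ, r ∉ Y) →
      f g - f τ ≤ B * (τ - g)) : f s - f t ≤ B * (t - s) := by
  set P : ℝ → ℝ := fun r => f r + B * r with hPdef
  have hP : ContinuousOn P (Icc s t) := hf.add (by fun_prop)
  suffices h : P s ≤ P t by simp only [hPdef] at h; linarith
  have hA : IsCompact ((Icc s t ∩ P ⁻¹' Iic (P t)) ∩ Y) :=
    (isCompact_Icc.of_isClosed_subset (hP.preimage_isClosed_of_isClosed isClosed_Icc isClosed_Iic)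
      inter_subset_left).inter_right hY
  obtain ⟨τ, ⟨⟨hτ, hτt⟩, hτY⟩, hmin⟩ :=
    hA.exists_isLeast ⟨t, ⟨right_mem_Icc.2 hst, le_refl (P t)⟩, htY⟩
  rcases hτ.1.eq_or_lt with rfl | hlt
  · exact hτt
  obtain ⟨hder, hB⟩ := hd τ hτY ⟨hlt, hτ.2⟩
  have hder' : HasDerivWithinAt P (f' τ + B * 1) (Iio τ) τ :=
    hder.add ((hasDerivWithinAt_id τ _).const_mul B)
  have hev : ∀ᶠ r in 𝓝[<] τ, P r < P τ := by
    have hpos : 0 < f' τ + B * 1 := by linarith [neg_abs_le (f' τ)]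
    have := ((hasDerivWithinAt_iff_tendsto_slope' (by simp)).1 hder').eventually_const_lt hpos
    filter_upwards [this, self_mem_nhdsWithin] with r hr hrτ
    rw [slope_def_field] at hr
    have h1 : r - τ < 0 := sub_neg.2 hrτ
    by_contra hcon
    exact absurd hr (not_lt.2 (div_nonpos_of_nonneg_of_nonpos (by linarith) h1.le))
  obtain ⟨c, hc, hcs⟩ := (mem_nhdsLT_iff_exists_Ioo_subset).1 hev
  set c' := max c s with hc'
  have hc'τ : c' < τ := max_lt hc hlt
  have hempty : ∀ r ∈ Ioo c' τ, r ∉ Y := fun r hr hrY => by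
    have h1 : P r < P τ := hcs ⟨(le_max_left _ _).trans_lt hr.1, hr.2⟩
    exact absurd (hmin ⟨⟨⟨(le_max_right c s).trans hr.1.le, hr.2.le.trans hτ.2⟩,
      (h1.le.trans hτt : P r ≤ P t)⟩, hrY⟩) (not_le.2 hr.2)
  have key : ∀ g, s ≤ g → g < τ → (∀ r ∈ Ioo g τ, r ∉ Y) → P g ≤ P t := fun g hg hgτ hgY => by
    have := hgap g τ hg hgτ hτ.2 hτY hgY
    have h2 : P g ≤ P τ := by simp only [hPdef]; linarith
    exact h2.trans hτt
  rcases (Icc s c' ∩ Y).eq_empty_or_nonempty with he | hne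
  · refine key s le_rfl hlt fun r hr hrY => ?_
    rcases le_or_gt r c' with h | h
    · exact absurd (show r ∈ Icc s c' ∩ Y from ⟨⟨hr.1.le, h⟩, hrY⟩) (by simp [he])
    · exact hempty r ⟨h, hr.2⟩ hrY
  · obtain ⟨g, ⟨hg, hgY⟩, hmax⟩ := (isCompact_Icc.inter_right hY).exists_isGreatest hne
    have hgτ : g < τ := hg.2.trans_lt hc'τ
    have := key g hg.1 hgτ fun r hr hrY => by
      rcases le_or_gt r c' with h | h
      · exact absurd (hmax ⟨⟨hg.1.trans hr.1.le, h⟩, hrY⟩) (not_le.2 hr.1)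
      · exact hempty r ⟨h, hr.2⟩ hrY
    exact absurd (hmin ⟨⟨⟨hg.1, hgτ.le.trans hτ.2⟩, this⟩, hgY⟩) (not_le.2 hgτ)

end LeftDerivatives

section Truncation

lemma hasDerivAt_max_sq (z : ℝ) : HasDerivAt (fun z : ℝ => max z 0 ^ 2) (2 * max z 0) z := by
  rcases lt_trichotomy z 0 with h | rfl | h
  · have : (fun z : ℝ => max z 0 ^ 2) =ᶠ[𝓝 z] fun _ => 0 := by
      filter_upwards [Iio_mem_nhds h] with y hy
      simp [max_eq_right (le_of_lt (mem_Iio.1 hy))]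
    simpa [max_eq_right h.le] using (hasDerivAt_const z (0 : ℝ)).congr_of_eventuallyEq this
  · rw [hasDerivAt_iff_isLittleO_nhds_zero]
    simp only [zero_add, max_self, mul_zero, smul_zero, sub_zero, ne_eq, OfNat.ofNat_ne_zero,
      not_false_eq_true, zero_pow]
    refine Asymptotics.IsBigO.trans_isLittleO (g := fun z : ℝ => z ^ 2)
      (Asymptotics.IsBigO.of_bound 1 (Eventually.of_forall fun y => ?_)) ?_
    · rw [Real.norm_eq_abs, Real.norm_eq_abs, abs_pow, abs_pow, one_mul]
      gcongr 1
      rw [abs_of_nonneg (le_max_right _ _)]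
      exact max_le (le_abs_self _) (abs_nonneg _)
    · simpa using Asymptotics.isLittleO_pow_pow (𝕜 := ℝ) (one_lt_two)
  · have : (fun z : ℝ => max z 0 ^ 2) =ᶠ[𝓝 z] fun z => z ^ 2 := by
      filter_upwards [Ioi_mem_nhds h] with y hy
      simp [max_eq_left (le_of_lt (mem_Ioi.1 hy))]
    simpa [max_eq_left h.le] using (hasDerivAt_pow 2 z).congr_of_eventuallyEq this

lemma max_cube_eq (z : ℝ) : max z 0 ^ 3 = max z 0 ^ 2 * z := by
  rcases le_total z 0 with h | h
  · simp [max_eq_right h]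
  · rw [max_eq_left h]; ring

lemma hasDerivAt_max_cube (z : ℝ) : HasDerivAt (fun z : ℝ => max z 0 ^ 3) (3 * max z 0 ^ 2) z := by
  simp only [max_cube_eq]
  convert! (hasDerivAt_max_sq z).mul (hasDerivAt_id z) using 1
  rcases le_total z 0 with h | h
  · simp [max_eq_right h]
  · rw [max_eq_left h]; simp; ring

lemma contDiff_max_sq : ContDiff ℝ 1 (fun z : ℝ => max z 0 ^ 2) := by
  rw [contDiff_one_iff_deriv]
  refine ⟨fun z => (hasDerivAt_max_sq z).differentiableAt, ?_⟩
  rw [show deriv (fun z : ℝ => max z 0 ^ 2) = fun z => 2 * max z 0 from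
    funext fun z => (hasDerivAt_max_sq z).deriv]
  fun_prop

variable {d : ℕ}

/-- The basic energy inequality for the positive part of a function with a one-sided bound on
`Δq + h`. -/
lemma integral_max_sq_mul_ge {q h : EuclideanSpace ℝ (Fin d) → ℝ}
    {K : Set (EuclideanSpace ℝ (Fin d))} {M : ℝ} (hq : ContDiff ℝ 2 q) (hK : IsCompact K) (hqK : ∀ x ∉ K, q x ≤ 0)
    (hh : ∀ x, 0 < q x → -slap q x - M * √(gsq q x) ≤ h x)
    (hint : Integrable fun x => 3 * max (q x) 0 ^ 2 * h x) :
    -(3 * M ^ 2 / 8) * ∫ x, max (q x) 0 ^ 3 ≤ ∫ x, 3 * max (q x) 0 ^ 2 * h x := by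
  have dq : Differentiable ℝ q := hq.differentiable (by norm_num)
  have hQ : ContDiff ℝ 1 (fun x => max (q x) 0 ^ 2) := contDiff_max_sq.comp (hq.of_le (by norm_num))
  have hmax : ∀ x ∉ K, max (q x) 0 = 0 := fun x hx => max_eq_right (hqK x hx)
  have hQs : HasCompactSupport (fun x => max (q x) 0 ^ 2) :=
    HasCompactSupport.intro hK fun x hx => by simp [hmax x hx]
  have hpq : ∀ i, ContDiff ℝ 1 (pd i q) := fun i => hq.pd_one
  have hcq := hq.continuous
  have ibp : ∀ i, ∫ x, max (q x) 0 ^ 2 * pd i (pd i q) x = - ∫ x, 2 * max (q x) 0 * pd i q x ^ 2 := by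
    intro i
    rw [integral_mul_pd hQ (hpq i) hQs]
    congr 1
    refine integral_congr_ae (ae_of_all _ fun x => ?_)
    simp only
    rw [pd_comp (hasDerivAt_max_sq _) (dq x)]; ring
  have cs : ∀ {F : EuclideanSpace ℝ (Fin d) → ℝ}, Continuous F → (∀ x ∉ K, F x = 0) → Integrable F :=
    fun hF h0 => hF.integrable_of_hasCompactSupport (HasCompactSupport.intro hK h0)
  have c1 : ∀ i, Continuous (pd i q) := fun i => (hpq i).continuous
  have c2 : ∀ i, Continuous (pd i (pd i q)) := fun i => (hpq i).continuous_pd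
  have cg : Continuous (gsq q) := (hq.of_le (by norm_num)).continuous_gsq
  have csl : Continuous (slap q) := hq.continuous_slap
  have hsl : ∫ x, max (q x) 0 ^ 2 * slap q x = - ∫ x, 2 * max (q x) 0 * gsq q x := by
    simp only [slap_eq_sum_pd, gsq, Finset.mul_sum]
    rw [integral_finsetSum, integral_finsetSum, ← Finset.sum_neg_distrib]
    · exact Finset.sum_congr rfl fun i _ => ibp i
    · exact fun i _ => cs (by have := c1 i; fun_prop) fun x hx => by simp [hmax x hx]
    · exact fun i _ => cs (by have := c2 i; fun_prop) fun x hx => by simp [hmax x hx]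
  have i1 : Integrable fun x => max (q x) 0 ^ 2 * slap q x :=
    cs (by fun_prop) fun x hx => by simp [hmax x hx]
  have i2 : Integrable fun x => 2 * max (q x) 0 * gsq q x :=
    cs (by fun_prop) fun x hx => by simp [hmax x hx]
  have i3 : Integrable fun x => max (q x) 0 ^ 3 :=
    cs (by fun_prop) fun x hx => by simp [hmax x hx]
  have hle : ∫ x, (-(3 * M ^ 2 / 8) * max (q x) 0 ^ 3 - 3 * (max (q x) 0 ^ 2 * slap q x)
      - 3 * (2 * max (q x) 0 * gsq q x)) ≤ ∫ x, 3 * max (q x) 0 ^ 2 * h x := by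
    refine integral_mono (((i3.const_mul _).sub (i1.const_mul 3)).sub (i2.const_mul 3)) hint
      fun x => ?_
    simp only
    rcases le_or_gt (q x) 0 with hx | hx
    · simp [max_eq_right hx]
    · rw [max_eq_left hx.le]
      have := hh x hx
      set g := √(gsq q x) with hg
      have hg2 : gsq q x = g ^ 2 := (Real.sq_sqrt gsq_nonneg).symm
      rw [hg2]
      have h3 : 3 * q x ^ 2 * (-slap q x - M * g) ≤ 3 * q x ^ 2 * h x := by gcongr
      nlinarith [mul_nonneg hx.le (sq_nonneg (4 * g - M * q x))]
  have j1 : Integrable fun x => -(3 * M ^ 2 / 8) * max (q x) 0 ^ 3 -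
      3 * (max (q x) 0 ^ 2 * slap q x) := (i3.const_mul _).sub (i1.const_mul 3)
  rw [integral_sub j1 (i2.const_mul 3), integral_sub (i3.const_mul _) (i1.const_mul 3),
    integral_const_mul, integral_const_mul, integral_const_mul, hsl] at hle
  linarith

end Truncation

section Regularity

variable {d : ℕ}

/-- A bounded, compactly supported, separately regular function that solves
`|Δw + ∂ₜw| ≤ M (|w| + |∇w|)` on `V`. -/
structure IsSol (T M U : ℝ) (V : Set (EuclideanSpace ℝ (Fin d)))
    (w w' : EuclideanSpace ℝ (Fin d) → ℝ → ℝ) : Prop where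
  T_pos : 0 < T
  M_pos : 0 < M
  isOpen : IsOpen V
  smooth : ∀ t, ContDiff ℝ 2 (fun x => w x t)
  supp : ∃ S, IsCompact S ∧ ∀ x ∉ S, ∀ t, w x t = 0
  bound : ∀ x t, |w x t| ≤ U
  deriv : ∀ x, ∀ t ∈ Icc 0 T, HasDerivWithinAt (w x) (w' x t) (Icc 0 T) t
  cont_deriv : ∀ x, ContinuousOn (w' x) (Icc 0 T)
  cont : ∀ x, Continuous (w x)
  pde : ∀ x ∈ V, ∀ t ∈ Icc 0 T, |slap (fun y => w y t) x + w' x t| ≤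
    M * (|w x t| + √(gsq (fun y => w y t) x))

variable {T M U : ℝ} {V : Set (EuclideanSpace ℝ (Fin d))}
  {w w' : EuclideanSpace ℝ (Fin d) → ℝ → ℝ}

lemma gsq_neg (f : EuclideanSpace ℝ (Fin d) → ℝ) (x) : gsq (fun y => - f y) x = gsq f x := by
  have : ∀ i, pd i (fun y => - f y) x = - pd i f x := fun i => by
    simp [pd, fderiv_fun_neg]
  simp [gsq, this]

lemma slap_neg (f : EuclideanSpace ℝ (Fin d) → ℝ) (x) : slap (fun y => - f y) x = - slap f x := by
  have h1 : ∀ i, ∀ g : EuclideanSpace ℝ (Fin d) → ℝ, pd i (fun y => - g y) = fun x => - pd i g x :=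
    fun i g => funext fun x => by simp [pd, fderiv_fun_neg]
  simp [slap_eq_sum_pd, h1]

lemma IsSol.neg (h : IsSol T M U V w w') :
    IsSol T M U V (fun x t => - w x t) (fun x t => - w' x t) where
  T_pos := h.T_pos
  M_pos := h.M_pos
  isOpen := h.isOpen
  smooth t := (h.smooth t).neg
  supp := by
    obtain ⟨S, hS, h0⟩ := h.supp
    exact ⟨S, hS, fun x hx t => by simp [h0 x hx t]⟩
  bound x t := by simpa using h.bound x t
  deriv x t ht := (h.deriv x t ht).neg
  cont_deriv x := (h.cont_deriv x).neg
  cont x := (h.cont x).neg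
  pde x hx t ht := by
    rw [slap_neg, gsq_neg, abs_neg, ← abs_neg]
    simpa [add_comm] using h.pde x hx t ht

lemma IsSol.U_nonneg (h : IsSol T M U V w w') : 0 ≤ U :=
  (abs_nonneg _).trans (h.bound 0 0)

lemma IsSol.hasDerivWithinAt_left (h : IsSol T M U V w w') (x) {t : ℝ} (ht : t ∈ Ioc 0 T) :
    HasDerivWithinAt (w x) (w' x t) (Iio t) t :=
  (h.deriv x t ⟨ht.1.le, ht.2⟩).mono_of_mem_nhdsWithin
    (mem_of_superset (Ioo_mem_nhdsLT ht.1) fun _ hs => ⟨hs.1.le, hs.2.le.trans ht.2⟩)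

/-- Uniform left Lipschitz continuity at time `t` on `K`. -/
def LeftLip (w : EuclideanSpace ℝ (Fin d) → ℝ → ℝ) (K : Set (EuclideanSpace ℝ (Fin d)))
    (t : ℝ) : Prop :=
  ∃ B, ∀ᶠ s in 𝓝[<] t, ∀ x ∈ K, |w x s - w x t| ≤ B * (t - s)

lemma IsSol.ld (h : IsSol T M U V w w') {K : Set (EuclideanSpace ℝ (Fin d))} {t : ℝ}
    (ht : t ∈ Ioc 0 T) (hK : LeftLip w K t) : LD K w (fun x => w' x t) t :=
  ⟨fun x _ => h.hasDerivWithinAt_left x ht, hK, ⟨U, fun x _ => h.bound x t⟩⟩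

/-- Admissible comparison functions `ψ - B t`. -/
structure Adm (w : EuclideanSpace ℝ (Fin d) → ℝ → ℝ) (V : Set (EuclideanSpace ℝ (Fin d)))
    (M U : ℝ) (ψ : EuclideanSpace ℝ (Fin d) → ℝ) (B t₁ : ℝ)
    (K : Set (EuclideanSpace ℝ (Fin d))) : Prop where
  isCompact : IsCompact K
  subset : K ⊆ V
  smooth : ContDiff ℝ 2 ψ
  nonpos : ∀ x ∉ K, ∀ t ∈ Icc 0 t₁, w x t - ψ x + B * t ≤ 0
  bound : ∀ x ∈ K, |slap ψ x| + M * (U + √(gsq ψ x)) ≤ B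

lemma Adm.mono {ψ B t₁ t₂ K} (h : Adm w V M U ψ B t₁ K) (ht : t₂ ≤ t₁) : Adm w V M U ψ B t₂ K :=
  ⟨h.isCompact, h.subset, h.smooth, fun x hx t ht' => h.nonpos x hx t ⟨ht'.1, ht'.2.trans ht⟩,
    h.bound⟩

/-- The entropy used in the comparison argument. -/
noncomputable def ent (w : EuclideanSpace ℝ (Fin d) → ℝ → ℝ) (ψ : EuclideanSpace ℝ (Fin d) → ℝ)
    (B t : ℝ) : ℝ := ∫ x, max (w x t - ψ x + B * t) 0 ^ 3

lemma Adm.integrable_cube (h : IsSol T M U V w w') {ψ B t₁ K} (ha : Adm w V M U ψ B t₁ K) {t : ℝ}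
    (ht : t ∈ Icc 0 t₁) : Integrable fun x => max (w x t - ψ x + B * t) 0 ^ 3 := by
  have h1 := (h.smooth t).continuous
  have h2 := ha.smooth.continuous
  refine Continuous.integrable_of_hasCompactSupport (by fun_prop)
    (HasCompactSupport.intro ha.isCompact fun x hx => ?_)
  simp [ha.nonpos x hx t ht]

lemma Adm.continuousOn_ent (h : IsSol T M U V w w') {ψ B t₁ K} (ha : Adm w V M U ψ B t₁ K) :
    ContinuousOn (ent w ψ B) (Icc 0 t₁) := by
  obtain ⟨C, hC⟩ := ha.isCompact.exists_bound_of_continuousOn ha.smooth.continuous.continuousOn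
  intro t ht
  refine continuousWithinAt_of_dominated
    (bound := K.indicator fun _ => (U + C + |B| * t₁) ^ 3) ?_ ?_ ?_ ?_
  · filter_upwards [self_mem_nhdsWithin] with s hs
    exact (ha.integrable_cube h hs).aestronglyMeasurable
  · filter_upwards [self_mem_nhdsWithin] with s hs
    refine ae_of_all _ fun x => ?_
    by_cases hx : x ∈ K
    · rw [indicator_of_mem hx, norm_pow, Real.norm_eq_abs, abs_of_nonneg (le_max_right _ _)]
      gcongr 1
      have h1 := (abs_le.1 (h.bound x s)).2
      have h2 := (abs_le.1 (hC x hx)).1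
      have h3 : B * s ≤ |B| * t₁ := by
        have := mul_le_mul (le_abs_self B) hs.2 hs.1 (abs_nonneg B)
        linarith
      have h4 := h.U_nonneg
      have h5 := (norm_nonneg _).trans (hC x hx)
      have h6 : 0 ≤ |B| * t₁ := mul_nonneg (abs_nonneg _) (hs.1.trans hs.2)
      exact max_le (by linarith) (by linarith)
    · simp [ha.nonpos x hx s hs, hx]
  · exact (integrable_indicator_iff ha.isCompact.measurableSet).2
      (integrableOn_const ha.isCompact.measure_lt_top.ne)
  · refine ae_of_all _ fun x => ?_
    have := h.cont x
    exact Continuous.continuousWithinAt (by fun_prop)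

lemma abs_max_cube_sub_le {a b R : ℝ} (ha : a ≤ R) (hb : b ≤ R) (hR : 0 ≤ R) :
    |max a 0 ^ 3 - max b 0 ^ 3| ≤ 3 * R ^ 2 * |a - b| := by
  have h0 : |max a 0 - max b 0| ≤ |a - b| := abs_max_sub_max_le_abs a b 0
  have ha0 : 0 ≤ max a 0 := le_max_right _ _
  have hb0 : 0 ≤ max b 0 := le_max_right _ _
  have ha1 : max a 0 ≤ R := max_le ha hR
  have hb1 : max b 0 ≤ R := max_le hb hR
  rw [show max a 0 ^ 3 - max b 0 ^ 3 =
    (max a 0 ^ 2 + max a 0 * max b 0 + max b 0 ^ 2) * (max a 0 - max b 0) by ring, abs_mul,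
    abs_of_nonneg (by positivity)]
  have : max a 0 ^ 2 + max a 0 * max b 0 + max b 0 ^ 2 ≤ 3 * R ^ 2 := by
    have e1 : max a 0 ^ 2 ≤ R ^ 2 := by gcongr
    have e2 : max b 0 ^ 2 ≤ R ^ 2 := by gcongr
    have e3 : max a 0 * max b 0 ≤ R * R := by gcongr
    linarith
  gcongr

/-- The left derivative of the entropy. -/
lemma Adm.ent_deriv (h : IsSol T M U V w w') {ψ B t₁ K} (ha : Adm w V M U ψ B t₁ K) {t : ℝ}
    (ht : t ∈ Ioc 0 t₁) (ht₁ : t₁ ≤ T) (hK : LeftLip w K t) :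
    ∃ m, HasDerivWithinAt (ent w ψ B) m (Iio t) t ∧ -(3 * M ^ 2 / 8) * ent w ψ B t ≤ m := by
  have htT : t ∈ Ioc 0 T := ⟨ht.1, ht.2.trans ht₁⟩
  obtain ⟨C, hC⟩ := ha.isCompact.exists_bound_of_continuousOn ha.smooth.continuous.continuousOn
  set q : EuclideanSpace ℝ (Fin d) → ℝ := fun x => w x t - ψ x + B * t with hq
  have hev : ∀ᶠ s in 𝓝[<] t, s ∈ Ioo 0 t := Ioo_mem_nhdsLT ht.1
  -- the entropy density, cut off at times outside `[0, t]`
  set F : EuclideanSpace ℝ (Fin d) → ℝ → ℝ := fun x s =>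
    K.indicator (fun x => max (w x s - ψ x + B * s) 0 ^ 3) x with hF
  set F' : EuclideanSpace ℝ (Fin d) → ℝ := fun x =>
    3 * max (q x) 0 ^ 2 * (w' x t + B) with hF'
  have hFe : ∀ s ∈ Icc 0 t, ∀ x, F x s = max (w x s - ψ x + B * s) 0 ^ 3 := fun s hs x => by
    by_cases hx : x ∈ K
    · simp [hF, hx]
    · simp [hF, hx, ha.nonpos x hx s ⟨hs.1, hs.2.trans ht.2⟩]
  have hqK : ∀ x ∉ K, q x ≤ 0 := fun x hx => ha.nonpos x hx t ⟨ht.1.le, ht.2⟩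
  have hLD : LD K F F' t := by
    obtain ⟨B₁, hB₁⟩ := hK
    set R := U + C + |B| * t with hR
    have hb : ∀ x ∈ K, ∀ s ∈ Icc 0 t, w x s - ψ x + B * s ≤ R := fun x hx s hs => by
      have h1 := (abs_le.1 (h.bound x s)).2
      have h2 := (abs_le.1 (hC x hx)).1
      have := mul_le_mul (le_abs_self B) hs.2 hs.1 (abs_nonneg B)
      linarith
    have hR0 : ∀ x ∈ K, 0 ≤ R := fun x hx => by
      have h4 := h.U_nonneg
      have h5 := (norm_nonneg _).trans (hC x hx)
      have h6 : 0 ≤ |B| * t := mul_nonneg (abs_nonneg _) ht.1.le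
      linarith
    refine ⟨fun x hx => ?_, ⟨3 * R ^ 2 * (B₁ + |B|), ?_⟩, ⟨R ^ 3, fun x hx => ?_⟩⟩
    · have h1 : HasDerivWithinAt (fun s => w x s - ψ x + B * s) (w' x t + B) (Iio t) t := by
        have := ((h.hasDerivWithinAt_left x htT).sub_const (ψ x)).fun_add
          ((hasDerivWithinAt_id t (Iio t)).const_mul B)
        simpa using this
      have h2 := (hasDerivAt_max_cube (q x)).comp_hasDerivWithinAt t h1
      simpa [hF, hx, Function.comp_def] using h2
    · filter_upwards [hB₁, hev] with s hs hst x hx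
      have hs' : s ∈ Icc 0 t := ⟨hst.1.le, hst.2.le⟩
      rw [hFe s hs', hFe t ⟨ht.1.le, le_rfl⟩]
      refine (abs_max_cube_sub_le (hb x hx s hs') (hb x hx t ⟨ht.1.le, le_rfl⟩)
        (hR0 x hx)).trans ?_
      rw [mul_assoc (3 * R ^ 2)]
      gcongr
      calc |w x s - ψ x + B * s - (w x t - ψ x + B * t)|
          = |(w x s - w x t) + B * (s - t)| := by ring_nf
        _ ≤ |w x s - w x t| + |B| * |s - t| := by rw [← abs_mul]; exact abs_add_le _ _
        _ ≤ B₁ * (t - s) + |B| * (t - s) := by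
          rw [abs_sub_comm s t, abs_of_pos (sub_pos.2 hst.2)]
          exact add_le_add_left (hs x hx) _
        _ = _ := by ring
    · rw [hFe t ⟨ht.1.le, le_rfl⟩, abs_of_nonneg (by positivity)]
      gcongr
      exact max_le (hb x hx t ⟨ht.1.le, le_rfl⟩) (hR0 x hx)
  have hF0 : ∀ s, ∀ x ∉ K, F x s = 0 := fun s x hx => by simp [hF, hx]
  have hF0' : ∀ x ∉ K, F' x = 0 := fun x hx => by simp [hF', hqK x hx]
  have hI : ∀ s ∈ Icc 0 t, Integrable (fun x => F x s) := fun s hs => by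
    simp only [hFe s hs]
    exact ha.integrable_cube h ⟨hs.1, hs.2.trans ht.2⟩
  have hI1 : ∀ᶠ s in 𝓝[<] t, Integrable (fun x => F x s) :=
    hev.mono fun s hs => hI s ⟨hs.1.le, hs.2.le⟩
  have hIt := hI t ⟨ht.1.le, le_rfl⟩
  have hKm := ha.isCompact.measurableSet
  have hKf : volume K ≠ ⊤ := ha.isCompact.measure_lt_top.ne
  have hder := hLD.hasDerivWithinAt_integral hKm hKf hF0 hF0' hI1 hIt
  have hint : Integrable F' := hLD.integrable_deriv hKm hKf hF0' hF0 hI1 hIt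
  refine ⟨_, hder.congr_of_eventuallyEq ?_ ?_, ?_⟩
  · filter_upwards [hev] with s hs
    simp only [ent, hFe s ⟨hs.1.le, hs.2.le⟩]
  · simp only [ent, hFe t ⟨ht.1.le, le_rfl⟩]
  · have hsm := h.smooth t
    have hqs : ContDiff ℝ 2 q := (hsm.sub ha.smooth).add contDiff_const
    refine integral_max_sq_mul_ge hqs ha.isCompact hqK (fun x hx => ?_) hint
    have hxK : x ∈ K := by by_contra hc; exact absurd hx (not_lt.2 (hqK x hc))
    have e0 : (fun y => w y t) = fun y => q y + (ψ y + (-(B * t))) := by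
      funext y; simp only [hq]; ring
    have hψ' : ContDiff ℝ 2 (fun y => ψ y + (-(B * t))) := ha.smooth.add contDiff_const
    have dq : Differentiable ℝ q := hqs.differentiable (by norm_num)
    have dψ : Differentiable ℝ ψ := ha.smooth.differentiable (by norm_num)
    have dψ' : Differentiable ℝ (fun y => ψ y + (-(B * t))) := hψ'.differentiable (by norm_num)
    have e1 : ∀ i, pd i (fun y => ψ y + (-(B * t))) = pd i ψ := fun i => funext fun y => by
      rw [pd_add (dψ y) (differentiableAt_const _), pd_const, add_zero]
    have e2 : slap (fun y => w y t) x = slap q x + slap ψ x := by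
      rw [e0, slap_add hqs hψ']; simp only [slap_eq_sum_pd, e1]
    have e3 : √(gsq (fun y => w y t) x) ≤ √(gsq q x) + √(gsq ψ x) := by
      rw [e0]
      have : ∀ i, pd i (fun y => q y + (ψ y + (-(B * t)))) x = pd i q x + pd i ψ x := fun i => by
        rw [pd_add (dq x) (dψ' x), e1]
      simp only [gsq, this]
      have := norm_add_le (WithLp.toLp 2 (fun i => pd i q x)) (WithLp.toLp 2 (fun i => pd i ψ x))
      simpa [EuclideanSpace.norm_eq] using this
    have hp := (abs_le.1 (h.pde x (ha.subset hxK) t ⟨htT.1.le, htT.2⟩)).1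
    have hb := ha.bound x hxK
    have hM := h.M_pos
    have h7 : M * (|w x t| + √(gsq (fun y => w y t) x)) ≤ M * (U + (√(gsq q x) + √(gsq ψ x))) := by
      gcongr
      exact h.bound x t
    have h8 := le_abs_self (slap ψ x)
    rw [e2] at hp
    linarith

end Regularity

section Baire

variable {d : ℕ} {T M U : ℝ} {V : Set (EuclideanSpace ℝ (Fin d))}
  {w w' : EuclideanSpace ℝ (Fin d) → ℝ → ℝ}

/-- The entropies of all admissible comparison functions are almost increasing within distance `δ`
of the time `t`. -/
def GoodAt (w : EuclideanSpace ℝ (Fin d) → ℝ → ℝ) (V : Set (EuclideanSpace ℝ (Fin d)))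
    (T M U δ t : ℝ) : Prop :=
  ∀ ψ B t₁ K, Adm w V M U ψ B t₁ K → t₁ ∈ Ioo (t - δ) (t + δ) → t₁ ≤ T →
    ∀ s, 0 ≤ s → t - δ < s → s ≤ t₁ →
      ent w ψ B s * exp (3 * M ^ 2 / 8 * s) ≤ ent w ψ B t₁ * exp (3 * M ^ 2 / 8 * t₁)

lemma GoodAt.mono {δ δ' t t' : ℝ} (h : GoodAt w V T M U δ t) (ht : |t' - t| + δ' ≤ δ) :
    GoodAt w V T M U δ' t' := by
  have := abs_le.1 (le_refl |t' - t|)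
  exact fun ψ B t₁ K ha ht₁ hT s h0 hs hst =>
    h ψ B t₁ K ha ⟨by linarith [ht₁.1], by linarith [ht₁.2]⟩ hT s h0 (by linarith) hst

lemma Adm.ent_le (h : IsSol T M U V w w') {ψ B t₁ K} (ha : Adm w V M U ψ B t₁ K) (ht₁ : t₁ ≤ T)
    {a b : ℝ} (h0 : 0 ≤ a) (hab : a ≤ b) (hb : b ≤ t₁)
    (hgood : ∀ t ∈ Ioc a b, (∃ δ > 0, GoodAt w V T M U δ t) ∨ LeftLip w K t) :
    ent w ψ B a * exp (3 * M ^ 2 / 8 * a) ≤ ent w ψ B b * exp (3 * M ^ 2 / 8 * b) := by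
  set C := 3 * M ^ 2 / 8 with hC
  suffices hε : ∀ ε > 0, ent w ψ B a * exp (C * a) + ε * a ≤ ent w ψ B b * exp (C * b) + ε * b by
    refine le_of_forall_pos_le_add fun ε hε' => ?_
    have h1 := hε (ε / (b - a + 1)) (div_pos hε' (by linarith))
    have h2 : ε / (b - a + 1) * (b - a) ≤ ε := by
      rw [div_mul_eq_mul_div, div_le_iff₀ (by linarith)]
      nlinarith
    linarith
  intro ε hε
  refine le_of_forall_exists_left (P := fun s => ent w ψ B s * exp (C * s) + ε * s) hab ?_
    fun t ht => ?_
  · have := (ha.continuousOn_ent h).mono (Icc_subset_Icc h0 hb)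
    fun_prop
  · have ht0 : 0 < t := h0.trans_lt ht.1
    rcases hgood t ht with ⟨δ, hδ, hg⟩ | hl
    · refine ⟨max a (t - δ / 2), ⟨le_max_left _ _, max_lt ht.1 (by linarith)⟩, ?_⟩
      have h1 : max a (t - δ / 2) ≤ t := max_le ht.1.le (by linarith)
      have := hg ψ B t K (ha.mono (ht.2.trans hb)) ⟨by linarith, by linarith⟩
        ((ht.2.trans hb).trans ht₁) (max a (t - δ / 2)) (h0.trans (le_max_left _ _))
        ((by linarith : t - δ < t - δ / 2).trans_le (le_max_right _ _)) h1
      have h2 : ε * max a (t - δ / 2) ≤ ε * t := by gcongr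
      linarith
    · obtain ⟨m, hm, hle⟩ := ha.ent_deriv h ⟨ht0, ht.2.trans hb⟩ ht₁ hl
      have he : HasDerivWithinAt (fun s => exp (C * s)) (exp (C * t) * C) (Iio t) t := by
        have := ((hasDerivAt_id t).const_mul C).exp
        simpa using this.hasDerivWithinAt
      have hd := (hm.fun_mul he).fun_add ((hasDerivWithinAt_id t (Iio t)).const_mul ε)
      have hpos : 0 < m * exp (C * t) + ent w ψ B t * (exp (C * t) * C) + ε * 1 := by
        have : 0 ≤ (m + C * ent w ψ B t) * exp (C * t) :=
          mul_nonneg (by rw [← hC] at hle; linarith) (exp_pos _).le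
        nlinarith
      have hev := ((hasDerivWithinAt_iff_tendsto_slope' (by simp)).1 hd).eventually_const_lt hpos
      obtain ⟨s, hs, hst⟩ := (hev.and (Ioo_mem_nhdsLT ht.1)).exists
      refine ⟨s, ⟨hst.1.le, hst.2⟩, ?_⟩
      rw [slope_def_field] at hs
      by_contra hcon
      rw [not_le] at hcon
      refine absurd hs (not_lt.2 (div_nonpos_of_nonneg_of_nonpos ?_ (by linarith [hst.2])))
      simp only [id] at hcon ⊢
      linarith

lemma pd_le_of_lipschitz {f : EuclideanSpace ℝ (Fin d) → ℝ} {k : ℝ} (hk : 0 ≤ k)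
    (hf : ∀ x y, |f x - f y| ≤ k * ‖x - y‖) (x) : √(gsq f x) ≤ k := by
  rw [gsq_eq_norm_gradient_sq, Real.sqrt_sq (norm_nonneg _), gradient, LinearIsometryEquiv.norm_map]
  exact norm_fderiv_le_of_lip' ℝ hk (Eventually.of_forall fun y => hf y x)

/-- The constant in the comparison lemma. -/
noncomputable def gapConst (d : ℕ) (M U k ρ : ℝ) : ℝ :=
  (k + M * (U + k) + 2 * d * (2 * U / ρ ^ 2)) + M * (U + (k + 2 * (2 * U / ρ ^ 2) * ρ))

/-- Comparison across an interval of good times. -/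
lemma IsSol.sub_le_of_good (h : IsSol T M U V w w') {g τ k ρ : ℝ} {x₀ : EuclideanSpace ℝ (Fin d)}
    (hg : 0 ≤ g) (hgτ : g < τ) (hτ : τ ≤ T) (hρ : 0 < ρ) (hV : closedBall x₀ ρ ⊆ V) (hk : 0 ≤ k)
    (hk1 : ∀ x ∈ V, |w' x τ| ≤ k) (hk2 : ∀ x y, |w x τ - w y τ| ≤ k * ‖x - y‖)
    (hgood : ∀ t ∈ Ioo g τ, ∃ δ > 0, GoodAt w V T M U δ t) :
    ∀ r ∈ Icc g τ, w x₀ r - w x₀ τ ≤ gapConst d M U k ρ * (τ - r) := by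
  set A := 2 * U / ρ ^ 2 with hA
  set B := gapConst d M U k ρ with hB
  have hU := h.U_nonneg
  have hM := h.M_pos
  have hA0 : 0 ≤ A := by positivity
  have hgp : ∀ x, √(gsq (fun y => w y τ) x) ≤ k := pd_le_of_lipschitz hk hk2
  have hB0 : 0 ≤ B := by rw [hB, gapConst]; positivity
  have hτ0 : 0 ≤ τ := hg.trans hgτ.le
  have hwτ := h.smooth τ
  have hφ : ContDiff ℝ 2 (fun y => ‖y - x₀‖ ^ 2) := contDiff_norm_sub_sq x₀
  have hAφ : ContDiff ℝ 2 (fun y => A * ‖y - x₀‖ ^ 2 + B * τ) :=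
    (contDiff_const.mul hφ).add contDiff_const
  set ψ : EuclideanSpace ℝ (Fin d) → ℝ := fun y => w y τ + (A * ‖y - x₀‖ ^ 2 + B * τ) with hψ
  have ha : Adm w V M U ψ B τ (closedBall x₀ ρ) := by
    refine ⟨isCompact_closedBall _ _, hV, hwτ.add hAφ, fun x hx t ht => ?_, fun x hx => ?_⟩
    · have h1 := (abs_le.1 (h.bound x t)).2
      have h2 := (abs_le.1 (h.bound x τ)).1
      have h3 : ρ < ‖x - x₀‖ := by simpa [dist_eq_norm] using hx
      have h4 : 2 * U ≤ A * ‖x - x₀‖ ^ 2 := by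
        calc 2 * U = A * ρ ^ 2 := by rw [hA]; field_simp
          _ ≤ _ := by gcongr
      have h5 : B * t ≤ B * τ := mul_le_mul_of_nonneg_left ht.2 hB0
      simp only [hψ]; linarith
    · have hx' : ‖x - x₀‖ ≤ ρ := by simpa [dist_eq_norm] using hx
      have dφ : Differentiable ℝ (fun y => ‖y - x₀‖ ^ 2) := hφ.differentiable (by norm_num)
      have dw : Differentiable ℝ (fun y => w y τ) := hwτ.differentiable (by norm_num)
      have dAφ : Differentiable ℝ (fun y => A * ‖y - x₀‖ ^ 2 + B * τ) :=
        hAφ.differentiable (by norm_num)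
      have e1 : slap ψ x = slap (fun y => w y τ) x + A * (2 * d) := by
        rw [hψ, slap_add hwτ hAφ, slap_add (contDiff_const.mul hφ) contDiff_const,
          slap_const_mul _ hφ, slap_norm_sub_sq]
        simp [slap]
      have e2 : √(gsq ψ x) ≤ k + 2 * A * ρ := by
        have e3 : ∀ i, pd i ψ x = pd i (fun y => w y τ) x + A * (2 * (x i - x₀ i)) := fun i => by
          rw [hψ, pd_add (dw x) (dAφ x), pd_add ((dφ x).const_mul A) (differentiableAt_const _),
            pd_const_mul A (dφ x), pd_norm_sub_sq, pd_const, add_zero]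
        have e4 := norm_add_le (WithLp.toLp 2 (fun i => pd i (fun y => w y τ) x))
          ((2 * A) • (x - x₀))
        rw [norm_smul, Real.norm_eq_abs, abs_of_nonneg (by positivity)] at e4
        have e5 : √(gsq ψ x) = ‖WithLp.toLp 2 (fun i => pd i (fun y => w y τ) x) +
            (2 * A) • (x - x₀)‖ := by
          rw [EuclideanSpace.norm_eq]
          congr 1
          refine Finset.sum_congr rfl fun i _ => ?_
          rw [e3]; simp; ring
        have e6 : √(gsq (fun y => w y τ) x) = ‖WithLp.toLp 2 (fun i => pd i (fun y => w y τ) x)‖ := by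
          rw [EuclideanSpace.norm_eq]; simp [gsq]
        rw [e5]
        refine e4.trans ?_
        rw [← e6]
        have := hgp x
        gcongr
      have e7 : |slap (fun y => w y τ) x| ≤ k + M * (U + k) := by
        have h1 := h.pde x (hV hx) τ ⟨hτ0, hτ⟩
        have h2 : M * (|w x τ| + √(gsq (fun y => w y τ) x)) ≤ M * (U + k) := by
          gcongr
          · exact h.bound x τ
          · exact hgp x
        have h3 := hk1 x (hV hx)
        have := abs_sub (slap (fun y => w y τ) x + w' x τ) (w' x τ)
        rw [add_sub_cancel_right] at this
        linarith
      rw [e1, hB, gapConst]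
      have e8 : |slap (fun y => w y τ) x + A * (2 * d)| ≤ (k + M * (U + k)) + A * (2 * d) := by
        refine (abs_add_le _ _).trans ?_
        rw [abs_of_nonneg (by positivity : 0 ≤ A * (2 * d))]
        linarith
      have e9 : M * (U + √(gsq ψ x)) ≤ M * (U + (k + 2 * A * ρ)) := by gcongr
      rw [← hA]
      linarith
  have hent : ent w ψ B τ = 0 := by
    refine integral_eq_zero_of_ae (ae_of_all _ fun x => ?_)
    have : w x τ - ψ x + B * τ ≤ 0 := by
      have : 0 ≤ A * ‖x - x₀‖ ^ 2 := by positivity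
      simp only [hψ]; linarith
    simp [max_eq_right this]
  have hcont := ha.continuousOn_ent h
  have hr : ∀ r ∈ Ioo g τ, w x₀ r - w x₀ τ ≤ B * (τ - r) := by
    intro r hr
    have hr0 : r ∈ Icc 0 τ := ⟨hg.trans hr.1.le, hr.2.le⟩
    have h1 : ∀ᶠ s in 𝓝[<] τ, ent w ψ B r * exp (3 * M ^ 2 / 8 * r) ≤
        ent w ψ B s * exp (3 * M ^ 2 / 8 * s) := by
      filter_upwards [Ioo_mem_nhdsLT hr.2] with s hs
      exact ha.ent_le h hτ hr0.1 hs.1.le hs.2.le fun t ht =>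
        Or.inl (hgood t ⟨hr.1.trans ht.1, ht.2.trans_lt hs.2⟩)
    have h2 : Tendsto (fun s => ent w ψ B s * exp (3 * M ^ 2 / 8 * s)) (𝓝[<] τ) (𝓝 0) := by
      have h3 : ContinuousOn (fun s => ent w ψ B s * exp (3 * M ^ 2 / 8 * s)) (Icc 0 τ) :=
        hcont.mul (by fun_prop)
      have h4 : ContinuousWithinAt _ (Iio τ) τ := (h3 τ ⟨hτ0, le_rfl⟩).mono_of_mem_nhdsWithin
        (mem_of_superset (Ioo_mem_nhdsLT hgτ) fun s hs => ⟨hg.trans hs.1.le, hs.2.le⟩)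
      simpa [ContinuousWithinAt, hent] using h4
    have h5 : ent w ψ B r ≤ 0 := by
      have := ge_of_tendsto h2 h1
      exact nonpos_of_mul_nonpos_left this (exp_pos _)
    have h6 : ∀ x, max (w x r - ψ x + B * r) 0 ^ 3 = 0 := by
      have hint := ha.integrable_cube h hr0
      have h7 : (fun x => max (w x r - ψ x + B * r) 0 ^ 3) =ᵐ[volume] 0 := by
        rw [← integral_eq_zero_iff_of_nonneg (fun x => by positivity) hint]
        exact le_antisymm h5 (integral_nonneg fun x => by positivity)
      have c1 := (h.smooth r).continuous
      have c2 := ha.smooth.continuous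
      have := Continuous.ae_eq_iff_eq volume (f := fun x => max (w x r - ψ x + B * r) 0 ^ 3)
        (g := 0) (by fun_prop) continuous_zero
      exact fun x => congrFun (this.1 h7) x
    have h8 := h6 x₀
    rw [pow_eq_zero_iff (by norm_num)] at h8
    have h9 : w x₀ r - ψ x₀ + B * r ≤ 0 := h8 ▸ le_max_left _ _
    simp only [hψ, sub_self, norm_zero] at h9
    linarith
  intro r hr'
  have hc := h.cont x₀
  have hcl : IsClosed {r | w x₀ r - w x₀ τ ≤ B * (τ - r)} :=
    isClosed_le (by fun_prop) (by fun_prop)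
  have := closure_minimal (s := Ioo g τ) (fun r hr'' => hr r hr'') hcl
  rw [closure_Ioo hgτ.ne] at this
  exact this hr'

/-- Times at which the solution is controlled by `k`. -/
def ctrl (w w' : EuclideanSpace ℝ (Fin d) → ℝ → ℝ) (V : Set (EuclideanSpace ℝ (Fin d)))
    (T k : ℝ) : Set ℝ :=
  {t ∈ Icc 0 T | (∀ x ∈ V, |w' x t| ≤ k) ∧ ∀ x y, |w x t - w y t| ≤ k * ‖x - y‖}

lemma IsSol.isClosed_ctrl (h : IsSol T M U V w w') (k : ℝ) : IsClosed (ctrl w w' V T k) := by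
  have h1 : IsClosed (⋂ x ∈ V, {t ∈ Icc 0 T | |w' x t| ≤ k}) :=
    isClosed_biInter fun x _ =>
      (h.cont_deriv x).abs.preimage_isClosed_of_isClosed isClosed_Icc isClosed_Iic
  have h2 : IsClosed (⋂ x, ⋂ y, {t | |w x t - w y t| ≤ k * ‖x - y‖}) :=
    isClosed_iInter fun x => isClosed_iInter fun y => by
      have := h.cont x
      have := h.cont y
      exact isClosed_le (by fun_prop) (by fun_prop)
  convert (isClosed_Icc.inter h1).inter h2 using 1
  ext t
  simp only [ctrl, mem_ofPred_eq, mem_inter_iff, mem_iInter]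
  exact ⟨fun ⟨a, b, c⟩ => ⟨⟨a, fun x hx => ⟨a, b x hx⟩⟩, c⟩, fun ⟨⟨a, b⟩, c⟩ =>
    ⟨a, fun x hx => (b x hx).2, c⟩⟩

lemma IsSol.exists_mem_ctrl (h : IsSol T M U V w w') {t : ℝ} (ht : t ∈ Icc 0 T) :
    ∃ k : ℕ, t ∈ ctrl w w' V T k := by
  obtain ⟨S, hS, h0⟩ := h.supp
  have hcs : HasCompactSupport (fun x => w x t) := HasCompactSupport.intro hS fun x hx => h0 x hx t
  have hsm := h.smooth t
  obtain ⟨C1, hC1⟩ := (hcs.fderiv (𝕜 := ℝ)).exists_bound_of_continuous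
    (hsm.continuous_fderiv (by norm_num))
  have hsl : HasCompactSupport (slap (fun x => w x t)) := by
    refine HasCompactSupport.intro hcs fun x hx => ?_
    rw [slap_eq_sum_pd]
    exact Finset.sum_eq_zero fun i _ =>
      pd_eq_zero_of_notMem_tsupport fun hh => hx (tsupport_pd_subset hh)
  obtain ⟨C2, hC2⟩ := hsl.exists_bound_of_continuous hsm.continuous_slap
  have hlip : ∀ x y, |w x t - w y t| ≤ C1 * ‖x - y‖ := fun x y => by
    have := Convex.norm_image_sub_le_of_norm_fderiv_le (𝕜 := ℝ) (f := fun x => w x t) (C := C1)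
      (s := univ) (fun x _ => (hsm.differentiable (by norm_num)) x) (fun x _ => hC1 x) convex_univ
      (mem_univ y) (mem_univ x)
    simpa using this
  have hC10 : 0 ≤ C1 := (norm_nonneg _).trans (hC1 0)
  obtain ⟨k, hk⟩ := exists_nat_ge (max C1 (C2 + M * (U + C1)))
  refine ⟨k, ht, fun x hx => ?_, fun x y => (hlip x y).trans ?_⟩
  · have h1 := h.pde x hx t ht
    have hM := h.M_pos
    have h2 : M * (|w x t| + √(gsq (fun y => w y t) x)) ≤ M * (U + C1) := by
      gcongr
      · exact h.bound x t
      · exact pd_le_of_lipschitz hC10 hlip x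
    have h3 := hC2 x
    rw [Real.norm_eq_abs] at h3
    have := abs_sub (slap (fun y => w y t) x + w' x t) (slap (fun y => w y t) x)
    rw [add_sub_cancel_left] at this
    linarith [le_max_right C1 (C2 + M * (U + C1))]
  · have := (le_max_left C1 (C2 + M * (U + C1))).trans hk
    gcongr

/-- Exceptional times. -/
def badTimes (w : EuclideanSpace ℝ (Fin d) → ℝ → ℝ) (V : Set (EuclideanSpace ℝ (Fin d)))
    (T M U : ℝ) : Set ℝ :=
  {t ∈ Icc 0 T | ¬ ∃ δ > 0, GoodAt w V T M U δ t ∧ GoodAt (fun x t => - w x t) V T M U δ t}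

lemma isClosed_badTimes : IsClosed (badTimes w V T M U) := by
  have : IsOpen {t | ∃ δ > 0, GoodAt w V T M U δ t ∧
      GoodAt (fun x t => - w x t) V T M U δ t} := by
    rw [Metric.isOpen_iff]
    rintro t ⟨δ, hδ, h1, h2⟩
    refine ⟨δ / 2, by positivity, fun t' ht' => ⟨δ / 2, by positivity, ?_, ?_⟩⟩
    all_goals
      rw [mem_ball, Real.dist_eq] at ht'
    · exact h1.mono (by linarith)
    · exact h2.mono (by linarith)
  exact (isClosed_Icc (a := (0 : ℝ)) (b := T)).inter this.isClosed_compl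

lemma IsSol.one_sided (h : IsSol T M U V w w') {Y : Set ℝ} (hY : IsClosed Y) {δ c k ρ : ℝ}
    (hk : 0 ≤ k) (hYk : Y ∩ Ioo (c - δ) (c + δ) ⊆ ctrl w w' V T k) (hρ : 0 < ρ)
    (hgood : ∀ t ∈ Icc 0 T, t ∉ Y → ∃ δ > 0, GoodAt w V T M U δ t)
    {x₀ : EuclideanSpace ℝ (Fin d)} (hx₀ : closedBall x₀ ρ ⊆ V) {s t : ℝ} (hs : 0 ≤ s) (hst : s ≤ t)
    (hcs : c - δ < s) (ht : t ∈ Y) (htc : t < c + δ) :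
    w x₀ s - w x₀ t ≤ (max (gapConst d M U k ρ) k + 1) * (t - s) := by
  have htT : t ≤ T := (hYk ⟨ht, by linarith, htc⟩).1.2
  refine sub_le_of_gaps (f' := w' x₀) hY hst ht (h.cont x₀).continuousOn ?_ ?_
  · intro τ hτ hτs
    have hz := hYk ⟨hτ, by linarith [hτs.1], by linarith [hτs.2]⟩
    refine ⟨h.hasDerivWithinAt_left x₀ ⟨hs.trans_lt hτs.1, hz.1.2⟩, ?_⟩
    have h1 := hz.2.1 x₀ (hx₀ (mem_closedBall_self hρ.le))
    have h2 := le_max_right (gapConst d M U k ρ) k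
    linarith
  · intro g τ hg hgτ hτt hτY hgap
    have hz := hYk ⟨hτY, by linarith, by linarith⟩
    have h1 := h.sub_le_of_good (hs.trans hg) hgτ hz.1.2 hρ hx₀ hk hz.2.1 hz.2.2
      (fun r hr => hgood r ⟨by linarith [hr.1], by linarith [hr.2, hz.1.2]⟩ (hgap r hr)) g
      ⟨le_rfl, hgτ.le⟩
    have h2 := le_max_left (gapConst d M U k ρ) k
    nlinarith

lemma exists_closedBall_subset {K : Set (EuclideanSpace ℝ (Fin d))} (hK : IsCompact K)
    (hV : IsOpen V) (hKV : K ⊆ V) : ∃ ρ > 0, ∀ x ∈ K, closedBall x ρ ⊆ V := by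
  obtain ⟨ρ, hρ, h⟩ := hK.exists_cthickening_subset_open hV hKV
  exact ⟨ρ, hρ, fun x hx => (closedBall_subset_cthickening hx ρ).trans h⟩

/-- There are no exceptional times. -/
lemma IsSol.badTimes_eq_empty (h : IsSol T M U V w w') : badTimes w V T M U = ∅ := by
  by_contra hne
  set Y := badTimes w V T M U with hYdef
  have hY : IsClosed Y := isClosed_badTimes
  have : Nonempty Y := (nonempty_iff_ne_empty.2 hne).to_subtype
  have : CompleteSpace Y := hY.completeSpace_coe
  obtain ⟨k, ⟨⟨t₀, ht₀Y⟩, ht₀⟩⟩ := nonempty_interior_of_iUnion_of_closed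
    (f := fun k : ℕ => ((↑) : Y → ℝ) ⁻¹' ctrl w w' V T k)
    (fun k => (h.isClosed_ctrl k).preimage continuous_subtype_val)
    (eq_univ_of_forall fun t => by
      obtain ⟨k, hk⟩ := h.exists_mem_ctrl t.2.1
      exact mem_iUnion.2 ⟨k, hk⟩)
  rw [mem_interior_iff_mem_nhds, Metric.mem_nhds_iff] at ht₀
  obtain ⟨δ, hδ, hball⟩ := ht₀
  have hYk : Y ∩ Ioo (t₀ - δ) (t₀ + δ) ⊆ ctrl w w' V T k := by
    rintro t ⟨htY, ht⟩
    have : (⟨t, htY⟩ : Y) ∈ ball (⟨t₀, ht₀Y⟩ : Y) δ := by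
      rw [mem_ball, Subtype.dist_eq, Real.dist_eq, abs_lt]
      exact ⟨by linarith [ht.1], by linarith [ht.2]⟩
    exact hball this
  have hYk' : Y ∩ Ioo (t₀ - δ) (t₀ + δ) ⊆
      ctrl (fun x t => - w x t) (fun x t => - w' x t) V T k := fun t ht => by
    obtain ⟨h1, h2, h3⟩ := hYk ht
    refine ⟨h1, by simpa using h2, fun x y => ?_⟩
    rw [show - w x t - - w y t = -(w x t - w y t) by ring, abs_neg]
    exact h3 x y
  have hg : ∀ t ∈ Icc 0 T, t ∉ Y → ∃ δ > 0, GoodAt w V T M U δ t ∧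
      GoodAt (fun x t => - w x t) V T M U δ t := fun t ht htY => by
    by_contra hc; exact htY ⟨ht, hc⟩
  have hg1 : ∀ t ∈ Icc 0 T, t ∉ Y → ∃ δ > 0, GoodAt w V T M U δ t := fun t ht htY =>
    let ⟨δ, hδ, h1, _⟩ := hg t ht htY; ⟨δ, hδ, h1⟩
  have hg2 : ∀ t ∈ Icc 0 T, t ∉ Y → ∃ δ > 0, GoodAt (fun x t => - w x t) V T M U δ t :=
    fun t ht htY => let ⟨δ, hδ, _, h1⟩ := hg t ht htY; ⟨δ, hδ, h1⟩
  have hlip : ∀ K, IsCompact K → K ⊆ V → ∀ t ∈ Y, 0 < t → t ∈ Ioo (t₀ - δ) (t₀ + δ) →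
      LeftLip w K t := by
    intro K hK hKV t htY ht0 ht
    obtain ⟨ρ, hρ, hρV⟩ := exists_closedBall_subset hK h.isOpen hKV
    refine ⟨max (gapConst d M U k ρ) k + 1, ?_⟩
    filter_upwards [Ioo_mem_nhdsLT ht0, Ioo_mem_nhdsLT ht.1] with s hs hs' x hx
    have a1 := h.one_sided hY (Nat.cast_nonneg k) hYk hρ hg1 (hρV x hx) hs.1.le hs.2.le hs'.1 htY ht.2
    have a2 := h.neg.one_sided hY (Nat.cast_nonneg k) hYk' hρ hg2 (hρV x hx) hs.1.le hs.2.le hs'.1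
      htY ht.2
    exact abs_le.2 ⟨by linarith, a1⟩
  have hlip' : ∀ K, IsCompact K → K ⊆ V → ∀ t ∈ Y, 0 < t → t ∈ Ioo (t₀ - δ) (t₀ + δ) →
      LeftLip (fun x t => - w x t) K t := by
    intro K hK hKV t htY ht0 ht
    obtain ⟨B, hB⟩ := hlip K hK hKV t htY ht0 ht
    refine ⟨B, hB.mono fun s hs x hx => ?_⟩
    rw [show - w x s - - w x t = -(w x s - w x t) by ring, abs_neg]
    exact hs x hx
  refine ht₀Y.2 ⟨δ, hδ, ?_, ?_⟩
  · intro ψ B t₁ K ha ht₁ ht₁T s hs0 hs hst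
    refine ha.ent_le h ht₁T hs0 hst le_rfl fun t ht => ?_
    by_cases htY : t ∈ Y
    · exact Or.inr (hlip K ha.isCompact ha.subset t htY (hs0.trans_lt ht.1)
        ⟨hs.trans ht.1, ht.2.trans_lt ht₁.2⟩)
    · exact Or.inl (hg1 t ⟨hs0.trans ht.1.le, ht.2.trans ht₁T⟩ htY)
  · intro ψ B t₁ K ha ht₁ ht₁T s hs0 hs hst
    refine ha.ent_le h.neg ht₁T hs0 hst le_rfl fun t ht => ?_
    by_cases htY : t ∈ Y
    · exact Or.inr (hlip' K ha.isCompact ha.subset t htY (hs0.trans_lt ht.1)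
        ⟨hs.trans ht.1, ht.2.trans_lt ht₁.2⟩)
    · exact Or.inl (hg2 t ⟨hs0.trans ht.1.le, ht.2.trans ht₁T⟩ htY)

/-- Solutions are locally uniformly left Lipschitz in time. -/
theorem IsSol.leftLip (h : IsSol T M U V w w') {K : Set (EuclideanSpace ℝ (Fin d))}
    (hK : IsCompact K) (hKV : K ⊆ V) {t : ℝ} (ht : t ∈ Ioc 0 T) : LeftLip w K t := by
  have hg : ∀ t ∈ Icc 0 T, ∃ δ > 0, GoodAt w V T M U δ t ∧
      GoodAt (fun x t => - w x t) V T M U δ t := fun t ht => by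
    by_contra hc
    exact (h.badTimes_eq_empty ▸ (⟨ht, hc⟩ : t ∈ badTimes w V T M U) : t ∈ (∅ : Set ℝ))
  obtain ⟨ρ, hρ, hρV⟩ := exists_closedBall_subset hK h.isOpen hKV
  obtain ⟨k, -, hk1, hk2⟩ := h.exists_mem_ctrl ⟨ht.1.le, ht.2⟩
  have hk0 : (0 : ℝ) ≤ k := Nat.cast_nonneg k
  refine ⟨gapConst d M U k ρ, ?_⟩
  filter_upwards [Ioo_mem_nhdsLT ht.1] with s hs x hx
  have hI : ∀ r ∈ Ioo 0 t, r ∈ Icc 0 T := fun r hr => ⟨hr.1.le, hr.2.le.trans ht.2⟩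
  have a1 := h.sub_le_of_good le_rfl ht.1 ht.2 hρ (hρV x hx) hk0 hk1 hk2
    (fun r hr => let ⟨δ, hδ, h1, _⟩ := hg r (hI r hr); ⟨δ, hδ, h1⟩) s ⟨hs.1.le, hs.2.le⟩
  have a2 := h.neg.sub_le_of_good le_rfl ht.1 ht.2 hρ (hρV x hx) hk0 (by simpa using hk1)
    (fun x y => by
      rw [show - w x t - - w y t = -(w x t - w y t) by ring, abs_neg]; exact hk2 x y)
    (fun r hr => let ⟨δ, hδ, _, h1⟩ := hg r (hI r hr); ⟨δ, hδ, h1⟩) s ⟨hs.1.le, hs.2.le⟩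
  exact abs_le.2 ⟨by linarith, a1⟩

end Baire

section Carleman

variable {d : ℕ} {c : EuclideanSpace ℝ (Fin d)}

/-- The derivative in the direction `x - c`. -/
noncomputable def dr (c : EuclideanSpace ℝ (Fin d)) (f : EuclideanSpace ℝ (Fin d) → ℝ)
    (x : EuclideanSpace ℝ (Fin d)) : ℝ := ∑ i, (x i - c i) * pd i f x

lemma ContDiff.gsq_one {f : EuclideanSpace ℝ (Fin d) → ℝ} (hf : ContDiff ℝ 2 f) :
    ContDiff ℝ 1 (gsq f) :=
  ContDiff.sum fun _ _ => hf.pd_one.pow 2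

lemma ContDiff.dr_one {f : EuclideanSpace ℝ (Fin d) → ℝ} (hf : ContDiff ℝ 2 f) :
    ContDiff ℝ 1 (dr c f) :=
  ContDiff.sum fun i _ => (contDiff_coord c i).mul hf.pd_one

lemma HasCompactSupport.gsq {f : EuclideanSpace ℝ (Fin d) → ℝ} (hf : HasCompactSupport f) :
    HasCompactSupport (gsq f) :=
  HasCompactSupport.intro hf fun _ hx => Finset.sum_eq_zero fun _ _ => by
    rw [pd_eq_zero_of_notMem_tsupport hx]; norm_num

lemma HasCompactSupport.slap {f : EuclideanSpace ℝ (Fin d) → ℝ} (hf : HasCompactSupport f) :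
    HasCompactSupport (slap f) :=
  HasCompactSupport.intro hf fun _ hx => by
    rw [slap_eq_sum_pd]
    exact Finset.sum_eq_zero fun _ _ =>
      pd_eq_zero_of_notMem_tsupport fun h => hx (tsupport_pd_subset h)

variable {p F G H : EuclideanSpace ℝ (Fin d) → ℝ} {s : ℝ}

/-- An integrable function with vanishing integral. -/
def IsNull (f : EuclideanSpace ℝ (Fin d) → ℝ) : Prop := Integrable f ∧ ∫ x, f x = 0

lemma IsNull.add {f g : EuclideanSpace ℝ (Fin d) → ℝ} (hf : IsNull f) (hg : IsNull g) :
    IsNull fun x => f x + g x :=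
  ⟨hf.1.add hg.1, by rw [integral_add hf.1 hg.1, hf.2, hg.2, add_zero]⟩

lemma IsNull.const_mul {f : EuclideanSpace ℝ (Fin d) → ℝ} (hf : IsNull f) (k : ℝ) :
    IsNull fun x => k * f x :=
  ⟨hf.1.const_mul k, by rw [integral_const_mul, hf.2, mul_zero]⟩

lemma IsNull.sum {f : Fin d → EuclideanSpace ℝ (Fin d) → ℝ} (hf : ∀ i, IsNull (f i)) :
    IsNull fun x => ∑ i, f i x :=
  ⟨integrable_finsetSum _ fun i _ => (hf i).1, by
    rw [integral_finsetSum _ fun i _ => (hf i).1]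
    exact Finset.sum_eq_zero fun i _ => (hf i).2⟩

lemma IsNull.integral_le {f g n : EuclideanSpace ℝ (Fin d) → ℝ} (hn : IsNull n)
    (hf : Integrable f) (hg : Integrable g) (h : ∀ x, f x ≤ g x - n x) :
    ∫ x, f x ≤ ∫ x, g x := by
  have := integral_mono hf (hg.sub hn.1) h
  rw [integral_sub' hg hn.1, hn.2, sub_zero] at this
  exact this

lemma isNull_of_pd {f g : EuclideanSpace ℝ (Fin d) → ℝ} (hf : ContDiff ℝ 1 f) (hg : ContDiff ℝ 1 g)
    (hs : HasCompactSupport f) (i : Fin d) : IsNull fun x => f x * pd i g x + pd i f x * g x := by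
  have h1 : Integrable fun x => f x * pd i g x :=
    (hf.continuous.mul hg.continuous_pd).integrable_of_hasCompactSupport hs.mul_right
  have h2 : Integrable fun x => pd i f x * g x :=
    (hf.continuous_pd.mul hg.continuous).integrable_of_hasCompactSupport hs.pd.mul_right
  exact ⟨h1.add h2, by rw [integral_add h1 h2, integral_mul_pd hf hg hs]; ring⟩

/-- Green's formula for the Gaussian weight. -/
lemma isNull_green (hp : ContDiff ℝ 1 p) (hpd : ∀ i x, pd i p x = -((x i - c i) / (2 * s)) * p x)
    (hF : ContDiff ℝ 2 F) (hFs : HasCompactSupport F) (hG : ContDiff ℝ 1 G) :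
    IsNull fun x => p x * (∑ i, pd i F x * pd i G x + G x * (slap F x - dr c F x / (2 * s))) := by
  have h := IsNull.sum fun i => isNull_of_pd (hp.mul hF.pd_one) hG
    (f := fun x => p x * pd i F x) hFs.pd.mul_left i
  convert! h using 1
  funext x
  have e : ∀ i, pd i (fun x => p x * pd i F x) x =
      -((x i - c i) / (2 * s)) * p x * pd i F x + p x * pd i (pd i F) x := fun i => by
    rw [pd_mul (hp.contDiffAt.differentiableAt (by norm_num))
      (hF.pd_one.contDiffAt.differentiableAt (by norm_num)), hpd]
  simp only [e, slap_eq_sum_pd, dr, Finset.sum_div, mul_add, mul_sub, Finset.mul_sum,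
    ← Finset.sum_add_distrib, ← Finset.sum_sub_distrib]
  exact Finset.sum_congr rfl fun i _ => by ring

lemma isNull_radial (hp : ContDiff ℝ 1 p) (hpd : ∀ i x, pd i p x = -((x i - c i) / (2 * s)) * p x)
    (hG : ContDiff ℝ 1 G) (hGs : HasCompactSupport G) :
    IsNull fun x => p x * (dr c G x - (‖x - c‖ ^ 2 / (2 * s) - d) * G x) := by
  have h := IsNull.sum fun i => isNull_of_pd hG (hp.mul (contDiff_coord c i (k := 1)))
    (g := fun x => p x * (x i - c i)) hGs i
  convert! h using 1
  funext x
  have e : ∀ i, pd i (fun x => p x * (x i - c i)) x =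
      -((x i - c i) / (2 * s)) * p x * (x i - c i) + p x := fun i => by
    rw [pd_mul (hp.contDiffAt.differentiableAt (by norm_num))
      ((contDiff_coord c i (k := 1)).contDiffAt.differentiableAt (by norm_num)), hpd, pd_coord]
    simp
  have e2 : ((d : ℝ)) = ∑ _i : Fin d, (1 : ℝ) := by simp
  simp only [e]
  simp only [norm_sub_sq_eq_sum, dr, e2, Finset.sum_div, mul_add, mul_sub, sub_mul,
    Finset.mul_sum, Finset.sum_mul, ← Finset.sum_sub_distrib]
  exact Finset.sum_congr rfl fun i _ => by ring

lemma pd_pd_comm (hF : ContDiff ℝ 2 F) (i j : Fin d) (x : EuclideanSpace ℝ (Fin d)) :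
    pd i (pd j F) x = pd j (pd i F) x := by
  have h : ∀ i j, pd i (pd j F) x = fderiv ℝ (fderiv ℝ F) x (EuclideanSpace.single i 1)
      (EuclideanSpace.single j 1) := fun i j => by
    have h1 : DifferentiableAt ℝ (fderiv ℝ F) x :=
      (hF.fderiv_right (m := 1) (by norm_num)).contDiffAt.differentiableAt (by norm_num)
    have : pd j F = fun y => fderiv ℝ F y (EuclideanSpace.single j 1) := rfl
    rw [this, pd, fderiv_clm_apply h1 (differentiableAt_const _)]
    simp
  rw [h, h]
  exact (hF.contDiffAt.isSymmSndFDerivAt (by simp)) _ _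

lemma sum_pd_mul_pd_dr (hF : ContDiff ℝ 2 F) (x : EuclideanSpace ℝ (Fin d)) :
    ∑ i, pd i F x * pd i (dr c F) x = gsq F x + dr c (gsq F) x / 2 := by
  have h1 : ∀ i, DifferentiableAt ℝ (pd i F) x := fun i =>
    hF.pd_one.contDiffAt.differentiableAt (by norm_num)
  have h2 : ∀ i, DifferentiableAt ℝ (fun y : EuclideanSpace ℝ (Fin d) => y i - c i) x := fun i =>
    (contDiff_coord c i (k := 1)).contDiffAt.differentiableAt (by norm_num)
  have h3 : ∀ i, pd i (dr c F) x = pd i F x + ∑ j, (x j - c j) * pd i (pd j F) x := fun i => by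
    have : dr c F = fun y => ∑ j, (y j - c j) * pd j F y := rfl
    rw [this, pd_sum _ fun j _ => (h2 j).fun_mul (h1 j)]
    simp only [pd_mul (h2 _) (h1 _), pd_coord, Finset.sum_add_distrib]
    simp
  have h4 : ∀ j, pd j (gsq F) x = ∑ i, 2 * (pd i F x * pd j (pd i F) x) := fun j => by
    have : gsq F = fun y => ∑ i, pd i F y * pd i F y := by
      funext y; simp only [gsq, pow_two]
    rw [this, pd_sum _ fun j _ => (h1 j).fun_mul (h1 j)]
    simp only [pd_mul (h1 _) (h1 _)]
    exact Finset.sum_congr rfl fun i _ => by ring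
  have h5 : ∀ i j, pd i (pd j F) x = pd j (pd i F) x := fun i j => pd_pd_comm hF i j x
  rw [dr]
  simp only [h3, h4, mul_add, Finset.sum_add_distrib, gsq, Finset.mul_sum, Finset.sum_div]
  congr 1
  · exact Finset.sum_congr rfl fun i _ => by ring
  · rw [Finset.sum_comm]
    refine Finset.sum_congr rfl fun j _ => Finset.sum_congr rfl fun i _ => ?_
    rw [h5 i j]; ring

/-- The pointwise in time Carleman inequality. -/
lemma carleman_spatial (hp : ContDiff ℝ 1 p)
    (hpd : ∀ i x, pd i p x = -((x i - c i) / (2 * s)) * p x) (hp0 : ∀ x, 0 ≤ p x)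
    (hF : ContDiff ℝ 2 F) (hFs : HasCompactSupport F) (hG : ContDiff ℝ 1 G)
    (hGs : HasCompactSupport G) {α lam b : ℝ} (hs : 0 < s) (hα : 1 ≤ α) (hl : 0 < lam)
    (hls : lam * s ≤ 1) (hb : b = α / 2 * (1 / s - lam)) :
    ∫ x, p x * (α * lam / 4 / s * F x ^ 2 + lam / 4 * gsq F x - (G x + slap F x) ^ 2) ≤
    ∫ x, (p x * ((1 - d / 2 - α) / s + α * lam + ‖x - c‖ ^ 2 / (4 * s ^ 2)) *
        (gsq F x - b * F x ^ 2) + p x * (2 * ∑ i, pd i F x * pd i G x + α / 2 / s ^ 2 * F x ^ 2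
        - 2 * b * F x * G x)) := by
  have hF1 : ContDiff ℝ 1 F := hF.of_le (by norm_num)
  have e1 := isNull_green hp hpd hF hFs hG
  have e2 := isNull_green hp hpd hF hFs hF1
  have e3 := isNull_green hp hpd hF hFs (hF.dr_one (c := c))
  have e4 := isNull_radial hp hpd hF.gsq_one hFs.gsq
  have e5 := isNull_radial hp hpd (hF1.mul hF1) (hFs.mul_right (f' := F)) (G := fun x => F x * F x)
  have n := ((((e1.const_mul 2).add (e3.const_mul (1 / s))).add (e4.const_mul (-1 / (2 * s)))).add
    (e2.const_mul (-2 * b - lam / 4))).add (e5.const_mul (b / (2 * s)))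
  have c1 := hp.continuous
  have c2 := hF.continuous
  have c3 := hG.continuous
  have c4 := hF1.continuous_gsq
  have c5 := hF.continuous_slap
  have c6 : ∀ i, Continuous (pd i F) := fun i => hF1.continuous_pd
  have c7 : ∀ i, Continuous (pd i G) := fun i => hG.continuous_pd
  set K := tsupport F ∪ tsupport G with hK
  have hKc : IsCompact K := hFs.isCompact.union hGs.isCompact
  have z1 : ∀ x ∉ K, F x = 0 := fun x hx =>
    image_eq_zero_of_notMem_tsupport fun h => hx (Or.inl h)
  have z2 : ∀ x ∉ K, G x = 0 := fun x hx =>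
    image_eq_zero_of_notMem_tsupport fun h => hx (Or.inr h)
  have z3 : ∀ x ∉ K, gsq F x = 0 := fun x hx => Finset.sum_eq_zero fun _ _ => by
    rw [pd_eq_zero_of_notMem_tsupport fun h => hx (Or.inl h)]; norm_num
  have z4 : ∀ x ∉ K, slap F x = 0 := fun x hx => by
    rw [slap_eq_sum_pd]
    exact Finset.sum_eq_zero fun _ _ =>
      pd_eq_zero_of_notMem_tsupport fun h => hx (Or.inl (tsupport_pd_subset h))
  have z5 : ∀ x ∉ K, ∀ i, pd i F x = 0 := fun x hx i =>
    pd_eq_zero_of_notMem_tsupport fun h => hx (Or.inl h)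
  have cs : ∀ {f : EuclideanSpace ℝ (Fin d) → ℝ}, Continuous f → (∀ x ∉ K, f x = 0) → Integrable f :=
    fun hf h0 => hf.integrable_of_hasCompactSupport (HasCompactSupport.intro hKc h0)
  have i1 : Integrable fun x => p x * (α * lam / 4 / s * F x ^ 2 + lam / 4 * gsq F x -
      (G x + slap F x) ^ 2) :=
    cs (by fun_prop) fun x hx => by simp [z1 x hx, z2 x hx, z3 x hx, z4 x hx]
  have i2 : Integrable fun x => (p x * ((1 - d / 2 - α) / s + α * lam + ‖x - c‖ ^ 2 / (4 * s ^ 2)) *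
        (gsq F x - b * F x ^ 2) + p x * (2 * ∑ i, pd i F x * pd i G x + α / 2 / s ^ 2 * F x ^ 2
        - 2 * b * F x * G x)) :=
    cs (by fun_prop) fun x hx => by simp [z1 x hx, z3 x hx, z5 x hx]
  refine n.integral_le i1 i2 fun x => ?_
  have hdr : dr c (fun x => F x * F x) x = 2 * F x * dr c F x := by
    have dF : DifferentiableAt ℝ F x := hF1.contDiffAt.differentiableAt (by norm_num)
    simp only [dr, pd_mul dF dF, Finset.mul_sum]
    exact Finset.sum_congr rfl fun i _ => by ring
  have hgF : ∑ i, pd i F x * pd i F x = gsq F x := by simp only [gsq, pow_two]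
  simp only [sum_pd_mul_pd_dr hF, hdr, hgF]
  set Y := slap F x - dr c F x / (2 * s) + b * F x with hY
  have key : 0 ≤ p x * ((Y - (G x + slap F x)) ^ 2 + (Y ^ 2 + lam / 4 * F x * Y +
      (α * lam / 4 / s - lam * b / 4) * F x ^ 2)) := by
    refine mul_nonneg (hp0 x) (add_nonneg (sq_nonneg _) ?_)
    have h1 : lam ^ 2 / 64 ≤ α * lam / 4 / s - lam * b / 4 := by
      rw [hb]
      have : lam ≤ 1 / s := by rw [le_div_iff₀ hs]; exact hls
      have h2 : α * lam / 4 / s - lam * (α / 2 * (1 / s - lam)) / 4 =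
        α * lam / 8 * (1 / s) + α * lam ^ 2 / 8 := by field_simp; ring
      rw [h2]
      have : 0 ≤ α * lam / 8 * (1 / s) := by positivity
      nlinarith [sq_nonneg lam]
    nlinarith [sq_nonneg (Y + lam / 8 * F x), mul_le_mul_of_nonneg_right h1 (sq_nonneg (F x))]
  rw [← sub_nonneg]
  refine key.trans (le_of_eq ?_)
  rw [hY, hb]
  field_simp
  ring

end Carleman

section Weight

variable {d : ℕ} {c x : EuclideanSpace ℝ (Fin d)} {a α lam t : ℝ}

/-- The Carleman weight. -/
noncomputable def wt (c : EuclideanSpace ℝ (Fin d)) (a α lam : ℝ) (x : EuclideanSpace ℝ (Fin d))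
    (t : ℝ) : ℝ :=
  exp ((1 - d / 2 - α) * log (t + a) + α * lam * (t + a) - ‖x - c‖ ^ 2 / (4 * (t + a)))

lemma wt_pos : 0 < wt c a α lam x t := exp_pos _

lemma contDiff_wt {k : WithTop ℕ∞} : ContDiff ℝ k (fun x => wt c a α lam x t) :=
  (contDiff_const.sub ((contDiff_norm_sub_sq c).div_const _)).exp

lemma continuous_wt : Continuous (fun x => wt c a α lam x t) := (contDiff_wt (k := 0)).continuous

lemma pd_wt (i : Fin d) : pd i (fun x => wt c a α lam x t) x =
    -((x i - c i) / (2 * (t + a))) * wt c a α lam x t := by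
  have h1 : Differentiable ℝ fun x : EuclideanSpace ℝ (Fin d) => ‖x - c‖ ^ 2 :=
    (contDiff_norm_sub_sq c (k := 1)).differentiable (by norm_num)
  have h2 : HasDerivAt (fun z => exp ((1 - d / 2 - α) * log (t + a) + α * lam * (t + a)
      - z / (4 * (t + a)))) (wt c a α lam x t * (-(1 / (4 * (t + a))))) (‖x - c‖ ^ 2) := by
    have := (((hasDerivAt_id (‖x - c‖ ^ 2)).div_const (4 * (t + a))).const_sub
      ((1 - d / 2 - α) * log (t + a) + α * lam * (t + a))).exp
    simpa [wt] using this
  have := pd_comp (i := i) (f := fun x => ‖x - c‖ ^ 2) h2 (h1 x)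
  rw [pd_norm_sub_sq] at this
  have e : (fun x => wt c a α lam x t) = fun y => exp ((1 - d / 2 - α) * log (t + a) +
    α * lam * (t + a) - ‖y - c‖ ^ 2 / (4 * (t + a))) := rfl
  rw [e, this]
  by_cases h0 : t + a = 0
  · simp [h0]
  · field_simp; ring

/-- The logarithmic time derivative of the weight. -/
noncomputable def wtd (c : EuclideanSpace ℝ (Fin d)) (a α lam : ℝ) (x : EuclideanSpace ℝ (Fin d))
    (t : ℝ) : ℝ := (1 - d / 2 - α) / (t + a) + α * lam + ‖x - c‖ ^ 2 / (4 * (t + a) ^ 2)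

lemma hasDerivAt_wt (h : 0 < t + a) :
    HasDerivAt (wt c a α lam x) (wt c a α lam x t * wtd c a α lam x t) t := by
  have h1 : HasDerivAt (fun t => t + a) 1 t := (hasDerivAt_id t).add_const a
  have h2 := (((h1.log h.ne').const_mul (1 - (d : ℝ) / 2 - α)).fun_add
    (h1.const_mul (α * lam))).fun_sub
    ((hasDerivAt_const t (‖x - c‖ ^ 2)).fun_div (h1.const_mul 4) (by positivity))
  convert! h2.exp using 1
  rw [wt, wtd]
  congr 1
  field_simp
  ring

lemma continuousOn_uncurry_wt : ContinuousOn (fun z : EuclideanSpace ℝ (Fin d) × ℝ =>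
    wt c a α lam z.1 z.2) {z | 0 < z.2 + a} := by
  unfold wt
  refine ContinuousOn.rexp (((ContinuousOn.mul continuousOn_const (ContinuousOn.log ?_ ?_)).add
    ?_).sub (ContinuousOn.div ?_ ?_ ?_))
  · fun_prop
  · exact fun z hz => ne_of_gt hz
  · fun_prop
  · fun_prop
  · fun_prop
  · exact fun z hz => ne_of_gt (mul_pos (by norm_num) hz)

lemma continuousOn_wt_time : ContinuousOn (wt c a α lam x) {t | 0 < t + a} := fun _ ht =>
  (hasDerivAt_wt (x := x) ht).continuousAt.continuousWithinAt

lemma wt_bound (ha : 0 < a) {K : Set (EuclideanSpace ℝ (Fin d))} (hK : IsCompact K) (T : ℝ) :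
    ∃ B, ∀ x ∈ K, ∀ t ∈ Icc 0 T, wt c a α lam x t ≤ B := by
  obtain ⟨B, hB⟩ := (hK.prod (isCompact_Icc (a := (0 : ℝ)) (b := T))).exists_bound_of_continuousOn
    ((continuousOn_uncurry_wt (c := c) (a := a) (α := α) (lam := lam)).mono fun z hz => by
      have := hz.2.1
      show 0 < z.2 + a
      linarith)
  exact ⟨B, fun x hx t ht => (le_abs_self _).trans (hB (x, t) ⟨hx, ht⟩)⟩

lemma LD.of_hasDerivAt {X : Type*} {K : Set X} {f : ℝ → ℝ} {f' t : ℝ} (h : HasDerivAt f f' t) :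
    LD K (fun _ s => f s) (fun _ => f') t := by
  refine ⟨fun _ _ => h.hasDerivWithinAt, ?_, ⟨|f t|, fun _ _ => le_rfl⟩⟩
  have h1 := ((hasDerivWithinAt_iff_tendsto_slope' (by simp)).1
    (h.hasDerivWithinAt (s := Iio t))).abs.eventually_lt_const (lt_add_one |f'|)
  refine ⟨|f'| + 1, ?_⟩
  filter_upwards [h1, self_mem_nhdsWithin] with s hs hst x _
  have hst' : s < t := hst
  rw [slope_def_field, abs_div, abs_sub_comm s t, abs_of_pos (sub_pos.2 hst'),
    div_lt_iff₀ (sub_pos.2 hst')] at hs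
  exact hs.le

lemma LD.wt (ha : 0 < a) {K : Set (EuclideanSpace ℝ (Fin d))} (hK : IsCompact K) (ht : 0 < t) :
    LD K (wt c a α lam) (fun x => wt c a α lam x t * wtd c a α lam x t) t := by
  obtain ⟨B, hB⟩ := (hK.prod (isCompact_Icc (a := (0 : ℝ)) (b := t))).exists_bound_of_continuousOn
    (f := fun z => _root_.wt c a α lam z.1 z.2 * wtd c a α lam z.1 z.2) (by
      refine (continuousOn_uncurry_wt.mono fun z hz => ?_).mul ?_
      · have := hz.2.1
        show 0 < z.2 + a
        linarith
      · have h0 : ∀ z ∈ K ×ˢ Icc 0 t, z.2 + a ≠ 0 := fun z hz => by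
          have := hz.2.1
          linarith
        unfold wtd
        refine ((continuousOn_const.div (by fun_prop) h0).add continuousOn_const).add
          (ContinuousOn.div (by fun_prop) (by fun_prop) fun z hz => ?_)
        have := h0 z hz
        positivity)
  refine LD.of_deriv_bound (F' := fun x s => _root_.wt c a α lam x s * wtd c a α lam x s) (B := B) ht
    (fun x _ s hs => ?_) (fun x hx s hs => ?_) ?_
  · exact (hasDerivAt_wt (by linarith [hs.1])).hasDerivWithinAt
  · exact hB (x, s) ⟨hx, by simpa using hs⟩
  · obtain ⟨B, hB⟩ := wt_bound (c := c) (α := α) (lam := lam) ha hK t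
    exact ⟨B, fun x hx => by
      rw [abs_of_pos wt_pos]; exact hB x hx t ⟨ht.le, le_rfl⟩⟩

end Weight

section CarlemanTime

variable {d : ℕ} {c : EuclideanSpace ℝ (Fin d)} {T : ℝ} {K : Set (EuclideanSpace ℝ (Fin d))}
  {F F' : EuclideanSpace ℝ (Fin d) → ℝ → ℝ}

/-- Functions to which the Carleman inequality applies directly. -/
structure IsReg (T : ℝ) (K : Set (EuclideanSpace ℝ (Fin d)))
    (F F' : EuclideanSpace ℝ (Fin d) → ℝ → ℝ) : Prop where
  isCompact : IsCompact K
  smooth : ∀ t, ContDiff ℝ 2 (fun x => F x t)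
  smooth' : ∀ t ∈ Ioo 0 T, ContDiff ℝ 1 (fun x => F' x t)
  supp : ∀ t, ∀ x ∉ K, F x t = 0
  supp' : ∀ t ∈ Ioo 0 T, ∀ x ∉ K, F' x t = 0
  ld : ∀ t ∈ Ioo 0 T, LD K F (fun x => F' x t) t
  ld_pd : ∀ t ∈ Ioo 0 T, ∀ i, LD K (fun x s => pd i (fun y => F y s) x)
    (fun x => pd i (fun y => F' y t) x) t
  bound : ∃ C, ∀ x t, |F x t| ≤ C
  bound_pd : ∃ C, ∀ x t i, |pd i (fun y => F y t) x| ≤ C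
  cont : ∀ x, Continuous (F x)
  cont_pd : ∀ x i, Continuous fun t => pd i (fun y => F y t) x

lemma pd_eq_zero_of_eq_zero {f : EuclideanSpace ℝ (Fin d) → ℝ} (hK : IsClosed K)
    (h : ∀ x ∉ K, f x = 0) {x} (hx : x ∉ K) (i : Fin d) : pd i f x = 0 :=
  pd_eq_zero_of_notMem_tsupport fun hh => hx (closure_minimal (fun y hy => by
    by_contra hc; exact hy (h y hc)) hK hh)

lemma gsq_eq_zero_of_eq_zero {f : EuclideanSpace ℝ (Fin d) → ℝ} (hK : IsClosed K)
    (h : ∀ x ∉ K, f x = 0) {x} (hx : x ∉ K) : gsq f x = 0 :=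
  Finset.sum_eq_zero fun i _ => by rw [pd_eq_zero_of_eq_zero hK h hx]; norm_num

/-- A weighted energy of a regular function depends continuously on time. -/
lemma IsReg.continuousOn_energy (h : IsReg T K F F') {q₁ q₂ : EuclideanSpace ℝ (Fin d) → ℝ → ℝ}
    (h1 : ∀ t ∈ Icc 0 T, Continuous fun x => q₁ x t)
    (h2 : ∀ t ∈ Icc 0 T, Continuous fun x => q₂ x t)
    (h3 : ∀ x, ContinuousOn (q₁ x) (Icc 0 T)) (h4 : ∀ x, ContinuousOn (q₂ x) (Icc 0 T))
    (h5 : ∃ B, ∀ x ∈ K, ∀ t ∈ Icc 0 T, |q₁ x t| ≤ B)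
    (h6 : ∃ B, ∀ x ∈ K, ∀ t ∈ Icc 0 T, |q₂ x t| ≤ B) :
    ContinuousOn (fun t => ∫ x, (q₁ x t * F x t ^ 2 + q₂ x t * gsq (fun y => F y t) x)) (Icc 0 T) := by
  obtain ⟨C₁, hC₁⟩ := h.bound
  obtain ⟨C₂, hC₂⟩ := h.bound_pd
  obtain ⟨B₁, hB₁⟩ := h5
  obtain ⟨B₂, hB₂⟩ := h6
  have hg : ∀ x t, gsq (fun y => F y t) x ≤ d * C₂ ^ 2 := fun x t => by
    calc gsq (fun y => F y t) x ≤ ∑ _i : Fin d, C₂ ^ 2 :=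
          Finset.sum_le_sum fun i _ => sq_le_sq.2 ((hC₂ x t i).trans (le_abs_self _))
      _ = _ := by simp
  intro t ht
  refine continuousWithinAt_of_dominated
    (bound := K.indicator fun _ => B₁ * C₁ ^ 2 + B₂ * (d * C₂ ^ 2)) ?_ ?_ ?_ ?_
  · filter_upwards [self_mem_nhdsWithin] with s hs
    have e1 := (h.smooth s).continuous
    have e2 := ((h.smooth s).of_le (by norm_num : (1 : WithTop ℕ∞) ≤ 2)).continuous_gsq
    have e3 := h1 s hs
    have e4 := h2 s hs
    exact Continuous.aestronglyMeasurable (by fun_prop)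
  · filter_upwards [self_mem_nhdsWithin] with s hs
    refine ae_of_all _ fun x => ?_
    by_cases hx : x ∈ K
    · rw [indicator_of_mem hx]
      refine (norm_add_le _ _).trans (add_le_add ?_ ?_)
      · rw [norm_mul, norm_pow]
        have := hB₁ x hx s hs
        have hB0 : 0 ≤ B₁ := (abs_nonneg _).trans this
        have := hC₁ x s
        simp only [Real.norm_eq_abs]
        gcongr
      · rw [norm_mul]
        have := hB₂ x hx s hs
        have hB0 : 0 ≤ B₂ := (abs_nonneg _).trans this
        have := hg x s
        simp only [Real.norm_eq_abs, abs_of_nonneg gsq_nonneg]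
        exact mul_le_mul (by assumption) this gsq_nonneg hB0
    · simp [h.supp s x hx, hx, gsq_eq_zero_of_eq_zero h.isCompact.isClosed (h.supp s) hx]
  · exact (integrable_indicator_iff h.isCompact.measurableSet).2
      (integrableOn_const h.isCompact.measure_lt_top.ne)
  · refine ae_of_all _ fun x => ?_
    have e1 := (h.cont x).continuousWithinAt (s := Icc 0 T) (x := t)
    have e2 : ContinuousWithinAt (fun t => gsq (fun y => F y t) x) (Icc 0 T) t :=
      (continuous_finsetSum _ fun i _ => (h.cont_pd x i).pow 2).continuousWithinAt
    exact ((h3 x t ht).mul (e1.pow 2)).add ((h4 x t ht).mul e2)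

lemma IsReg.continuousOn_wt_energy (h : IsReg T K F F') {a α lam : ℝ} (ha : 0 < a)
    {r₁ r₂ : ℝ → ℝ} (hr₁ : ContinuousOn r₁ (Icc 0 T)) (hr₂ : ContinuousOn r₂ (Icc 0 T)) :
    ContinuousOn (fun t => ∫ x, (wt c a α lam x t * r₁ t * F x t ^ 2 +
      wt c a α lam x t * r₂ t * gsq (fun y => F y t) x)) (Icc 0 T) := by
  have hwtc : ∀ x, ContinuousOn (wt c a α lam x) (Icc 0 T) := fun x =>
    continuousOn_wt_time.mono fun t ht => by
      change 0 < t + a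
      linarith [ht.1]
  obtain ⟨B, hB⟩ := wt_bound (c := c) (α := α) (lam := lam) ha h.isCompact T
  have hbnd : ∀ {r : ℝ → ℝ}, ContinuousOn r (Icc 0 T) →
      ∃ B, ∀ x ∈ K, ∀ t ∈ Icc 0 T, |wt c a α lam x t * r t| ≤ B := fun {r} hr => by
    obtain ⟨R, hR⟩ := isCompact_Icc.exists_bound_of_continuousOn hr
    refine ⟨B * R, fun x hx t ht => ?_⟩
    rw [abs_mul, abs_of_pos wt_pos]
    have h1 := hB x hx t ht
    have h2 := hR t ht
    rw [Real.norm_eq_abs] at h2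
    have h3 : 0 ≤ B := wt_pos.le.trans h1
    gcongr
  have hcx : ∀ {r : ℝ}, ∀ t, Continuous fun x => wt c a α lam x t * r := fun t =>
    continuous_wt.mul continuous_const
  exact h.continuousOn_energy (fun t _ => hcx t) (fun t _ => hcx t)
    (fun x => (hwtc x).mul hr₁) (fun x => (hwtc x).mul hr₂) (hbnd hr₁) (hbnd hr₂)

/-- The Carleman inequality for regular functions. -/
lemma IsReg.carleman (h : IsReg T K F F') {a α lam : ℝ} (hT : 0 ≤ T) (ha : 0 < a)
    (hα : 1 ≤ α) (hl : 0 < lam) (hls : lam * (T + a) ≤ 1) (hend : ∀ x, F x T = 0)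
    {m : ℝ → ℝ} (hm : IntegrableOn m (Icc 0 T))
    (hle : ∀ t ∈ Ioo 0 T, ∫ x, wt c a α lam x t * (F' x t + slap (fun y => F y t) x) ^ 2 ≤ m t) :
    ∫ t in (0)..T, ((∫ x, (wt c a α lam x t * (α * lam / 4 / (t + a)) * F x t ^ 2 +
      wt c a α lam x t * (lam / 4) * gsq (fun y => F y t) x)) - m t) ≤
      α / 2 * ∫ x, wt c a α lam x 0 / a * F x 0 ^ 2 := by
  set b : ℝ → ℝ := fun t => α / 2 * (1 / (t + a) - lam) with hb
  set Q : ℝ → ℝ := fun t => ∫ x, (wt c a α lam x t * (-b t) * F x t ^ 2 +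
    wt c a α lam x t * gsq (fun y => F y t) x) with hQ
  have hpos : ∀ t ∈ Icc 0 T, 0 < t + a := fun t ht => by linarith [ht.1]
  have hwtc : ∀ x, ContinuousOn (wt c a α lam x) (Icc 0 T) := fun x =>
    continuousOn_wt_time.mono hpos
  have hinv : ContinuousOn (fun t => 1 / (t + a)) (Icc 0 T) :=
    continuousOn_const.div (by fun_prop) fun t ht => (hpos t ht).ne'
  have hbc : ContinuousOn b (Icc 0 T) := continuousOn_const.mul (hinv.sub continuousOn_const)
  have hQc : ContinuousOn Q (Icc 0 T) := by
    simpa [hQ] using h.continuousOn_wt_energy (c := c) (α := α) (lam := lam) ha hbc.neg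
      (continuousOn_const (c := (1 : ℝ)))
  set A : ℝ → ℝ := fun t => ∫ x, (wt c a α lam x t * (α * lam / 4 / (t + a)) * F x t ^ 2 +
      wt c a α lam x t * (lam / 4) * gsq (fun y => F y t) x) with hA
  have hr1 : ContinuousOn (fun t => α * lam / 4 / (t + a)) (Icc 0 T) :=
    continuousOn_const.div (by fun_prop) fun t ht => (hpos t ht).ne'
  have hAc : ContinuousOn A (Icc 0 T) := h.continuousOn_wt_energy ha hr1 continuousOn_const
  have hcl := h.isCompact.isClosed
  have key := integral_le_sub_of_hasDeriv_left (g := Q) (φ := fun t => A t - m t)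
    (g' := fun t => ∫ x, (wt c a α lam x t * wtd c a α lam x t *
        (gsq (fun y => F y t) x - b t * F x t ^ 2) + wt c a α lam x t *
        (2 * ∑ i, pd i (fun y => F y t) x * pd i (fun y => F' y t) x +
          α / 2 / (t + a) ^ 2 * F x t ^ 2 - 2 * b t * F x t * F' x t))) hT hQc ?_
    ((hAc.integrableOn_Icc).sub hm) ?_
  · have hQT : Q T = 0 := by
      have hz : ∀ x : EuclideanSpace ℝ (Fin d), gsq (fun _ => (0 : ℝ)) x = 0 := fun x => by
        simp [gsq, pd_const]
      simp only [hQ, hend, hz]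
      simp
    have hQ0 : -Q 0 ≤ α / 2 * ∫ x, wt c a α lam x 0 / a * F x 0 ^ 2 := by
      have c1 := (h.smooth 0).continuous
      have c2 := ((h.smooth 0).of_le (by norm_num : (1 : WithTop ℕ∞) ≤ 2)).continuous_gsq
      have c3 : Continuous fun x => wt c a α lam x 0 := continuous_wt
      have cs : ∀ {f : EuclideanSpace ℝ (Fin d) → ℝ}, Continuous f → (∀ x ∉ K, f x = 0) →
          Integrable f := fun hf h0 =>
        hf.integrable_of_hasCompactSupport (HasCompactSupport.intro h.isCompact h0)
      rw [hQ, ← integral_neg, ← integral_const_mul]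
      refine integral_mono (cs (by fun_prop) fun x hx => ?_) (cs (by fun_prop) fun x hx => ?_)
        fun x => ?_
      · simp [h.supp 0 x hx, gsq_eq_zero_of_eq_zero hcl (h.supp 0) hx]
      · simp [h.supp 0 x hx]
      · have h1 : 0 ≤ wt c a α lam x 0 * gsq (fun y => F y 0) x := mul_nonneg wt_pos.le gsq_nonneg
        have h2 : 0 ≤ wt c a α lam x 0 * (α / 2 * lam) * F x 0 ^ 2 := by
          have := (wt_pos (c := c) (a := a) (α := α) (lam := lam) (x := x) (t := 0)).le
          positivity
        simp only [hb, zero_add]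
        have : α / 2 * (wt c a α lam x 0 / a * F x 0 ^ 2) =
          wt c a α lam x 0 * (α / 2 * (1 / a)) * F x 0 ^ 2 := by ring
        rw [this]
        linarith
    linarith
  · intro t ht
    have hts : 0 < t + a := by linarith [ht.1]
    have hb' : HasDerivAt b (-(α / 2 / (t + a) ^ 2)) t := by
      have := ((((hasDerivAt_id t).add_const a).fun_inv hts.ne').sub_const lam).const_mul (α / 2)
      convert! this using 1
      · funext t; simp [hb]
      · simp; ring
    have l1 := h.ld t ht
    have l2 : LD K (fun x s => gsq (fun y => F y s) x)
        (fun x => ∑ i, (pd i (fun y => F' y t) x * pd i (fun y => F y t) x +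
          pd i (fun y => F y t) x * pd i (fun y => F' y t) x)) t := by
      have := LD.sum (S := Finset.univ) fun i _ => (h.ld_pd t ht i).mul (h.ld_pd t ht i)
      simpa only [gsq, pow_two] using this
    have l3 := LD.wt (c := c) (α := α) (lam := lam) ha h.isCompact ht.1
    have l4 := LD.of_hasDerivAt (K := K) hb'.fun_neg
    have l5 := ((l3.mul l4).mul (l1.mul l1)).add (l3.mul l2)
    have cs : ∀ s, Integrable fun x => wt c a α lam x s * -b s * (F x s * F x s) +
        wt c a α lam x s * gsq (fun y => F y s) x := fun s => by
      have c1 := (h.smooth s).continuous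
      have c2 := ((h.smooth s).of_le (by norm_num : (1 : WithTop ℕ∞) ≤ 2)).continuous_gsq
      have c3 : Continuous fun x => wt c a α lam x s := continuous_wt
      refine Continuous.integrable_of_hasCompactSupport (by fun_prop)
        (HasCompactSupport.intro h.isCompact fun x hx => ?_)
      simp [h.supp s x hx, gsq_eq_zero_of_eq_zero hcl (h.supp s) hx]
    have := l5.hasDerivWithinAt_integral h.isCompact.measurableSet h.isCompact.measure_lt_top.ne
      (fun s x hx => by simp [h.supp s x hx, gsq_eq_zero_of_eq_zero hcl (h.supp s) hx])
      (fun x hx => by simp [h.supp t x hx, h.supp' t ht x hx,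
          gsq_eq_zero_of_eq_zero hcl (h.supp t) hx, pd_eq_zero_of_eq_zero hcl (h.supp t) hx])
      (Eventually.of_forall cs) (cs t)
    convert! this using 1
    · funext s
      simp only [hQ, pow_two]
    · refine integral_congr_ae (ae_of_all _ fun x => ?_)
      simp only [Finset.sum_add_distrib, mul_comm (pd _ (fun y => F' y t) x)]
      ring
  · intro t ht
    have hts : 0 < t + a := by linarith [ht.1]
    have hcs : HasCompactSupport fun x => F x t := HasCompactSupport.intro h.isCompact (h.supp t)
    have hcs' : HasCompactSupport fun x => F' x t :=
      HasCompactSupport.intro h.isCompact (h.supp' t ht)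
    have hls' : lam * (t + a) ≤ 1 := by nlinarith [ht.2]
    have := carleman_spatial (c := c) (s := t + a) (p := fun x => wt c a α lam x t) contDiff_wt
      (fun i x => pd_wt i) (fun x => wt_pos.le) (h.smooth t) hcs (h.smooth' t ht) hcs' hts hα hl
      hls' (b := b t) rfl
    refine le_trans ?_ this
    have h1 := hle t ht
    have c1 := (h.smooth t).continuous
    have c2 := ((h.smooth t).of_le (by norm_num : (1 : WithTop ℕ∞) ≤ 2)).continuous_gsq
    have c3 : Continuous fun x => wt c a α lam x t := continuous_wt
    have c4 := (h.smooth' t ht).continuous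
    have c5 := (h.smooth t).continuous_slap
    have i1 : Integrable fun x => wt c a α lam x t * (α * lam / 4 / (t + a)) * F x t ^ 2 +
      wt c a α lam x t * (lam / 4) * gsq (fun y => F y t) x :=
      Continuous.integrable_of_hasCompactSupport (by fun_prop)
        (HasCompactSupport.intro h.isCompact fun x hx => by
          simp [h.supp t x hx, gsq_eq_zero_of_eq_zero hcl (h.supp t) hx])
    have i2 : Integrable fun x => wt c a α lam x t * (F' x t + slap (fun y => F y t) x) ^ 2 := by
      refine Continuous.integrable_of_hasCompactSupport (by fun_prop) (HasCompactSupport.mul_left ?_)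
      exact (hcs'.add hcs.slap).comp_left (g := fun z : ℝ => z ^ 2) (by norm_num)
    calc A t - m t ≤ A t - ∫ x, wt c a α lam x t * (F' x t + slap (fun y => F y t) x) ^ 2 := by
          linarith
      _ = _ := by
        rw [hA, ← integral_sub i1 i2]
        exact integral_congr_ae (ae_of_all _ fun x => by simp only; ring)

end CarlemanTime

section Mollification

variable {d : ℕ} {ρ g : EuclideanSpace ℝ (Fin d) → ℝ} {K K₁ : Set (EuclideanSpace ℝ (Fin d))}

/-- Convolution of `g` with the kernel `ρ`. -/
noncomputable def mol (ρ g : EuclideanSpace ℝ (Fin d) → ℝ) (x : EuclideanSpace ℝ (Fin d)) : ℝ :=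
  ∫ z, g z * ρ (x - z)

open scoped Convolution in
lemma mol_eq_convolution : mol ρ g = g ⋆[ContinuousLinearMap.mul ℝ ℝ, volume] ρ := rfl

lemma contDiff_mol {k : ℕ∞} (hρ : ContDiff ℝ k ρ) (hc : HasCompactSupport ρ)
    (hg : LocallyIntegrable g) : ContDiff ℝ k (mol ρ g) := by
  rw [mol_eq_convolution]
  exact hc.contDiff_convolution_right _ hg hρ

lemma pd_mol {i : Fin d} (hρ : ContDiff ℝ 1 ρ) (hc : HasCompactSupport ρ)
    (hg : LocallyIntegrable g) : pd i (mol ρ g) = mol (pd i ρ) g := by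
  ext x
  rw [mol_eq_convolution, (hc.hasFDerivAt_convolution_right _ hg hρ x).pd_eq,
    convolution_precompR_apply _ hg (hc.fderiv ℝ) (hρ.continuous_fderiv (by norm_num))]
  rfl

lemma integrable_mol (hρ : Continuous ρ) (hc : HasCompactSupport ρ) (hg : LocallyIntegrable g)
    (x : EuclideanSpace ℝ (Fin d)) : Integrable fun z => g z * ρ (x - z) :=
  hc.convolutionExists_right (ContinuousLinearMap.mul ℝ ℝ) hg hρ x

lemma pd_comp_const_sub {i : Fin d} (hρ : ContDiff ℝ 1 ρ) (x z : EuclideanSpace ℝ (Fin d)) :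
    pd i (fun y => ρ (x - y)) z = - pd i ρ (x - z) := by
  have h1 := (hρ.differentiable (by norm_num)) (x - z)
  have h2 := h1.hasFDerivAt.comp z ((hasFDerivAt_id z).const_sub x)
  exact h2.pd_eq.trans (by simp [pd])

lemma mol_pd {i : Fin d} (hρ : ContDiff ℝ 1 ρ) (hg : ContDiff ℝ 1 g) (hc : HasCompactSupport g) :
    mol (pd i ρ) g = mol ρ (pd i g) := by
  ext x
  have hρ' : ContDiff ℝ 1 fun y => ρ (x - y) := hρ.comp (contDiff_const.sub contDiff_id)
  have := integral_mul_pd (i := i) hg hρ' hc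
  simp only [pd_comp_const_sub hρ, mul_neg, integral_neg, neg_inj] at this
  exact this

lemma abs_mol_le {U : ℝ} (hρ : Integrable ρ) (hg : ∀ x, |g x| ≤ U) (x : EuclideanSpace ℝ (Fin d)) :
    |mol ρ g x| ≤ U * ∫ z, |ρ z| := by
  have h1 : Integrable fun z => U * |ρ (x - z)| := (hρ.abs.comp_sub_left x).const_mul U
  have h2 := norm_integral_le_of_norm_le (f := fun z => g z * ρ (x - z)) h1 (ae_of_all _ fun z => by
    rw [norm_mul, Real.norm_eq_abs, Real.norm_eq_abs]
    exact mul_le_mul_of_nonneg_right (hg z) (abs_nonneg _))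
  rwa [integral_const_mul, integral_sub_left_eq_self (fun z => |ρ z|)] at h2

lemma mol_eq_zero {ε : ℝ} (hρ : ∀ z, ε ≤ ‖z‖ → ρ z = 0) (hg : ∀ x ∉ K, g x = 0)
    {x : EuclideanSpace ℝ (Fin d)} (hx : x ∉ cthickening ε K) : mol ρ g x = 0 := by
  refine integral_eq_zero_of_ae (ae_of_all _ fun z => ?_)
  by_cases hz : z ∈ K
  · have : ε ≤ ‖x - z‖ := by
      by_contra! h
      exact hx (mem_cthickening_of_dist_le x z ε K hz (by rw [dist_eq_norm]; exact h.le))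
    simp [hρ _ this]
  · simp [hg z hz]

lemma LD.mol {f : EuclideanSpace ℝ (Fin d) → ℝ → ℝ} {f' : EuclideanSpace ℝ (Fin d) → ℝ} {t : ℝ}
    (hρ : Continuous ρ) (hc : HasCompactSupport ρ) (h : LD K f f' t) (hK : IsCompact K)
    (hsupp : ∀ s, ∀ x ∉ K, f x s = 0) (hsupp' : ∀ x ∉ K, f' x = 0)
    (hf : ∀ s, LocallyIntegrable fun x => f x s) :
    LD K₁ (fun x s => mol ρ (fun y => f y s) x) (mol ρ f') t := by
  obtain ⟨R, hR⟩ := hρ.bounded_above_of_compact_support hc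
  have hR0 : 0 ≤ R := (norm_nonneg _).trans (hR 0)
  refine ⟨fun x _ => ?_, ?_, ?_⟩
  · have h1 : LD K (fun z s => ρ (x - z) * f z s) (fun z => ρ (x - z) * f' z) t :=
      h.const_mul ⟨R, fun z _ => hR _⟩
    have h2 := h1.hasDerivWithinAt_integral hK.measurableSet hK.measure_lt_top.ne
      (fun s z hz => by simp [hsupp s z hz]) (fun z hz => by simp [hsupp' z hz])
      (Eventually.of_forall fun s => by
        simpa only [mul_comm] using integrable_mol hρ hc (hf s) x)
      (by simpa only [mul_comm] using integrable_mol hρ hc (hf t) x)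
    simpa only [_root_.mol, mul_comm] using h2
  · obtain ⟨B, hB⟩ := h.dom
    refine ⟨B * R * volume.real K, ?_⟩
    filter_upwards [hB, self_mem_nhdsWithin] with s hs hst x _
    have hst' : 0 < t - s := sub_pos.2 hst
    rw [_root_.mol, _root_.mol, ← integral_sub (integrable_mol hρ hc (hf s) x)
      (integrable_mol hρ hc (hf t) x)]
    have hi : Integrable (K.indicator fun _ : EuclideanSpace ℝ (Fin d) => B * R * (t - s)) :=
      (integrable_indicator_iff hK.measurableSet).2 (integrableOn_const hK.measure_lt_top.ne)
    rw [← Real.norm_eq_abs]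
    refine (norm_integral_le_of_norm_le hi (ae_of_all _ fun z => ?_)).trans_eq ?_
    · by_cases hz : z ∈ K
      · rw [indicator_of_mem hz, ← sub_mul, norm_mul]
        have := hs z hz
        have h3 := hR (x - z)
        calc ‖f z s - f z t‖ * ‖ρ (x - z)‖ ≤ (B * (t - s)) * R :=
              mul_le_mul this h3 (norm_nonneg _) ((abs_nonneg _).trans this)
          _ = _ := by ring
      · simp [hsupp _ z hz, hz]
    · rw [integral_indicator hK.measurableSet, setIntegral_const, smul_eq_mul]
      ring
  · obtain ⟨B, hB⟩ := h.bdd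
    refine ⟨|B| * ∫ z, |ρ z|, fun x _ => abs_mol_le (hρ.integrable_of_hasCompactSupport hc)
      (fun z => ?_) x⟩
    by_cases hz : z ∈ K
    · exact (hB z hz).trans (le_abs_self _)
    · simp [hsupp t z hz]

end Mollification

section Fatou

lemma integral_le_of_tendsto_of_nonneg {X : Type*} [MeasurableSpace X] {μ : Measure X}
    {A : X → ℝ} {B : ℕ → X → ℝ} {b : ℕ → ℝ} {b₀ : ℝ} (hint : ∀ᶠ k in atTop, Integrable (B k) μ)
    (hpos : ∀ᶠ k in atTop, ∀ᵐ x ∂μ, 0 ≤ B k x)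
    (hlim : ∀ᵐ x ∂μ, Tendsto (fun k => B k x) atTop (𝓝 (A x)))
    (hle : ∀ᶠ k in atTop, ∫ x, B k x ∂μ ≤ b k) (hb : Tendsto b atTop (𝓝 b₀)) :
    Integrable A μ ∧ ∫ x, A x ∂μ ≤ b₀ := by
  obtain ⟨N, hN⟩ := eventually_atTop.1 (hint.and (hpos.and hle))
  have hlim' : ∀ᵐ x ∂μ, Tendsto (fun k => B (k + N) x) atTop (𝓝 (A x)) := by
    filter_upwards [hlim] with x hx
    exact hx.comp (tendsto_add_atTop_nat N)
  have hb' : Tendsto (fun k => b (k + N)) atTop (𝓝 b₀) := hb.comp (tendsto_add_atTop_nat N)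
  have h1 : ∀ k, Integrable (B (k + N)) μ := fun k => (hN _ (by omega)).1
  have h2 : ∀ k, ∀ᵐ x ∂μ, 0 ≤ B (k + N) x := fun k => (hN _ (by omega)).2.1
  have h3 : ∀ k, ∫ x, B (k + N) x ∂μ ≤ b (k + N) := fun k => (hN _ (by omega)).2.2
  have hmeas : AEStronglyMeasurable A μ :=
    aestronglyMeasurable_of_tendsto_ae atTop (fun k => (h1 k).1) hlim'
  have hA0 : ∀ᵐ x ∂μ, 0 ≤ A x := by
    filter_upwards [hlim', ae_all_iff.2 h2] with x hx h0
    exact ge_of_tendsto' hx h0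
  have hb0 : 0 ≤ b₀ := ge_of_tendsto' hb' fun k => (integral_nonneg_of_ae (h2 k)).trans (h3 k)
  have key : ∫⁻ x, ENNReal.ofReal (A x) ∂μ ≤ ENNReal.ofReal b₀ := by
    calc ∫⁻ x, ENNReal.ofReal (A x) ∂μ
        = ∫⁻ x, liminf (fun k => ENNReal.ofReal (B (k + N) x)) atTop ∂μ := by
          refine lintegral_congr_ae ?_
          filter_upwards [hlim'] with x hx
          exact ((ENNReal.continuous_ofReal.tendsto _).comp hx).liminf_eq.symm
      _ ≤ liminf (fun k => ∫⁻ x, ENNReal.ofReal (B (k + N) x) ∂μ) atTop :=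
          lintegral_liminf_le' fun k => (h1 k).1.aemeasurable.ennreal_ofReal
      _ ≤ liminf (fun k => ENNReal.ofReal (b (k + N))) atTop := by
          refine liminf_le_liminf (Eventually.of_forall fun k => ?_)
          rw [← ofReal_integral_eq_lintegral_ofReal (h1 k) (h2 k)]
          exact ENNReal.ofReal_le_ofReal (h3 k)
      _ = ENNReal.ofReal b₀ := ((ENNReal.continuous_ofReal.tendsto _).comp hb').liminf_eq
  have hi : Integrable A μ := by
    refine ⟨hmeas, ?_⟩
    rw [hasFiniteIntegral_iff_ofReal hA0]
    exact key.trans_lt ENNReal.ofReal_lt_top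
  refine ⟨hi, ?_⟩
  rw [← ofReal_integral_eq_lintegral_ofReal hi hA0] at key
  exact (ENNReal.ofReal_le_ofReal_iff hb0).1 key

end Fatou

section CarlemanC2

variable {d : ℕ} {T : ℝ} {K : Set (EuclideanSpace ℝ (Fin d))}
  {f f' : EuclideanSpace ℝ (Fin d) → ℝ → ℝ} {ρ g p : EuclideanSpace ℝ (Fin d) → ℝ}

lemma mol_sq_le (hρ : Continuous ρ) (hc : HasCompactSupport ρ) (h0 : ∀ z, 0 ≤ ρ z)
    (h1 : ∫ z, ρ z = 1) (hg : LocallyIntegrable g) (hg2 : LocallyIntegrable fun x => g x ^ 2)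
    (x : EuclideanSpace ℝ (Fin d)) : mol ρ g x ^ 2 ≤ mol ρ (fun z => g z ^ 2) x := by
  have i1 := integrable_mol hρ hc hg x
  have i2 := integrable_mol hρ hc hg2 x
  have i3 : Integrable fun z => ρ (x - z) := (hρ.integrable_of_hasCompactSupport hc).comp_sub_left x
  have e3 : ∫ z, ρ (x - z) = 1 := by rw [integral_sub_left_eq_self (fun z => ρ z), h1]
  set m := mol ρ g x with hm
  have key : 0 ≤ ∫ z, (g z ^ 2 * ρ (x - z) - 2 * m * (g z * ρ (x - z)) + m ^ 2 * ρ (x - z)) :=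
    integral_nonneg fun z => by
      have := mul_nonneg (sq_nonneg (g z - m)) (h0 (x - z))
      simp only [Pi.zero_apply]
      linarith
  have i4 : Integrable fun z => g z ^ 2 * ρ (x - z) - 2 * m * (g z * ρ (x - z)) :=
    i2.sub (i1.const_mul _)
  rw [integral_add i4 (i3.const_mul _), integral_sub i2 (i1.const_mul _),
    integral_const_mul, integral_const_mul, e3] at key
  have e1 : ∫ z, g z * ρ (x - z) = m := rfl
  rw [e1] at key
  change m ^ 2 ≤ ∫ z, g z ^ 2 * ρ (x - z)
  linarith

lemma integral_mul_mol_le {ε P : ℝ} (hρ : Continuous ρ) (hc : HasCompactSupport ρ)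
    (h0 : ∀ z, 0 ≤ ρ z) (h1 : ∫ z, ρ z = 1) (hε : ∀ z, ε ≤ ‖z‖ → ρ z = 0)
    (hg : Integrable g) (hg0 : ∀ x, 0 ≤ g x) (hgK : ∀ x ∉ K, g x = 0)
    (hp : Continuous p) (hpb : ∀ x, |p x| ≤ P)
    (hp2 : ∀ z ∈ K, ∀ x, ‖x - z‖ < ε → p x ≤ 2 * p z) :
    Integrable (fun x => p x * mol ρ g x) ∧ ∫ x, p x * mol ρ g x ≤ 2 * ∫ x, p x * g x := by
  have hρi := hρ.integrable_of_hasCompactSupport (μ := volume) hc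
  have i1 : Integrable (fun z : EuclideanSpace ℝ (Fin d) × EuclideanSpace ℝ (Fin d) =>
      p z.1 * (g z.2 * ρ (z.1 - z.2))) (volume.prod volume) :=
    (hg.convolution_integrand (ContinuousLinearMap.mul ℝ ℝ) hρi).bdd_mul
      (c := P) (hp.comp continuous_fst).aestronglyMeasurable (ae_of_all _ fun z => hpb z.1)
  have i2 : Integrable fun x => p x * g x :=
    hg.bdd_mul (c := P) hp.aestronglyMeasurable (ae_of_all _ hpb)
  have e1 : ∀ x, p x * mol ρ g x = ∫ z, p x * (g z * ρ (x - z)) := fun x => by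
    rw [integral_const_mul]; rfl
  simp only [e1]
  refine ⟨i1.integral_prod_left, ?_⟩
  rw [integral_integral_swap i1, ← integral_const_mul]
  refine integral_mono i1.integral_prod_right (i2.const_mul 2) fun z => ?_
  have i3 : Integrable fun x => ρ (x - z) := hρi.comp_sub_right z
  have e3 : ∫ x, ρ (x - z) = 1 := by rw [integral_sub_right_eq_self (fun z => ρ z), h1]
  have i4 : Integrable fun x => p x * (g z * ρ (x - z)) :=
    (i3.const_mul (g z)).bdd_mul (c := P) hp.aestronglyMeasurable (ae_of_all _ hpb)
  calc ∫ x, p x * (g z * ρ (x - z)) ≤ ∫ x, 2 * (p z * g z) * ρ (x - z) := by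
        refine integral_mono i4 (i3.const_mul _) fun x => ?_
        by_cases hz : z ∈ K
        · rcases lt_or_ge ‖x - z‖ ε with h | h
          · have := mul_le_mul_of_nonneg_right (hp2 z hz x h) (mul_nonneg (hg0 z) (h0 (x - z)))
            simp only
            linarith
          · simp [hε _ h]
        · simp [hgK z hz]
    _ = 2 * (p z * g z) := by rw [integral_const_mul, e3, mul_one]

/-- Functions of class `C²` in space only, to which the Carleman inequality is extended by
mollification. -/
structure IsPre (T : ℝ) (K : Set (EuclideanSpace ℝ (Fin d)))
    (f f' : EuclideanSpace ℝ (Fin d) → ℝ → ℝ) : Prop where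
  isCompact : IsCompact K
  smooth : ∀ t, ContDiff ℝ 2 (fun x => f x t)
  supp : ∀ t, ∀ x ∉ K, f x t = 0
  supp' : ∀ t ∈ Ioo 0 T, ∀ x ∉ K, f' x t = 0
  ld : ∀ t ∈ Ioo 0 T, LD K f (fun x => f' x t) t
  bound : ∃ C, ∀ x t, |f x t| ≤ C
  cont : ∀ x, Continuous (f x)

lemma IsPre.hasCompactSupport (h : IsPre T K f f') (t : ℝ) :
    HasCompactSupport fun x => f x t := HasCompactSupport.intro h.isCompact (h.supp t)

lemma IsPre.integrable (h : IsPre T K f f') (t : ℝ) : Integrable fun x => f x t :=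
  (h.smooth t).continuous.integrable_of_hasCompactSupport (h.hasCompactSupport t)

lemma IsPre.integrable_deriv (h : IsPre T K f f') {t : ℝ} (ht : t ∈ Ioo 0 T) :
    Integrable fun x => f' x t :=
  (h.ld t ht).integrable_deriv h.isCompact.measurableSet h.isCompact.measure_lt_top.ne
    (h.supp' t ht) h.supp (Eventually.of_forall fun s => h.integrable s) (h.integrable t)

lemma IsPre.isReg (h : IsPre T K f f') {ε : ℝ} (hρ : ContDiff ℝ 2 ρ) (hc : HasCompactSupport ρ)
    (hε : ∀ z, ε ≤ ‖z‖ → ρ z = 0) :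
    IsReg T (cthickening ε K) (fun x t => mol ρ (fun y => f y t) x)
      (fun x t => mol ρ (fun y => f' y t) x) := by
  have hloc := fun t => (h.integrable t).locallyIntegrable
  have hloc' := fun {t : ℝ} (ht : t ∈ Ioo 0 T) => (h.integrable_deriv ht).locallyIntegrable
  have hρ1 : ContDiff ℝ 1 ρ := hρ.of_le (by norm_num)
  have e1 : ∀ i t, pd i (fun y => mol ρ (fun z => f z t) y) = mol (pd i ρ) fun z => f z t :=
    fun i t => pd_mol hρ1 hc (hloc t)
  obtain ⟨U, hU⟩ := h.bound
  have hcont : ∀ {ρ : EuclideanSpace ℝ (Fin d) → ℝ}, Continuous ρ → HasCompactSupport ρ →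
      ∀ x, Continuous fun t => mol ρ (fun y => f y t) x := fun {ρ} h1 h2 x => by
    refine continuous_of_dominated (bound := fun z => U * |ρ (x - z)|)
      (fun t => (integrable_mol h1 h2 (hloc t) x).1) (fun t => ae_of_all _ fun z => ?_) ?_
      (ae_of_all _ fun z => (h.cont z).mul continuous_const)
    · rw [norm_mul]
      exact mul_le_mul_of_nonneg_right (hU z t) (norm_nonneg _)
    · exact ((h1.integrable_of_hasCompactSupport h2).abs.comp_sub_left x).const_mul U
  refine ⟨h.isCompact.cthickening, fun t => contDiff_mol (k := 2) hρ hc (hloc t),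
    fun t ht => contDiff_mol (k := 1) hρ1 hc (hloc' ht), fun t x hx => mol_eq_zero hε (h.supp t) hx,
    fun t ht x hx => mol_eq_zero hε (h.supp' t ht) hx,
    fun t ht => (h.ld t ht).mol hρ.continuous hc h.isCompact h.supp (h.supp' t ht) hloc,
    fun t ht i => ?_, ⟨_, fun x t => abs_mol_le (hρ.continuous.integrable_of_hasCompactSupport hc)
      (fun z => hU z t) x⟩, ?_, hcont hρ.continuous hc, fun x i => ?_⟩
  · simp only [e1]
    have e2 : pd i (fun y => mol ρ (fun z => f' z t) y) = mol (pd i ρ) fun z => f' z t :=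
      pd_mol hρ1 hc (hloc' ht)
    rw [e2]
    exact (h.ld t ht).mol hρ1.continuous_pd hc.pd h.isCompact h.supp (h.supp' t ht) hloc
  · have h2 : ∀ i, ∃ C, ∀ x t, |pd i (fun y => mol ρ (fun z => f z t) y) x| ≤ C := fun i => by
      simp only [e1]
      exact ⟨_, fun x t => abs_mol_le (hρ1.continuous_pd.integrable_of_hasCompactSupport hc.pd)
        (fun z => hU z t) x⟩
    choose C hC using h2
    refine ⟨∑ i, |C i|, fun x t i => (hC i x t).trans ((le_abs_self _).trans ?_)⟩
    exact Finset.single_le_sum (f := fun i => |C i|) (fun i _ => abs_nonneg _) (Finset.mem_univ i)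
  · simp only [e1]
    exact hcont hρ1.continuous_pd hc.pd x

lemma wt_le_two_mul {c : EuclideanSpace ℝ (Fin d)} {a α lam R t ε : ℝ} (ha : 0 < a) (ht : 0 ≤ t)
    (hεR : ε * (2 * R + 1) ≤ 2 * a) {x z : EuclideanSpace ℝ (Fin d)}
    (hz : ‖z - c‖ ≤ R) (hx : ‖x - z‖ < ε) : wt c a α lam x t ≤ 2 * wt c a α lam z t := by
  have h2 : (2 : ℝ) = exp (log 2) := (exp_log (by norm_num)).symm
  have h3 : (1 : ℝ) / 2 ≤ log 2 := by linarith [Real.log_two_gt_d9]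
  have hs : 0 < 4 * (t + a) := by linarith
  rw [wt, wt, h2, ← exp_add]
  refine exp_le_exp.2 ?_
  have h4 : (‖z - c‖ ^ 2 - ‖x - c‖ ^ 2) / (4 * (t + a)) ≤ 1 / 2 := by
    rw [div_le_iff₀ hs]
    have h5 : ‖z - c‖ ≤ ‖x - z‖ + ‖x - c‖ := by
      have := norm_sub_le (x - c) (x - z)
      rw [show x - c - (x - z) = z - c by abel] at this
      linarith
    have h6 := norm_nonneg (x - c)
    have h7 := norm_nonneg (z - c)
    have h8 := norm_nonneg (x - z)
    have h9 : ‖z - c‖ ^ 2 - ‖x - c‖ ^ 2 ≤ ‖x - z‖ * (2 * ‖z - c‖) := by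
      rcases le_total ‖z - c‖ ‖x - z‖ with h | h <;> nlinarith
    have h10 : ‖x - z‖ * (2 * ‖z - c‖) ≤ ε * (2 * R) := by gcongr; linarith
    nlinarith
  rw [sub_div] at h4
  linarith

end CarlemanC2

section CarlemanLimit

variable {d : ℕ} {T : ℝ} {K : Set (EuclideanSpace ℝ (Fin d))}
  {f f' : EuclideanSpace ℝ (Fin d) → ℝ → ℝ} {ρ g p : EuclideanSpace ℝ (Fin d) → ℝ}

/-- A standard sequence of mollifiers. -/
noncomputable def mollBump (d k : ℕ) : ContDiffBump (0 : EuclideanSpace ℝ (Fin d)) :=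
  ⟨1 / (2 * (k + 1)), 1 / (k + 1), by positivity, by
    rw [div_lt_div_iff₀ (by positivity) (by positivity)]
    nlinarith [(Nat.cast_nonneg k : (0 : ℝ) ≤ k)]⟩

/-- The `k`-th mollification kernel. -/
noncomputable def molKer (d k : ℕ) : EuclideanSpace ℝ (Fin d) → ℝ := (mollBump d k).normed volume

lemma mol_ker_eq (k : ℕ) : mol (molKer d k) g =
    convolution (molKer d k) g (ContinuousLinearMap.lsmul ℝ ℝ) volume := by
  ext x
  rw [mol, convolution, ← integral_sub_left_eq_self _ _ x]
  simp [mul_comm]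

lemma tendsto_mol_ker (hg : Continuous g) (x : EuclideanSpace ℝ (Fin d)) :
    Tendsto (fun k => mol (molKer d k) g x) atTop (𝓝 (g x)) := by
  simp only [mol_ker_eq]
  exact ContDiffBump.convolution_tendsto_right_of_continuous (φ := mollBump d)
    tendsto_one_div_add_atTop_nhds_zero_nat hg x

lemma contDiff_molKer (k : ℕ) {n : ℕ∞} : ContDiff ℝ n (molKer d k) := (mollBump d k).contDiff_normed

lemma hasCompactSupport_molKer (k : ℕ) : HasCompactSupport (molKer d k) :=
  (mollBump d k).hasCompactSupport_normed

lemma molKer_nonneg (k : ℕ) (z : EuclideanSpace ℝ (Fin d)) : 0 ≤ molKer d k z :=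
  (mollBump d k).nonneg_normed z

lemma integral_molKer (k : ℕ) : ∫ z, molKer d k z = 1 := (mollBump d k).integral_normed

lemma molKer_eq_zero (k : ℕ) (z : EuclideanSpace ℝ (Fin d)) (hz : 1 / ((k : ℝ) + 1) ≤ ‖z‖) :
    molKer d k z = 0 := by
  have : z ∉ Function.support (molKer d k) := by
    rw [molKer, ContDiffBump.support_normed_eq]
    simpa [mollBump] using hz
  simpa using this

lemma abs_mol_ker_le {U : ℝ} (hg : ∀ x, |g x| ≤ U) (k : ℕ) (x : EuclideanSpace ℝ (Fin d)) :
    |mol (molKer d k) g x| ≤ U := by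
  have := abs_mol_le ((contDiff_molKer (d := d) k (n := 0)).continuous.integrable_of_hasCompactSupport
    (hasCompactSupport_molKer k)) hg x
  simpa [abs_of_nonneg (molKer_nonneg k _), integral_molKer] using this

lemma tendsto_integral_mol_ker (hK : IsCompact K) (hg : ContDiff ℝ 1 g) (hgK : ∀ x ∉ K, g x = 0)
    {p q : EuclideanSpace ℝ (Fin d) → ℝ} (hp : Continuous p) (hq : Continuous q) :
    Tendsto (fun k => ∫ x, (p x * mol (molKer d k) g x ^ 2 + q x * gsq (mol (molKer d k) g) x))
      atTop (𝓝 (∫ x, (p x * g x ^ 2 + q x * gsq g x))) := by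
  have hgc : HasCompactSupport g := HasCompactSupport.intro hK hgK
  have hloc : LocallyIntegrable g :=
    (hg.continuous.integrable_of_hasCompactSupport hgc).locallyIntegrable
  have hpd : ∀ k i, pd i (mol (molKer d k) g) = mol (molKer d k) (pd i g) := fun k i => by
    rw [pd_mol (contDiff_molKer k (n := 1)) (hasCompactSupport_molKer k) hloc,
      mol_pd (contDiff_molKer k (n := 1)) hg hgc]
  have hC : ∀ k, ContDiff ℝ 1 (mol (molKer d k) g) := fun k =>
    contDiff_mol (k := 1) (contDiff_molKer k (n := 1)) (hasCompactSupport_molKer k) hloc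
  obtain ⟨U, hU⟩ := hg.continuous.bounded_above_of_compact_support hgc
  have hU' : ∀ i, ∃ U, ∀ x, |pd i g x| ≤ U := fun i =>
    hg.continuous_pd.bounded_above_of_compact_support hgc.pd
  choose V hV using hU'
  have hK1 : IsCompact (cthickening 1 K) := hK.cthickening
  have hsupp : ∀ k, ∀ x ∉ cthickening 1 K, mol (molKer d k) g x = 0 := fun k x hx =>
    mol_eq_zero (ε := 1) (fun z hz => molKer_eq_zero k z (le_trans (by
      rw [div_le_one (by positivity)]; linarith [(Nat.cast_nonneg k : (0 : ℝ) ≤ k)]) hz)) hgK hx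
  obtain ⟨P, hP⟩ := hK1.exists_bound_of_continuousOn hp.continuousOn
  obtain ⟨Q, hQ⟩ := hK1.exists_bound_of_continuousOn hq.continuousOn
  refine tendsto_integral_of_dominated_convergence
    ((cthickening 1 K).indicator fun _ => P * U ^ 2 + Q * ∑ i, V i ^ 2) (fun k => ?_) ?_
    (fun k => ae_of_all _ fun x => ?_) (ae_of_all _ fun x => ?_)
  · exact ((hp.mul ((hC k).continuous.pow 2)).add
      (hq.mul (hC k).continuous_gsq)).aestronglyMeasurable
  · exact (integrable_indicator_iff hK1.measurableSet).2 (integrableOn_const hK1.measure_lt_top.ne)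
  · by_cases hx : x ∈ cthickening 1 K
    · rw [indicator_of_mem hx]
      refine (norm_add_le _ _).trans (add_le_add ?_ ?_)
      · rw [norm_mul, norm_pow]
        have h1 := hP x hx
        have h2 := abs_mol_ker_le hU k x
        rw [Real.norm_eq_abs (mol _ _ _)]
        have h3 := (norm_nonneg _).trans h1
        gcongr
      · rw [norm_mul, Real.norm_of_nonneg gsq_nonneg]
        have h1 := hQ x hx
        have h3 := (norm_nonneg _).trans h1
        refine mul_le_mul h1 (Finset.sum_le_sum fun i _ => ?_) gsq_nonneg h3
        rw [hpd, ← sq_abs]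
        have := abs_mol_ker_le (hV i) k x
        gcongr
    · rw [hsupp k x hx, gsq_eq_zero_of_eq_zero hK1.isClosed (hsupp k) hx]
      simp [hx]
  · refine (((tendsto_mol_ker hg.continuous x).pow 2).const_mul _).add (Tendsto.const_mul _ ?_)
    simp only [gsq, hpd]
    exact tendsto_finsetSum _ fun i _ => (tendsto_mol_ker hg.continuous_pd x).pow 2

lemma exists_wt_bound {c : EuclideanSpace ℝ (Fin d)} {a α lam t : ℝ} (h : 0 < t + a) :
    ∃ P, ∀ x, |wt c a α lam x t| ≤ P := by
  refine ⟨exp ((1 - d / 2 - α) * log (t + a) + α * lam * (t + a)), fun x => ?_⟩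
  rw [abs_of_pos wt_pos]
  refine exp_le_exp.2 ?_
  have : 0 ≤ ‖x - c‖ ^ 2 / (4 * (t + a)) := by positivity
  linarith

lemma LD.exists_deriv_bound {X : Type*} {K : Set X} {F : X → ℝ → ℝ} {F' : X → ℝ} {t : ℝ}
    (h : LD K F F' t) : ∃ B, ∀ x ∈ K, |F' x| ≤ B := by
  obtain ⟨B, hB⟩ := h.dom
  refine ⟨B, fun x hx => ?_⟩
  refine le_of_tendsto ((hasDerivWithinAt_iff_tendsto_slope' (by simp)).1 (h.deriv x hx)).abs ?_
  filter_upwards [hB, self_mem_nhdsWithin] with s hs hst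
  have hst' : 0 < t - s := sub_pos.2 hst
  rw [slope_def_field, abs_div, abs_sub_comm s t, abs_of_pos hst', div_le_iff₀ hst']
  exact hs x hx

/-- The Carleman inequality. -/
lemma IsPre.carleman (h : IsPre T K f f') {c : EuclideanSpace ℝ (Fin d)} {a α lam : ℝ} (hT : 0 ≤ T)
    (ha : 0 < a) (hα : 1 ≤ α) (hl : 0 < lam) (hls : lam * (T + a) ≤ 1) (hend : ∀ x, f x T = 0)
    {m : ℝ → ℝ} (hm : IntegrableOn m (Icc 0 T))
    (hle : ∀ t ∈ Ioo 0 T,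
      2 * ∫ x, wt c a α lam x t * (f' x t + slap (fun y => f y t) x) ^ 2 ≤ m t) :
    IntegrableOn (fun t => ∫ x, (wt c a α lam x t * (α * lam / 4 / (t + a)) * f x t ^ 2 +
      wt c a α lam x t * (lam / 4) * gsq (fun y => f y t) x)) (Icc 0 T) ∧
    ∫ t in Icc 0 T, (∫ x, (wt c a α lam x t * (α * lam / 4 / (t + a)) * f x t ^ 2 +
      wt c a α lam x t * (lam / 4) * gsq (fun y => f y t) x)) ≤
      (∫ t in Icc 0 T, m t) + α / 2 * ∫ x, wt c a α lam x 0 / a * f x 0 ^ 2 := by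
  have hloc := fun t => (h.integrable t).locallyIntegrable
  obtain ⟨R, hR⟩ : ∃ R, ∀ z ∈ K, ‖z - c‖ ≤ R := by
    obtain ⟨R, hR⟩ := h.isCompact.exists_bound_of_continuousOn
      (f := fun z => z - c) (by fun_prop)
    exact ⟨R, hR⟩
  have hreg : ∀ k : ℕ, IsReg T (cthickening (1 / ((k : ℝ) + 1)) K)
      (fun x t => mol (molKer d k) (fun y => f y t) x)
      (fun x t => mol (molKer d k) (fun y => f' y t) x) := fun k =>
    h.isReg (contDiff_molKer k (n := 2)) (hasCompactSupport_molKer k) (molKer_eq_zero k)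
  have hr1 : ContinuousOn (fun t => α * lam / 4 / (t + a)) (Icc 0 T) :=
    continuousOn_const.div (by fun_prop) fun t ht => by linarith [ht.1]
  have hcont := fun k => (hreg k).continuousOn_wt_energy (c := c) (α := α) (lam := lam) ha hr1
    (continuousOn_const (c := lam / 4))
  have hsmall : ∀ᶠ k : ℕ in atTop, 1 / ((k : ℝ) + 1) * (2 * R + 1) ≤ 2 * a := by
    have h1 : Tendsto (fun k : ℕ => 1 / ((k : ℝ) + 1) * (2 * R + 1)) atTop (𝓝 (0 * (2 * R + 1))) :=
      tendsto_one_div_add_atTop_nhds_zero_nat.mul_const _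
    exact h1.eventually_le_const (by linarith)
  refine integral_le_of_tendsto_of_nonneg
    (B := fun k t => ∫ x, (wt c a α lam x t * (α * lam / 4 / (t + a)) *
      mol (molKer d k) (fun y => f y t) x ^ 2 +
      wt c a α lam x t * (lam / 4) * gsq (mol (molKer d k) (fun y => f y t)) x))
    (b := fun k => (∫ t in Icc 0 T, m t) + α / 2 * ∫ x, (wt c a α lam x 0 / a *
      mol (molKer d k) (fun y => f y 0) x ^ 2 + 0 * gsq (mol (molKer d k) (fun y => f y 0)) x))
    (Eventually.of_forall fun k => (hcont k).integrableOn_Icc) ?_ ?_ ?_ ?_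
  · refine Eventually.of_forall fun k => ?_
    filter_upwards [ae_restrict_mem measurableSet_Icc] with t ht
    refine integral_nonneg fun x => ?_
    have h1 := (wt_pos (c := c) (a := a) (α := α) (lam := lam) (x := x) (t := t)).le
    have h2 : 0 < t + a := by linarith [ht.1]
    have h3 := gsq_nonneg (f := mol (molKer d k) (fun y => f y t)) (x := x)
    positivity
  · filter_upwards with t
    exact tendsto_integral_mol_ker h.isCompact ((h.smooth t).of_le (by norm_num)) (h.supp t)
      (continuous_wt.mul continuous_const) (continuous_wt.mul continuous_const)
  · filter_upwards [hsmall] with k hk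
    have key := (hreg k).carleman (c := c) hT ha hα hl hls (fun x => by simp [mol, hend]) hm ?_
    · rw [intervalIntegral.integral_of_le hT, ← integral_Icc_eq_integral_Ioc,
        integral_sub (hcont k).integrableOn_Icc hm] at key
      simp only [zero_mul, add_zero]
      linarith
    · intro t ht
      refine le_trans ?_ (hle t ht)
      have ht' : 0 < t + a := by linarith [ht.1]
      set ℓ : EuclideanSpace ℝ (Fin d) → ℝ := fun x => f' x t + slap (fun y => f y t) x with hℓ
      have hk1 := contDiff_molKer (d := d) k (n := 1)
      have hfc := h.hasCompactSupport t
      have hf1 : ContDiff ℝ 1 fun x => f x t := (h.smooth t).of_le (by norm_num)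
      have hsc : HasCompactSupport (slap fun y => f y t) := hfc.slap
      have i1 := h.integrable_deriv ht
      have i2 : Integrable (slap fun y => f y t) :=
        (h.smooth t).continuous_slap.integrable_of_hasCompactSupport hsc
      have iℓ : Integrable ℓ := i1.add i2
      have e1 : ∀ x, mol (molKer d k) (fun y => f' y t) x +
          slap (fun y => mol (molKer d k) (fun z => f z t) y) x = mol (molKer d k) ℓ x := fun x => by
        have e2 : slap (fun y => mol (molKer d k) (fun z => f z t) y) x =
            mol (molKer d k) (slap fun y => f y t) x := by
          have e3 : ∀ i, pd i (pd i (mol (molKer d k) fun z => f z t)) =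
              mol (molKer d k) (pd i (pd i fun z => f z t)) := fun i => by
            rw [pd_mol hk1 (hasCompactSupport_molKer k) (hloc t), mol_pd hk1 hf1 hfc,
              pd_mol hk1 (hasCompactSupport_molKer k)
              (hf1.continuous_pd.integrable_of_hasCompactSupport hfc.pd).locallyIntegrable,
              mol_pd hk1 (h.smooth t).pd_one hfc.pd]
          rw [slap_eq_sum_pd]
          change ∑ i, pd i (pd i (mol (molKer d k) fun z => f z t)) x = _
          simp only [e3, mol, slap_eq_sum_pd, Finset.sum_mul]
          rw [integral_finsetSum]
          intro i _
          exact integrable_mol hk1.continuous (hasCompactSupport_molKer k)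
            ((h.smooth t).pd_one.continuous_pd.integrable_of_hasCompactSupport
              hfc.pd.pd).locallyIntegrable x
        rw [e2, mol, mol, mol, ← integral_add (integrable_mol hk1.continuous
          (hasCompactSupport_molKer k) i1.locallyIntegrable x) (integrable_mol hk1.continuous
          (hasCompactSupport_molKer k) i2.locallyIntegrable x)]
        simp only [hℓ, add_mul]
      simp only [e1]
      have hℓK : ∀ x ∉ K, ℓ x = 0 := fun x hx => by
        have : slap (fun y => f y t) x = 0 := by
          have hcl := h.isCompact.isClosed
          rw [slap_eq_sum_pd]
          exact Finset.sum_eq_zero fun i _ => pd_eq_zero_of_eq_zero hcl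
            (fun y hy => pd_eq_zero_of_eq_zero hcl (h.supp t) hy i) hx i
        simp [hℓ, this, h.supp' t ht x hx]
      have hℓb : ∃ B, ∀ x, |ℓ x| ≤ B := by
        obtain ⟨B, hB⟩ := (h.ld t ht).exists_deriv_bound
        obtain ⟨C, hC⟩ := (h.smooth t).continuous_slap.bounded_above_of_compact_support hsc
        refine ⟨|B| + C, fun x => (abs_add_le _ _).trans (add_le_add ?_ (hC x))⟩
        by_cases hx : x ∈ K
        · exact (hB x hx).trans (le_abs_self _)
        · simp [h.supp' t ht x hx]
      obtain ⟨B, hB⟩ := hℓb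
      have iℓ2 : Integrable fun x => ℓ x ^ 2 := by
        simp only [pow_two]
        exact iℓ.bdd_mul iℓ.1 (ae_of_all _ hB)
      obtain ⟨P, hP⟩ := exists_wt_bound (c := c) (α := α) (lam := lam) ht'
      have hwc := continuous_wt (c := c) (a := a) (α := α) (lam := lam) (t := t)
      obtain ⟨j1, j2⟩ := integral_mul_mol_le (K := K) (p := fun x => wt c a α lam x t)
        hk1.continuous (hasCompactSupport_molKer k)
        (molKer_nonneg k) (integral_molKer k) (molKer_eq_zero k) iℓ2 (fun x => sq_nonneg _)
        (fun x hx => by simp [hℓK x hx]) hwc hP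
        fun z hz x hx => wt_le_two_mul ha ht.1.le hk (hR z hz) hx
      refine le_trans (integral_mono_of_nonneg (ae_of_all _ fun x => ?_) j1
        (ae_of_all _ fun x => ?_)) j2
      · exact mul_nonneg wt_pos.le (sq_nonneg _)
      · exact mul_le_mul_of_nonneg_left (mol_sq_le hk1.continuous (hasCompactSupport_molKer k)
          (molKer_nonneg k) (integral_molKer k) iℓ.locallyIntegrable iℓ2.locallyIntegrable x) wt_pos.le
  · have := tendsto_integral_mol_ker h.isCompact ((h.smooth 0).of_le (by norm_num)) (h.supp 0)
      (p := fun x => wt c a α lam x 0 / a) (q := fun _ => 0) (continuous_wt.div_const _)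
      continuous_const
    simp only [zero_mul, add_zero] at this ⊢
    exact (this.const_mul _).const_add _

end CarlemanLimit

section Energy

variable {d : ℕ} {T M U : ℝ} {V K : Set (EuclideanSpace ℝ (Fin d))}
  {w w' : EuclideanSpace ℝ (Fin d) → ℝ → ℝ} {W : EuclideanSpace ℝ (Fin d) → ℝ}

lemma isNull_caccioppoli {f W : EuclideanSpace ℝ (Fin d) → ℝ} (hf : ContDiff ℝ 2 f)
    (hfc : HasCompactSupport f) (hW : ContDiff ℝ 2 W) :
    IsNull fun x => W x * f x * slap f x + W x * gsq f x - f x ^ 2 * slap W x / 2 := by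
  have hf1 : ContDiff ℝ 1 f := hf.of_le (by norm_num)
  have hW1 : ContDiff ℝ 1 W := hW.of_le (by norm_num)
  have n1 := IsNull.sum fun i => isNull_of_pd (f := fun x => W x * f x) (hW1.mul hf1) hf.pd_one
    hfc.mul_left i (g := pd i f)
  have n2 := IsNull.sum fun i => isNull_of_pd (f := fun x => f x * f x) (hf1.mul hf1) hW.pd_one
    hfc.mul_left i (g := pd i W)
  convert! n1.add (n2.const_mul (-1 / 2)) using 1
  funext x
  have df := hf1.differentiable (by norm_num) x
  have dW := hW1.differentiable (by norm_num) x
  have e1 : ∀ i, pd i (fun x => W x * f x) x = W x * pd i f x + pd i W x * f x := fun i => by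
    rw [pd_mul dW df]; ring
  have e2 : ∀ i, pd i (fun x => f x * f x) x = f x * pd i f x + pd i f x * f x := fun i => by
    rw [pd_mul df df]; ring
  simp only [e1, e2, slap_eq_sum_pd, gsq, Finset.mul_sum, Finset.sum_div, ← Finset.sum_add_distrib,
    ← Finset.sum_sub_distrib]
  exact Finset.sum_congr rfl fun i _ => by ring

lemma IsSol.hasCompactSupport (h : IsSol T M U V w w') (t : ℝ) :
    HasCompactSupport fun x => w x t := by
  obtain ⟨S, hS, h0⟩ := h.supp
  exact HasCompactSupport.intro hS fun x hx => h0 x hx t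

/-- Local energy estimate: the weighted Dirichlet integral is integrable in time. -/
lemma IsSol.energy (h : IsSol T M U V w w') (hK : IsCompact K) (hKV : K ⊆ V)
    (hW : ContDiff ℝ 2 W) (hW0 : ∀ x, 0 ≤ W x) (hWK : ∀ x ∉ K, W x = 0) {T' D : ℝ} (hT' : 0 ≤ T')
    (hT'T : T' ≤ T)
    (hD : ∀ t, ∫ x, w x t ^ 2 * (|slap W x| + (2 * M + M ^ 2) * W x) ≤ D) :
    ∃ G : ℝ → ℝ, IntegrableOn G (Icc 0 T') ∧
      (∀ t ∈ Ioo 0 T', ∫ x, W x * gsq (fun y => w y t) x ≤ G t) ∧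
      ∫ t in Icc 0 T', G t ≤ (∫ x, W x * w x T' ^ 2) + D * T' := by
  have hWc := hW.continuous
  have hWs : HasCompactSupport W := HasCompactSupport.intro hK hWK
  have hw1 : ∀ t, ContDiff ℝ 1 fun x => w x t := fun t => (h.smooth t).of_le (by norm_num)
  have hint : ∀ s, Integrable fun x => W x * (w x s * w x s) := fun s =>
    (hWc.mul ((hw1 s).continuous.mul (hw1 s).continuous)).integrable_of_hasCompactSupport
      hWs.mul_right
  have hld : ∀ t ∈ Ioo 0 T', LD K (fun x s => W x * (w x s * w x s))
      (fun x => W x * (w' x t * w x t + w x t * w' x t)) t := fun t ht => by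
    have ht' : t ∈ Ioc 0 T := ⟨ht.1, ht.2.le.trans hT'T⟩
    have := h.ld ht' (h.leftLip hK hKV ht')
    obtain ⟨B, hB⟩ := hWc.bounded_above_of_compact_support hWs
    exact (this.mul this).const_mul ⟨B, fun x _ => hB x⟩
  have hdi : ∀ t ∈ Ioo 0 T', Integrable fun x => W x * (w' x t * w x t + w x t * w' x t) :=
    fun t ht => (hld t ht).integrable_deriv hK.measurableSet hK.measure_lt_top.ne
      (fun x hx => by simp [hWK x hx]) (fun s x hx => by simp [hWK x hx])
      (Eventually.of_forall hint) (hint t)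
  have hder : ∀ t ∈ Ioo 0 T', HasDerivWithinAt (fun s => ∫ x, W x * (w x s * w x s))
      (∫ x, W x * (w' x t * w x t + w x t * w' x t)) (Iio t) t := fun t ht =>
    (hld t ht).hasDerivWithinAt_integral hK.measurableSet hK.measure_lt_top.ne
      (fun s x hx => by simp [hWK x hx]) (fun x hx => by simp [hWK x hx])
      (Eventually.of_forall hint) (hint t)
  have hcont : Continuous fun s => ∫ x, W x * (w x s * w x s) := by
    refine continuous_of_dominated (bound := fun x => W x * (U * U)) (fun s => (hint s).1)
      (fun s => ae_of_all _ fun x => ?_)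
      ((hWc.integrable_of_hasCompactSupport hWs).mul_const _)
      (ae_of_all _ fun x => continuous_const.mul ((h.cont x).mul (h.cont x)))
    rw [norm_mul, norm_mul, Real.norm_of_nonneg (hW0 x)]
    have := h.bound x s
    have hU := h.U_nonneg
    simp only [Real.norm_eq_abs]
    have h0 := hW0 x
    gcongr
  have hgi : ∀ t, Integrable fun x => W x * gsq (fun y => w y t) x := fun t =>
    (hWc.mul (hw1 t).continuous_gsq).integrable_of_hasCompactSupport hWs.mul_right
  have hDi : ∀ t, Integrable fun x => w x t ^ 2 * (|slap W x| + (2 * M + M ^ 2) * W x) := fun t => by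
    refine Continuous.integrable_of_hasCompactSupport ?_ (HasCompactSupport.mul_left ?_)
    · have := hW.continuous_slap
      have := (hw1 t).continuous
      fun_prop
    · exact (hWs.slap.comp_left (g := fun z : ℝ => |z|) abs_zero).add hWs.mul_left
  have hkey : ∀ t ∈ Ioo 0 T', ∫ x, W x * gsq (fun y => w y t) x ≤
      (∫ x, W x * (w' x t * w x t + w x t * w' x t)) + D := fun t ht => by
    have hn := (isNull_caccioppoli (h.smooth t) (h.hasCompactSupport t) hW).const_mul (-2)
    have := hn.integral_le (hgi t) ((hdi t ht).add (hDi t)) fun x => ?_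
    · rw [integral_add' (hdi t ht) (hDi t)] at this
      linarith [hD t]
    · simp only [Pi.add_apply]
      have hL : -(w x t ^ 2 * |slap W x|) ≤ -(w x t ^ 2 * slap W x) := by
        have := le_abs_self (slap W x)
        have := mul_le_mul_of_nonneg_left this (sq_nonneg (w x t))
        linarith
      by_cases hx : x ∈ K
      · have hp := h.pde x (hKV hx) t ⟨ht.1.le, ht.2.le.trans hT'T⟩
        set G := gsq (fun y => w y t) x with hG
        have hG0 : 0 ≤ G := gsq_nonneg
        have hs := Real.sq_sqrt hG0
        set g := √G with hg
        set ℓ := slap (fun y => w y t) x + w' x t with hℓ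
        have e1 : -(2 * w x t * ℓ) ≤ 2 * M * w x t ^ 2 + (M ^ 2 * w x t ^ 2 + G) := by
          have a1 : -(w x t * ℓ) ≤ |w x t| * |ℓ| := by rw [← abs_mul]; exact neg_le_abs _
          have a2 : |w x t| * |ℓ| ≤ |w x t| * (M * (|w x t| + g)) := by gcongr
          have a3 := sq_abs (w x t)
          have a4 := sq_nonneg (M * |w x t| - g)
          have a5 : (M * |w x t| - g) ^ 2 = M ^ 2 * w x t ^ 2 - 2 * (M * |w x t| * g) + G := by
            rw [← a3, ← hs]; ring
          have a6 : |w x t| * (M * (|w x t| + g)) = M * w x t ^ 2 + M * |w x t| * g := by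
            rw [← a3]; ring
          linarith
        have e2 := mul_le_mul_of_nonneg_left e1 (hW0 x)
        have e3 : w' x t = ℓ - slap (fun y => w y t) x := by rw [hℓ]; ring
        rw [e3]
        linarith
      · simp only [hWK x hx]
        linarith
  have hder' : ∀ t ∈ Ioo 0 T', HasDerivWithinAt (fun s => (∫ x, W x * (w x s * w x s)) + D * s)
      ((∫ x, W x * (w' x t * w x t + w x t * w' x t)) + D) (Iio t) t := fun t ht => by
    have := (hder t ht).fun_add (((hasDerivAt_id t).const_mul D).hasDerivWithinAt)
    simpa using this
  have hcont' : ContinuousOn (fun s => (∫ x, W x * (w x s * w x s)) + D * s) (Icc 0 T') := by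
    fun_prop
  have hGint := integrableOn_deriv_left_of_nonneg hT' hcont' hder' fun t ht =>
    (integral_nonneg fun x => mul_nonneg (hW0 x) gsq_nonneg).trans (hkey t ht)
  refine ⟨_, hGint, hkey, ?_⟩
  have := integral_le_sub_of_hasDeriv_left hT' hcont' hder' hGint fun t _ => le_rfl
  rw [intervalIntegral.integral_of_le hT', ← integral_Icc_eq_integral_Ioc] at this
  have h0 : 0 ≤ ∫ x, W x * (w x 0 * w x 0) :=
    integral_nonneg fun x => mul_nonneg (hW0 x) (mul_self_nonneg _)
  simp only [pow_two]
  linarith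

end Energy

section CutCarleman

variable {d : ℕ} {T M U : ℝ} {V K Kf S : Set (EuclideanSpace ℝ (Fin d))}
  {w w' : EuclideanSpace ℝ (Fin d) → ℝ → ℝ} {W η : EuclideanSpace ℝ (Fin d) → ℝ}

lemma sq_sum_pd_mul_le (f g : EuclideanSpace ℝ (Fin d) → ℝ) (x) :
    (∑ i, pd i f x * pd i g x) ^ 2 ≤ gsq f x * gsq g x :=
  Finset.sum_mul_sq_le_sq_mul_sq _ _ _

lemma gsq_mul_le {f g : EuclideanSpace ℝ (Fin d) → ℝ} {x} (hf : DifferentiableAt ℝ f x)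
    (hg : DifferentiableAt ℝ g x) :
    gsq (fun y => f y * g y) x ≤ 2 * (f x ^ 2 * gsq g x) + 2 * (g x ^ 2 * gsq f x) := by
  simp only [gsq, pd_mul hf hg, Finset.mul_sum, ← Finset.sum_add_distrib]
  refine Finset.sum_le_sum fun i _ => ?_
  nlinarith [sq_nonneg (pd i f x * g x - f x * pd i g x)]

lemma sq_mul_gsq_le {f g : EuclideanSpace ℝ (Fin d) → ℝ} {x} (hf : DifferentiableAt ℝ f x)
    (hg : DifferentiableAt ℝ g x) :
    f x ^ 2 * gsq g x ≤ 2 * gsq (fun y => f y * g y) x + 2 * (g x ^ 2 * gsq f x) := by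
  simp only [gsq, pd_mul hf hg, Finset.mul_sum, ← Finset.sum_add_distrib]
  refine Finset.sum_le_sum fun i _ => ?_
  nlinarith [sq_nonneg (2 * (pd i f x * g x) + f x * pd i g x)]

lemma cut_rhs_sq_le {M e c c' w ℓ G X H L gf : ℝ} (he : 0 ≤ e) (he1 : e ≤ 1)
    (hc : 0 ≤ c) (hc1 : c ≤ 1) (hG : 0 ≤ G)
    (hℓ : |ℓ| ≤ M * (|w| + √G)) (hX : X ^ 2 ≤ H * G)
    (hgf : (e * c) ^ 2 * G ≤ 2 * gf + 2 * (w ^ 2 * H)) :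
    (e * c * ℓ + e * c' * w + c * w * L + 2 * c * X) ^ 2 ≤
      8 * M ^ 2 * (e * c * w) ^ 2 + 16 * M ^ 2 * gf + 4 * c' ^ 2 * w ^ 2 +
        (16 * M ^ 2 * H + 4 * L ^ 2) * w ^ 2 + 16 * H * G := by
  have h1 : ℓ ^ 2 ≤ 2 * M ^ 2 * (w ^ 2 + G) := by
    have a := pow_le_pow_left₀ (abs_nonneg ℓ) hℓ 2
    rw [sq_abs, mul_pow] at a
    have b : (|w| + √G) ^ 2 ≤ 2 * (w ^ 2 + G) := by
      rw [← sq_abs w]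
      nlinarith [sq_nonneg (|w| - √G), Real.sq_sqrt hG]
    nlinarith [mul_le_mul_of_nonneg_left b (sq_nonneg M)]
  have hc2 : c ^ 2 ≤ 1 := pow_le_one₀ hc hc1
  have he2 : e ^ 2 ≤ 1 := pow_le_one₀ he he1
  have h2 : (e * c * ℓ + e * c' * w + c * w * L + 2 * c * X) ^ 2 ≤
      4 * ((e * c) ^ 2 * ℓ ^ 2 + e ^ 2 * (c' ^ 2 * w ^ 2) + c ^ 2 * (w ^ 2 * L ^ 2) +
        c ^ 2 * (4 * X ^ 2)) := by
    nlinarith [sq_nonneg (e * c * ℓ - e * c' * w), sq_nonneg (e * c * ℓ - c * w * L),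
      sq_nonneg (e * c * ℓ - 2 * c * X), sq_nonneg (e * c' * w - c * w * L),
      sq_nonneg (e * c' * w - 2 * c * X), sq_nonneg (c * w * L - 2 * c * X)]
  have h3 : (e * c) ^ 2 * ℓ ^ 2 ≤ (e * c) ^ 2 * (2 * M ^ 2 * (w ^ 2 + G)) := by gcongr
  have h4 : e ^ 2 * (c' ^ 2 * w ^ 2) ≤ c' ^ 2 * w ^ 2 :=
    mul_le_of_le_one_left (by positivity) he2
  have h5 : c ^ 2 * (w ^ 2 * L ^ 2) ≤ w ^ 2 * L ^ 2 := mul_le_of_le_one_left (by positivity) hc2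
  have h6 : c ^ 2 * (4 * X ^ 2) ≤ 4 * (H * G) := by
    refine (mul_le_of_le_one_left (by positivity) hc2).trans ?_
    linarith
  have h7 := mul_le_mul_of_nonneg_left hgf (sq_nonneg M)
  nlinarith

set_option maxHeartbeats 2000000 in
/-- The localised Carleman inequality for a solution of the differential inequality. -/
lemma IsSol.cut_carleman (h : IsSol T M U V w w') (hK : IsCompact K) (hKV : K ⊆ V)
    (hW : ContDiff ℝ 2 W) (hW0 : ∀ x, 0 ≤ W x) (hWK : ∀ x ∉ K, W x = 0)
    (hKf : IsCompact Kf) (hKfK : Kf ⊆ K) {c₀ : ℝ} (hc₀ : 0 < c₀) (hWc : ∀ x ∈ Kf, c₀ ≤ W x)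
    (hη : ContDiff ℝ 2 η) (hη0 : ∀ x, 0 ≤ η x) (hη1 : ∀ x, η x ≤ 1) (hηK : ∀ x ∉ Kf, η x = 0)
    {C₁ : ℝ} (hC₁ : 0 ≤ C₁) (hηg : ∀ x, gsq η x ≤ C₁) (hηs : ∀ x, slap η x ^ 2 ≤ C₁)
    (hηgS : ∀ x ∉ S, gsq η x = 0) (hηsS : ∀ x ∉ S, slap η x = 0)
    {T' : ℝ} (hT' : 0 < T') (hT'T : T' ≤ T) (hT'1 : T' ≤ 1)
    {χ χ' : ℝ → ℝ} (hχ : ∀ t, HasDerivAt χ (χ' t) t) (hχ0 : ∀ t, 0 ≤ χ t) (hχ1 : ∀ t, χ t ≤ 1)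
    (hχT : χ T' = 0) {C₂ τ₂ : ℝ} (hχ' : ∀ t, χ' t ^ 2 ≤ C₂) (hχτ : ∀ t < τ₂, χ' t = 0)
    {D : ℝ} (hD : ∀ t, ∫ x, w x t ^ 2 * (|slap W x| + (2 * M + M ^ 2) * W x) ≤ D)
    (hD0 : ∀ t, ∫ x, W x * w x t ^ 2 ≤ D)
    {c : EuclideanSpace ℝ (Fin d)} {a α lam P₁ P₂ : ℝ} (ha : 0 < a) (hα : 1 ≤ α)
    (hlM : 256 * M ^ 2 ≤ lam) (hls : lam * (T' + a) ≤ 1) (hs1 : T' + a ≤ 1)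
    (hP₁ : 0 ≤ P₁) (hP₂ : 0 ≤ P₂)
    (hwt₁ : ∀ t ∈ Ioo 0 T', ∀ x ∈ S, x ∈ Kf → wt c a α lam x t ≤ P₁ * W x)
    (hwt₂ : ∀ t ∈ Ioo 0 T', τ₂ ≤ t → ∀ x ∈ Kf, wt c a α lam x t ≤ P₂ * W x)
    {t₁ t₂ L : ℝ} (ht₁ : 0 ≤ t₁) (ht₁₂ : t₁ ≤ t₂) (ht₂ : t₂ ≤ T')
    (hL : ∀ t ∈ Icc t₁ t₂,
      L ≤ ∫ x, wt c a α lam x t * (α * lam / 4 / (t + a)) * (η x * χ t * w x t) ^ 2) :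
    (t₂ - t₁) * L ≤ 192 * C₁ * (M ^ 2 + 1) * P₁ * D + 16 * C₂ * P₂ * D +
      α * ∫ x, wt c a α lam x 0 / a * (η x * χ 0 * w x 0) ^ 2 := by
  have hM := h.M_pos
  have hlam : 0 < lam := lt_of_lt_of_le (by positivity) hlM
  have hC₂ : 0 ≤ C₂ := (sq_nonneg _).trans (hχ' 0)
  have hWcont := hW.continuous
  have hWs : HasCompactSupport W := HasCompactSupport.intro hK hWK
  have hw1 : ∀ t, ContDiff ℝ 1 fun x => w x t := fun t => (h.smooth t).of_le (by norm_num)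
  have hη1' : ContDiff ℝ 1 η := hη.of_le (by norm_num)
  obtain ⟨G, hGi, hG, hGint⟩ := h.energy hK hKV hW hW0 hWK hT'.le hT'T hD
  have hcl := hKf.isClosed
  set f : EuclideanSpace ℝ (Fin d) → ℝ → ℝ := fun x t => η x * χ t * w x t with hf
  set f' : EuclideanSpace ℝ (Fin d) → ℝ → ℝ :=
    fun x t => η x * (χ' t * w x t + χ t * w' x t) with hf'
  have hηχ : ∀ t, ContDiff ℝ 2 fun x => η x * χ t := fun t => hη.mul contDiff_const
  have hfC : ∀ t, ContDiff ℝ 2 fun x => f x t := fun t => (hηχ t).mul (h.smooth t)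
  have hηb : ∃ B, ∀ x ∈ Kf, |η x| ≤ B := ⟨1, fun x _ => abs_le.2 ⟨by linarith [hη0 x], hη1 x⟩⟩
  have hf_bdd : ∀ x t, |f x t| ≤ U := fun x t => by
    rw [hf]
    simp only [abs_mul, abs_of_nonneg (hη0 x), abs_of_nonneg (hχ0 t)]
    have := h.bound x t
    have h1 : η x * χ t ≤ 1 := mul_le_one₀ (hη1 x) (hχ0 t) (hχ1 t)
    exact (mul_le_of_le_one_left (abs_nonneg _) h1).trans this
  have hpre : IsPre T' Kf f f' :=
    { isCompact := hKf
      smooth := hfC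
      supp := fun t x hx => by simp [hf, hηK x hx]
      supp' := fun t _ x hx => by simp [hf', hηK x hx]
      ld := fun t ht => by
        have ht' : t ∈ Ioc 0 T := ⟨ht.1, ht.2.le.trans hT'T⟩
        have h1 := (h.ld ht' (h.leftLip hK hKV ht')).mono hKfK
        have := ((LD.of_hasDerivAt (K := Kf) (hχ t)).mul h1).const_mul hηb
        simpa only [hf, hf', mul_assoc] using this
      bound := ⟨U, hf_bdd⟩
      cont := fun x => (continuous_const.mul
        (continuous_iff_continuousAt.2 fun t => (hχ t).continuousAt)).mul (h.cont x) }
  have hslap : ∀ x t, f' x t + slap (fun y => f y t) x =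
      η x * χ t * (slap (fun y => w y t) x + w' x t) + η x * χ' t * w x t +
        χ t * w x t * slap η x + 2 * χ t * ∑ i, pd i η x * pd i (fun y => w y t) x := by
    intro x t
    have e1 : slap (fun y => f y t) x = χ t * slap (fun y => η y * w y t) x := by
      rw [← slap_const_mul _ (hη.mul (h.smooth t))]
      congr 1; funext y; simp only [hf]; ring
    rw [e1, slap_mul hη (h.smooth t)]
    simp only [hf']; ring
  have hzero : ∀ x ∉ Kf, ∀ t, f' x t + slap (fun y => f y t) x = 0 := fun x hx t => by
    have h1 : ∀ i, pd i η x = 0 := pd_eq_zero_of_eq_zero hcl hηK hx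
    have h2 : slap η x = 0 := by
      rw [slap_eq_sum_pd]
      refine Finset.sum_eq_zero fun i _ => ?_
      exact pd_eq_zero_of_eq_zero hcl (fun y hy => pd_eq_zero_of_eq_zero hcl hηK hy i) hx i
    rw [hslap]
    simp [hηK x hx, h1, h2]
  have hptw : ∀ t ∈ Ioo 0 T', ∀ x ∈ Kf, (f' x t + slap (fun y => f y t) x) ^ 2 ≤
      8 * M ^ 2 * f x t ^ 2 + 16 * M ^ 2 * gsq (fun y => f y t) x + 4 * χ' t ^ 2 * w x t ^ 2 +
        (16 * M ^ 2 * gsq η x + 4 * slap η x ^ 2) * w x t ^ 2 +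
        16 * gsq η x * gsq (fun y => w y t) x := fun t ht x hx => by
    rw [hslap]
    refine cut_rhs_sq_le (hη0 x) (hη1 x) (hχ0 t) (hχ1 t) gsq_nonneg
      (h.pde x (hKV (hKfK hx)) t ⟨ht.1.le, ht.2.le.trans hT'T⟩) (sq_sum_pd_mul_le _ _ x) ?_
    have h1 := sq_mul_gsq_le (x := x) (f := fun y => η y * χ t) (g := fun y => w y t)
      (((hηχ t).differentiable (by norm_num)) x) (((hw1 t).differentiable (by norm_num)) x)
    have h2 : gsq (fun y => η y * χ t) x ≤ gsq η x := by
      simp only [gsq]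
      refine Finset.sum_le_sum fun i _ => ?_
      have : pd i (fun y => η y * χ t) x = χ t * pd i η x := by
        rw [← pd_const_mul _ (hη1'.differentiable (by norm_num) x)]
        congr 1; funext y; ring
      rw [this, mul_pow]
      exact mul_le_of_le_one_left (sq_nonneg _) (pow_le_one₀ (hχ0 t) (hχ1 t))
    have h3 := mul_le_mul_of_nonneg_left h2 (sq_nonneg (w x t))
    linarith
  have hgwi : ∀ t, Integrable fun x => W x * gsq (fun y => w y t) x := fun t =>
    (hWcont.mul (hw1 t).continuous_gsq).integrable_of_hasCompactSupport hWs.mul_right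
  have hw2i : ∀ t, Integrable fun x => W x * w x t ^ 2 := fun t =>
    (hWcont.mul ((hw1 t).continuous.pow 2)).integrable_of_hasCompactSupport hWs.mul_right
  -- a crude bound, giving integrability in time
  obtain ⟨P, hP0, hP⟩ : ∃ P, 0 ≤ P ∧ ∀ x ∈ Kf, ∀ t ∈ Icc 0 T', wt c a α lam x t ≤ P := by
    obtain ⟨P, hP⟩ := wt_bound (c := c) (α := α) (lam := lam) ha hKf T'
    exact ⟨|P|, abs_nonneg P, fun x hx t ht => (hP x hx t ht).trans (le_abs_self P)⟩
  have hg0 : ∀ x t, 0 ≤ gsq (fun y => w y t) x := fun x t => gsq_nonneg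
  have hgsqχ : ∀ t x, gsq (fun y => η y * χ t) x ≤ gsq η x := fun t x => by
    simp only [gsq]
    refine Finset.sum_le_sum fun i _ => ?_
    have : pd i (fun y => η y * χ t) x = χ t * pd i η x := by
      rw [← pd_const_mul _ (hη1'.differentiable (by norm_num) x)]
      congr 1; funext y; ring
    rw [this, mul_pow]
    exact mul_le_of_le_one_left (sq_nonneg _) (pow_le_one₀ (hχ0 t) (hχ1 t))
  have hQ0 : ∀ t, 0 ≤ ∫ x, W x * (w x t ^ 2 + gsq (fun y => w y t) x) := fun t =>
    integral_nonneg fun x => mul_nonneg (hW0 x) (add_nonneg (sq_nonneg _) (hg0 x t))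
  have hQi : ∀ t, Integrable fun x => W x * (w x t ^ 2 + gsq (fun y => w y t) x) := fun t => by
    simp only [mul_add]; exact (hw2i t).add (hgwi t)
  have hQ : ∀ t ∈ Ioo 0 T', ∫ x, W x * (w x t ^ 2 + gsq (fun y => w y t) x) ≤ D + G t :=
    fun t ht => by
      simp only [mul_add]
      rw [integral_add (hw2i t) (hgwi t)]
      exact add_le_add (hD0 t) (hG t ht)
  set Λ := 32 * M ^ 2 + 48 * M ^ 2 * C₁ + 4 * C₂ + 20 * C₁ with hΛ
  have hΛ0 : 0 ≤ Λ := by positivity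
  have hcrude : ∀ t ∈ Ioo 0 T', ∀ x,
      wt c a α lam x t * (f' x t + slap (fun y => f y t) x) ^ 2 ≤
        P / c₀ * Λ * (W x * (w x t ^ 2 + gsq (fun y => w y t) x)) := fun t ht x => by
    by_cases hx : x ∈ Kf
    · have hP' := hP x hx t ⟨ht.1.le, ht.2.le⟩
      have h1 : wt c a α lam x t ≤ P / c₀ * W x := by
        refine hP'.trans ?_
        rw [div_mul_eq_mul_div, le_div_iff₀ hc₀]
        exact mul_le_mul_of_nonneg_left (hWc x hx) hP0
      have h2 : (f' x t + slap (fun y => f y t) x) ^ 2 ≤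
          Λ * (w x t ^ 2 + gsq (fun y => w y t) x) := by
        have a1 := hptw t ht x hx
        have a0 : (η x * χ t) ^ 2 ≤ 1 := pow_le_one₀ (mul_nonneg (hη0 x) (hχ0 t))
          (mul_le_one₀ (hη1 x) (hχ0 t) (hχ1 t))
        have a2 : f x t ^ 2 ≤ w x t ^ 2 := by
          simp only [hf, mul_pow] at a0 ⊢
          exact mul_le_of_le_one_left (sq_nonneg _) a0
        have a3 := gsq_mul_le (x := x) (f := fun y => η y * χ t) (g := fun y => w y t)
          (((hηχ t).differentiable (by norm_num)) x) (((hw1 t).differentiable (by norm_num)) x)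
        have a4 : (η x * χ t) ^ 2 * gsq (fun y => w y t) x ≤ gsq (fun y => w y t) x :=
          mul_le_of_le_one_left (hg0 x t) a0
        have a5 : w x t ^ 2 * gsq (fun y => η y * χ t) x ≤ w x t ^ 2 * C₁ := by
          have := (hgsqχ t x).trans (hηg x)
          gcongr
        have a6 : gsq (fun y => f y t) x ≤ 2 * gsq (fun y => w y t) x + 2 * (w x t ^ 2 * C₁) := by
          simp only [hf]; linarith
        have b1 := mul_le_mul_of_nonneg_left a2 (by positivity : 0 ≤ 8 * M ^ 2)
        have b2 := mul_le_mul_of_nonneg_left a6 (by positivity : 0 ≤ 16 * M ^ 2)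
        have b3 := mul_le_mul_of_nonneg_right (hχ' t) (sq_nonneg (w x t))
        have b4 := mul_le_mul_of_nonneg_right (hηg x) (by positivity : 0 ≤ 16 * M ^ 2 * w x t ^ 2)
        have b5 := mul_le_mul_of_nonneg_right (hηs x) (sq_nonneg (w x t))
        have b6 := mul_le_mul_of_nonneg_right (hηg x) (hg0 x t)
        have b7 := hg0 x t
        have b8 : 0 ≤ M ^ 2 * w x t ^ 2 := by positivity
        have b9 : 0 ≤ (48 * M ^ 2 * C₁ + 4 * C₂ + 4 * C₁) * gsq (fun y => w y t) x := by positivity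
        have b10 : 0 ≤ C₁ * w x t ^ 2 := by positivity
        rw [hΛ]
        linarith
      calc _ ≤ P / c₀ * W x * (Λ * (w x t ^ 2 + gsq (fun y => w y t) x)) :=
            mul_le_mul h1 h2 (sq_nonneg _) (mul_nonneg (by positivity) (hW0 x))
        _ = _ := by ring
    · rw [hzero x hx]
      have := hW0 x
      have := hg0 x t
      have : 0 ≤ P / c₀ * Λ * (W x * (w x t ^ 2 + gsq (fun y => w y t) x)) := by positivity
      simpa using this
  have hDG : IntegrableOn (fun t => D + G t) (Icc 0 T') :=
    (integrableOn_const (by simp)).add hGi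
  have hfirst := (hpre.carleman (c := c) (α := α) (m := fun t => 2 * (P / c₀ * Λ) * (D + G t)) hT'.le ha
    hα hlam hls (fun x => by simp [hf, hχT]) (hDG.const_mul _) fun t ht => by
      have h1 := integral_mono_of_nonneg (ae_of_all _ fun x => mul_nonneg wt_pos.le (sq_nonneg _))
        ((hQi t).const_mul (P / c₀ * Λ)) (ae_of_all volume (hcrude t ht))
      rw [integral_const_mul] at h1
      have h2 := mul_le_mul_of_nonneg_left (hQ t ht) (by positivity : 0 ≤ 2 * (P / c₀ * Λ))
      linarith).1
  -- the sharp pass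
  set E₁ := 32 * C₁ * (M ^ 2 + 1) * P₁ with hE₁
  set E₂ := 8 * C₂ * P₂ with hE₂
  have hE₁0 : 0 ≤ E₁ := by positivity
  have hE₂0 : 0 ≤ E₂ := by positivity
  have hsharp : ∀ t ∈ Ioo 0 T', ∀ x,
      2 * (wt c a α lam x t * (f' x t + slap (fun y => f y t) x) ^ 2) ≤
        1 / 2 * (wt c a α lam x t * (α * lam / 4 / (t + a)) * f x t ^ 2 +
          wt c a α lam x t * (lam / 4) * gsq (fun y => f y t) x) +
        (E₁ * (W x * (w x t ^ 2 + gsq (fun y => w y t) x)) + E₂ * (W x * w x t ^ 2)) :=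
    fun t ht x => by
      have hW0x := hW0 x
      have hg0x := hg0 x t
      have hp : 0 < wt c a α lam x t := wt_pos
      have hgf0 : 0 ≤ gsq (fun y => f y t) x := gsq_nonneg
      have hs : 0 < t + a := by linarith [ht.1]
      by_cases hx : x ∈ Kf
      · have a1 := mul_le_mul_of_nonneg_left (hptw t ht x hx) hp.le
        have a2 : 16 * M ^ 2 * (wt c a α lam x t * f x t ^ 2) ≤
            1 / 2 * (α * lam / 4 / (t + a)) * (wt c a α lam x t * f x t ^ 2) := by
          refine mul_le_mul_of_nonneg_right ?_ (by positivity)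
          have : lam ≤ α * lam / (t + a) := by
            rw [le_div_iff₀ hs]
            have u1 : lam * (t + a) ≤ lam * 1 := mul_le_mul_of_nonneg_left (by linarith [ht.2]) hlam.le
            have u2 : 1 * lam ≤ α * lam := mul_le_mul_of_nonneg_right hα hlam.le
            linarith
          have e : α * lam / 4 / (t + a) = α * lam / (t + a) / 4 := by ring
          rw [e]; linarith
        have a3 : 32 * M ^ 2 * (wt c a α lam x t * gsq (fun y => f y t) x) ≤
            1 / 2 * (lam / 4) * (wt c a α lam x t * gsq (fun y => f y t) x) := by
          refine mul_le_mul_of_nonneg_right ?_ (by positivity)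
          linarith
        have a4 : wt c a α lam x t * (8 * χ' t ^ 2 * w x t ^ 2) ≤ E₂ * (W x * w x t ^ 2) := by
          by_cases htτ : t < τ₂
          · rw [hχτ t htτ]
            simp only [ne_eq, OfNat.ofNat_ne_zero, not_false_eq_true, zero_pow, mul_zero, zero_mul]
            positivity
          · have b := hwt₂ t ht (not_lt.1 htτ) x hx
            calc wt c a α lam x t * (8 * χ' t ^ 2 * w x t ^ 2)
                ≤ (P₂ * W x) * (8 * C₂ * w x t ^ 2) := by
                  have := hχ' t
                  gcongr
              _ = _ := by rw [hE₂]; ring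
        have a5 : wt c a α lam x t * (2 * ((16 * M ^ 2 * gsq η x + 4 * slap η x ^ 2) * w x t ^ 2 +
            16 * gsq η x * gsq (fun y => w y t) x)) ≤
            E₁ * (W x * (w x t ^ 2 + gsq (fun y => w y t) x)) := by
          by_cases hxS : x ∈ S
          · have b := hwt₁ t ht x hxS hx
            calc _ ≤ (P₁ * W x) * (2 * ((16 * M ^ 2 * C₁ + 4 * C₁) * w x t ^ 2 +
                  16 * C₁ * gsq (fun y => w y t) x)) := by
                  have := hηg x
                  have := hηs x
                  have : 0 ≤ gsq η x := gsq_nonneg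
                  gcongr
              _ ≤ (P₁ * W x) * (32 * C₁ * (M ^ 2 + 1) *
                    (w x t ^ 2 + gsq (fun y => w y t) x)) := by
                  refine mul_le_mul_of_nonneg_left ?_ (by positivity)
                  have c1 : 0 ≤ C₁ * w x t ^ 2 := by positivity
                  have c2 : 0 ≤ C₁ * M ^ 2 * gsq (fun y => w y t) x := by positivity
                  linarith
              _ = _ := by rw [hE₁]; ring
          · rw [hηgS x hxS, hηsS x hxS]
            simp only [ne_eq, OfNat.ofNat_ne_zero, not_false_eq_true, zero_pow, mul_zero, zero_mul,
              add_zero]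
            positivity
        linarith
      · rw [hzero x hx]
        simp only [ne_eq, OfNat.ofNat_ne_zero, not_false_eq_true, zero_pow, mul_zero]
        positivity
  have hAi : ∀ t, Integrable fun x => wt c a α lam x t * (α * lam / 4 / (t + a)) * f x t ^ 2 +
      wt c a α lam x t * (lam / 4) * gsq (fun y => f y t) x := fun t => by
    have hc1 : Continuous fun x => wt c a α lam x t := continuous_wt
    have hfc := hpre.hasCompactSupport t
    refine Integrable.add ?_ ?_
    · refine Continuous.integrable_of_hasCompactSupport ?_ (HasCompactSupport.mul_left
        (hfc.comp_left (g := fun z : ℝ => z ^ 2) (by simp)))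
      exact (hc1.mul continuous_const).mul ((hfC t).continuous.pow 2)
    · refine Continuous.integrable_of_hasCompactSupport ?_ (HasCompactSupport.mul_left hfc.gsq)
      exact (hc1.mul continuous_const).mul (((hfC t).of_le (by norm_num)).continuous_gsq)
  set A : ℝ → ℝ := fun t => ∫ x, (wt c a α lam x t * (α * lam / 4 / (t + a)) * f x t ^ 2 +
      wt c a α lam x t * (lam / 4) * gsq (fun y => f y t) x) with hA
  have hDc : IntegrableOn (fun _ : ℝ => E₂ * D) (Icc 0 T') := integrableOn_const (by simp)
  have hm₂ : IntegrableOn (fun t => E₁ * (D + G t) + E₂ * D) (Icc 0 T') :=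
    (hDG.const_mul E₁).add hDc
  have hA2 : IntegrableOn (fun t => 1 / 2 * A t) (Icc 0 T') := hfirst.const_mul _
  have hsecond := (hpre.carleman (c := c) (α := α)
    (m := fun t => 1 / 2 * A t + (E₁ * (D + G t) + E₂ * D)) hT'.le ha
    hα hlam hls (fun x => by simp [hf, hχT]) (hA2.add hm₂) fun t ht => by
      have i1 := (hQi t).const_mul E₁
      have i2 := (hw2i t).const_mul E₂
      have i3 := (hAi t).const_mul (1 / 2)
      have h1 := integral_mono_of_nonneg (ae_of_all _ fun x => mul_nonneg zero_le_two
        (mul_nonneg wt_pos.le (sq_nonneg _))) (i3.add (i1.add i2))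
        (ae_of_all volume (hsharp t ht))
      rw [integral_const_mul, integral_add' i3 (i1.add i2), integral_add' i1 i2,
        integral_const_mul, integral_const_mul, integral_const_mul] at h1
      have h2 := mul_le_mul_of_nonneg_left (hQ t ht) hE₁0
      have h3 := mul_le_mul_of_nonneg_left (hD0 t) hE₂0
      refine h1.trans ?_
      simp only [hA]
      linarith).2
  have hD0' : 0 ≤ D := (integral_nonneg fun x => mul_nonneg (hW0 x) (sq_nonneg _)).trans (hD0 0)
  have hmI : ∫ t in Icc 0 T', (1 / 2 * A t + (E₁ * (D + G t) + E₂ * D)) ≤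
      1 / 2 * (∫ t in Icc 0 T', A t) + (E₁ * (3 * D) + E₂ * D) := by
    have j0 : IntegrableOn (fun _ : ℝ => D) (Icc 0 T') := integrableOn_const (by simp)
    have j1 : IntegrableOn (fun t => E₁ * (D + G t)) (Icc 0 T') := hDG.const_mul E₁
    have k1 : ∫ t in Icc 0 T', D + G t ≤ 3 * D := by
      rw [integral_add j0 hGi]
      have := hD0 T'
      simp only [setIntegral_const, Real.volume_real_Icc_of_le hT'.le, smul_eq_mul, sub_zero]
      have : T' * D ≤ D := mul_le_of_le_one_left hD0' hT'1
      linarith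
    have k2 : ∫ t in Icc 0 T', E₂ * D ≤ E₂ * D := by
      simp only [setIntegral_const, Real.volume_real_Icc_of_le hT'.le, smul_eq_mul, sub_zero]
      exact mul_le_of_le_one_left (by positivity) hT'1
    rw [integral_add hA2 hm₂, integral_add j1 hDc, integral_const_mul, integral_const_mul]
    gcongr
  have hA0 : ∀ t ∈ Icc 0 T', 0 ≤ A t := fun t ht => integral_nonneg fun x => by
    have hp : 0 < wt c a α lam x t := wt_pos
    have hs : 0 < t + a := by linarith [ht.1]
    have : 0 ≤ gsq (fun y => f y t) x := gsq_nonneg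
    simp only [Pi.zero_apply]
    positivity
  have hsub : Icc t₁ t₂ ⊆ Icc 0 T' := Icc_subset_Icc ht₁ ht₂
  have hlow : (t₂ - t₁) * L ≤ ∫ t in Icc t₁ t₂, A t := by
    have : ∫ t in Icc t₁ t₂, L = (t₂ - t₁) * L := by
      simp [Real.volume_real_Icc_of_le ht₁₂]
    rw [← this]
    refine setIntegral_mono_on (integrableOn_const (by simp)) (hfirst.mono_set hsub)
      measurableSet_Icc fun t ht => (hL t ht).trans ?_
    have hs : 0 < t + a := by linarith [(hsub ht).1]
    refine integral_mono_of_nonneg (ae_of_all _ fun x => ?_) (hAi t) (ae_of_all _ fun x => ?_)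
    · have hp : 0 < wt c a α lam x t := wt_pos
      simp only [Pi.zero_apply]
      positivity
    · have hp : 0 < wt c a α lam x t := wt_pos
      have : 0 ≤ gsq (fun y => f y t) x := gsq_nonneg
      simp only [hf]
      exact le_add_of_nonneg_right (by positivity)
  have hup : ∫ t in Icc t₁ t₂, A t ≤ ∫ t in Icc 0 T', A t :=
    setIntegral_mono_set hfirst ((ae_restrict_iff' measurableSet_Icc).2 (ae_of_all _ hA0))
      hsub.eventuallyLE
  have hfin : ∫ t in Icc 0 T', A t ≤ 192 * C₁ * (M ^ 2 + 1) * P₁ * D + 16 * C₂ * P₂ * D +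
      α * ∫ x, wt c a α lam x 0 / a * f x 0 ^ 2 := by
    have := hsecond.trans (add_le_add_left hmI _)
    rw [hE₁, hE₂] at this
    linarith
  exact (hlow.trans hup).trans hfin

end CutCarleman

section Localise

variable {d : ℕ} {T M : ℝ} {H V S : Set (EuclideanSpace ℝ (Fin d))}
  {u : EuclideanSpace ℝ (Fin d) → ℝ → ℝ} {θ : EuclideanSpace ℝ (Fin d) → ℝ}

lemma slap_congr {f g : EuclideanSpace ℝ (Fin d) → ℝ} {x} (h : f =ᶠ[𝓝 x] g) :
    slap f x = slap g x := by
  simp only [slap_eq_sum_pd]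
  exact Finset.sum_congr rfl fun i _ => pd_congr (h.eventually_nhds.mono fun y hy => pd_congr hy)

lemma gsq_congr {f g : EuclideanSpace ℝ (Fin d) → ℝ} {x} (h : f =ᶠ[𝓝 x] g) :
    gsq f x = gsq g x := by
  simp only [gsq]
  exact Finset.sum_congr rfl fun i _ => by rw [pd_congr h]

/-- Cutting off in space and extending in time by constants turns a solution of the differential
inequality on an open set into a globally defined one. -/
lemma exists_isSol (hT : 0 < T) (hM : 0 < M) (hH : IsOpen H)
    (hux : ∀ t ∈ Icc (0 : ℝ) T, ContDiffOn ℝ 2 (fun x => u x t) H)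
    (hut : ∀ x ∈ H, ContDiffOn ℝ 1 (u x) (Icc (0 : ℝ) T))
    (hpde : ∀ x ∈ H, ∀ t ∈ Icc (0 : ℝ) T,
      |slap (fun y => u y t) x + derivWithin (u x) (Icc (0 : ℝ) T) t| ≤
        M * (|u x t| + ‖gradient (fun y => u y t) x‖))
    (hgrow : ∀ x ∈ H, ∀ t ∈ Icc (0 : ℝ) T, |u x t| ≤ M * Real.exp (M * ‖x‖ ^ 2))
    (hS : IsCompact S) (hSH : S ⊆ H) (hV : IsOpen V) (hVS : V ⊆ S)
    (hθ : ContDiff ℝ 2 θ) (hθ0 : ∀ x, 0 ≤ θ x) (hθ1 : ∀ x, θ x ≤ 1) (hθS : ∀ x ∉ S, θ x = 0)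
    (hθV : ∀ x ∈ V, θ x = 1) :
    ∃ U w w', IsSol T M U V w w' ∧ (∀ x ∈ V, ∀ t ∈ Icc 0 T, w x t = u x t) ∧
      ∀ x t, w x t ^ 2 ≤ (M * Real.exp (M * ‖x‖ ^ 2)) ^ 2 := by
  set cl : ℝ → ℝ := fun t => max 0 (min t T) with hcl
  have hclm : ∀ t, cl t ∈ Icc 0 T := fun t => ⟨le_max_left _ _, max_le hT.le (min_le_right _ _)⟩
  have hcle : ∀ t ∈ Icc 0 T, cl t = t := fun t ht => by
    simp only [hcl]; rw [min_eq_left ht.2, max_eq_right ht.1]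
  have hclc : Continuous cl := continuous_const.max (continuous_id.min continuous_const)
  obtain ⟨R, hR⟩ := hS.isBounded.exists_norm_le
  have hb : ∀ x t, |θ x * u x (cl t)| ≤ M * Real.exp (M * ‖x‖ ^ 2) := fun x t => by
    by_cases hx : x ∈ S
    · rw [abs_mul, abs_of_nonneg (hθ0 x)]
      exact (mul_le_of_le_one_left (abs_nonneg _) (hθ1 x)).trans (hgrow x (hSH hx) _ (hclm t))
    · rw [hθS x hx, zero_mul, abs_zero]; positivity
  refine ⟨M * Real.exp (M * R ^ 2), fun x t => θ x * u x (cl t),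
    fun x t => θ x * derivWithin (u x) (Icc 0 T) t, ?_, ?_, ?_⟩
  · refine
    { T_pos := hT
      M_pos := hM
      isOpen := hV
      smooth := fun t => ?_
      supp := ⟨S, hS, fun x hx t => by simp [hθS x hx]⟩
      bound := fun x t => ?_
      deriv := fun x t ht => ?_
      cont_deriv := fun x => ?_
      cont := fun x => ?_
      pde := fun x hx t ht => ?_ }
    · refine contDiff_iff_contDiffAt.2 fun x => ?_
      by_cases hx : x ∈ H
      · exact hθ.contDiffAt.mul ((hux _ (hclm t)).contDiffAt (hH.mem_nhds hx))
      · refine (contDiffAt_const (c := (0 : ℝ))).congr_of_eventuallyEq ?_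
        filter_upwards [hS.isClosed.isOpen_compl.mem_nhds (fun h => hx (hSH h) : x ∈ Sᶜ)] with y hy
        simp [hθS y hy]
    · by_cases hx : x ∈ S
      · refine (hb x t).trans ?_
        have := hR x hx
        gcongr
      · rw [hθS x hx, zero_mul, abs_zero]; positivity
    · by_cases hx : x ∈ H
      · have h1 := ((hut x hx).differentiableOn (by norm_num) t ht).hasDerivWithinAt.const_mul (θ x)
        exact h1.congr (fun s hs => by rw [hcle s hs]) (by rw [hcle t ht])
      · rw [hθS x fun h => hx (hSH h)]
        simpa using hasDerivWithinAt_const t (Icc 0 T) (0 : ℝ)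
    · by_cases hx : x ∈ H
      · exact continuousOn_const.mul
          ((hut x hx).continuousOn_derivWithin (uniqueDiffOn_Icc hT) le_rfl)
      · rw [hθS x fun h => hx (hSH h)]
        simpa using continuousOn_const
    · by_cases hx : x ∈ H
      · exact continuous_const.mul ((hut x hx).continuousOn.comp_continuous hclc hclm)
      · rw [hθS x fun h => hx (hSH h)]
        simpa using continuous_const
    · have he : (fun y => θ y * u y (cl t)) =ᶠ[𝓝 x] fun y => u y t := by
        filter_upwards [hV.mem_nhds hx] with y hy
        rw [hθV y hy, hcle t ht, one_mul]
      rw [slap_congr he, gsq_congr he, gsq_eq_norm_gradient_sq, Real.sqrt_sq (norm_nonneg _),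
        hθV x hx, hcle t ht, one_mul, one_mul]
      exact hpde x (hSH (hVS hx)) t ht
  · intro x hx t ht
    simp only [hθV x hx, hcle t ht, one_mul]
  · intro x t
    rw [← sq_abs]
    exact pow_le_pow_left₀ (abs_nonneg _) (hb x t) 2

end Localise

section Cutoffs

lemma exists_smoothTransition_deriv : ∃ (S₁ S₂ : ℝ → ℝ) (B : ℝ), 0 ≤ B ∧
    (∀ z, HasDerivAt smoothTransition (S₁ z) z) ∧ (∀ z, HasDerivAt S₁ (S₂ z) z) ∧
    (∀ z, |S₁ z| ≤ B) ∧ (∀ z, |S₂ z| ≤ B) ∧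
    (∀ z ∉ Icc (0 : ℝ) 1, S₁ z = 0) ∧ (∀ z ∉ Icc (0 : ℝ) 1, S₂ z = 0) := by
  have hS : ContDiff ℝ 2 smoothTransition := smoothTransition.contDiff (n := 2)
  have hS1 : ContDiff ℝ 1 (deriv smoothTransition) :=
    ((contDiff_succ_iff_deriv (n := 1)).1 (by simpa [one_add_one_eq_two] using hS)).2.2
  have h1 : ∀ z ∉ Icc (0 : ℝ) 1, deriv smoothTransition z = 0 := fun z hz => by
    rw [mem_Icc, not_and_or, not_le, not_le] at hz
    rcases hz with hz | hz
    · rw [(show smoothTransition =ᶠ[𝓝 z] fun _ => 0 from ?_).deriv_eq, deriv_const]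
      filter_upwards [Iio_mem_nhds hz] with y hy using smoothTransition.zero_of_nonpos (le_of_lt hy)
    · rw [(show smoothTransition =ᶠ[𝓝 z] fun _ => 1 from ?_).deriv_eq, deriv_const]
      filter_upwards [Ioi_mem_nhds hz] with y hy using smoothTransition.one_of_one_le (le_of_lt hy)
  have h2 : ∀ z ∉ Icc (0 : ℝ) 1, deriv (deriv smoothTransition) z = 0 := fun z hz => by
    rw [(show deriv smoothTransition =ᶠ[𝓝 z] fun _ => 0 from ?_).deriv_eq, deriv_const]
    filter_upwards [isClosed_Icc.isOpen_compl.mem_nhds hz] with y hy using h1 y hy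
  obtain ⟨B₁, hB₁⟩ := hS1.continuous.bounded_above_of_compact_support
    (HasCompactSupport.intro isCompact_Icc h1)
  obtain ⟨B₂, hB₂⟩ := (hS1.continuous_deriv le_rfl).bounded_above_of_compact_support
    (HasCompactSupport.intro isCompact_Icc h2)
  refine ⟨_, _, max B₁ B₂, (norm_nonneg _).trans ((hB₁ 0).trans (le_max_left _ _)),
    fun z => (hS.differentiable (by norm_num) z).hasDerivAt,
    fun z => (hS1.differentiable (by norm_num) z).hasDerivAt,
    fun z => (hB₁ z).trans (le_max_left _ _), fun z => (hB₂ z).trans (le_max_right _ _), h1, h2⟩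

variable {n : ℕ} {y M : ℝ} {x : EuclideanSpace ℝ (Fin (n + 1))}

/-- The defining function of a ball touching the boundary of a half space. -/
noncomputable def cap (n : ℕ) (y : ℝ) (x : EuclideanSpace ℝ (Fin (n + 1))) : ℝ :=
  x (Fin.last n) - 1 - ‖x‖ ^ 2 / (4 * y)

lemma cap_eq : cap n y = fun x => (x (Fin.last n) -
    (0 : EuclideanSpace ℝ (Fin (n + 1))) (Fin.last n)) + (-1) +
      (-(4 * y)⁻¹) * ‖x - 0‖ ^ 2 := by
  funext x
  simp only [cap, PiLp.zero_apply, sub_zero, div_eq_mul_inv]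
  ring

lemma contDiff_cap {k : WithTop ℕ∞} : ContDiff ℝ k (cap n y) := by
  rw [cap_eq]
  exact ((contDiff_coord 0 _).add contDiff_const).add (contDiff_const.mul (contDiff_norm_sub_sq 0))

lemma pd_cap (i : Fin (n + 1)) :
    pd i (cap n y) x = (if Fin.last n = i then 1 else 0) - (2 * y)⁻¹ * x i := by
  have h1 : ContDiff ℝ 1 (fun x : EuclideanSpace ℝ (Fin (n + 1)) => x (Fin.last n) -
    (0 : EuclideanSpace ℝ (Fin (n + 1))) (Fin.last n)) := contDiff_coord 0 _
  have h2 : ContDiff ℝ 1 (fun x : EuclideanSpace ℝ (Fin (n + 1)) => ‖x - 0‖ ^ 2) :=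
    contDiff_norm_sub_sq 0
  have d1 := h1.differentiable (by norm_num) x
  have d2 := h2.differentiable (by norm_num) x
  rw [cap_eq, pd_add (d1.fun_add (differentiableAt_const _)) (d2.const_mul _),
    pd_add d1 (differentiableAt_const _), pd_coord, pd_const, pd_const_mul _ d2, pd_norm_sub_sq]
  simp only [PiLp.zero_apply, mul_inv]
  ring

lemma slap_cap : slap (cap n y) x = -((2 * y)⁻¹ * (n + 1)) := by
  rw [slap_eq_sum_pd]
  have h : ∀ i, pd i (pd i (cap n y)) x = -(2 * y)⁻¹ := fun i => by
    have h2 : ContDiff ℝ 1 (fun x : EuclideanSpace ℝ (Fin (n + 1)) => x i -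
      (0 : EuclideanSpace ℝ (Fin (n + 1))) i) := contDiff_coord 0 _
    have d2 := h2.differentiable (by norm_num) x
    rw [show pd i (cap n y) = fun x => (if Fin.last n = i then 1 else 0) +
        (-(2 * y)⁻¹) * (x i - (0 : EuclideanSpace ℝ (Fin (n + 1))) i) from
        funext fun x => by rw [pd_cap]; simp [sub_eq_add_neg],
      pd_add (differentiableAt_const _) (d2.const_mul _), pd_const, pd_const_mul _ d2, pd_coord]
    simp
  simp only [h]
  simp; ring

lemma gsq_cap_le : gsq (cap n y) x ≤ 2 + 2 * ((2 * y)⁻¹ * ‖x‖) ^ 2 := by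
  simp only [gsq, pd_cap]
  calc _ ≤ ∑ i, (2 * (if Fin.last n = i then 1 else 0) + 2 * (2 * y)⁻¹ ^ 2 * x i ^ 2) := by
        refine Finset.sum_le_sum fun i _ => ?_
        split_ifs <;> nlinarith [sq_nonneg (1 + (2 * y)⁻¹ * x i), sq_nonneg ((2 * y)⁻¹ * x i)]
    _ = _ := by
        rw [Finset.sum_add_distrib, ← Finset.mul_sum, ← Finset.mul_sum, mul_pow,
          EuclideanSpace.norm_sq_eq]
        simp; ring

lemma coord_le_norm (i : Fin (n + 1)) : x i ≤ ‖x‖ :=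
  (le_abs_self _).trans (PiLp.norm_apply_le x i)

lemma norm_le_of_cap (hy : 0 < y) (hx : -1 ≤ cap n y x) : ‖x‖ ≤ 4 * y := by
  have h1 := coord_le_norm (x := x) (Fin.last n)
  simp only [cap] at hx
  have h2 : ‖x‖ ^ 2 / (4 * y) ≤ ‖x‖ := by linarith
  rw [div_le_iff₀ (by positivity)] at h2
  rcases (norm_nonneg x).eq_or_lt with h | h
  · rw [← h]; positivity
  · exact le_of_mul_le_mul_left (by linarith) h

lemma last_pos_of_cap (hy : 0 < y) (hx : -1 < cap n y x) : 0 < x (Fin.last n) := by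
  have : 0 ≤ ‖x‖ ^ 2 / (4 * y) := by positivity
  simp only [cap] at hx
  linarith

lemma norm_sub_sq_eq_cap (hy : 0 < y) :
    ‖x - y • EuclideanSpace.single (Fin.last n) (1 : ℝ)‖ ^ 2 =
      ‖x‖ ^ 2 / 2 + y ^ 2 - 2 * y * (cap n y x + 1) := by
  rw [norm_sub_sq_real, inner_smul_right, norm_smul]
  simp only [cap, EuclideanSpace.inner_single_right, PiLp.norm_single, norm_one, mul_one,
    Real.norm_eq_abs, sq_abs, one_mul, conj_trivial]
  field_simp
  ring

lemma gsq_cap_le_ten (hy : 0 < y) (hx : -1 ≤ cap n y x) : gsq (cap n y) x ≤ 10 := by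
  refine gsq_cap_le.trans ?_
  have h := norm_le_of_cap hy hx
  have : (2 * y)⁻¹ * ‖x‖ ≤ 2 := by
    rw [inv_mul_le_iff₀ (by positivity)]; linarith
  have h0 : 0 ≤ (2 * y)⁻¹ * ‖x‖ := by positivity
  nlinarith

lemma isCompact_cap_ge (hy : 0 < y) {b : ℝ} (hb : -1 ≤ b) : IsCompact {x | b ≤ cap n y x} := by
  refine (isCompact_closedBall 0 (4 * y)).of_isClosed_subset
    (isClosed_le continuous_const (contDiff_cap (k := 0)).continuous) fun x hx => ?_
  rw [mem_closedBall_zero_iff]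
  exact norm_le_of_cap hy (hb.trans hx)

/-- Bounds for smooth cutoffs along the level sets of `cap`. -/
lemma exists_cutoff_bound (n : ℕ) {k b : ℝ} (hk : 0 < k) (hbk : b ≤ k) : ∃ C, 0 ≤ C ∧
    ∀ y, 1 ≤ y → ∀ x, gsq (fun x => smoothTransition (k * cap n y x + b)) x ≤ C ∧
      |slap (fun x => smoothTransition (k * cap n y x + b)) x| ≤ C ∧
      (k * cap n y x + b ∉ Icc (0 : ℝ) 1 →
        gsq (fun x => smoothTransition (k * cap n y x + b)) x = 0 ∧
        slap (fun x => smoothTransition (k * cap n y x + b)) x = 0) := by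
  obtain ⟨S₁, S₂, B, hB, h1, h2, b1, b2, z1, z2⟩ := exists_smoothTransition_deriv
  refine ⟨10 * (k * B) ^ 2 + 10 * (B * k ^ 2) + B * k * (n + 1), by positivity,
    fun y hy x => ?_⟩
  have hc : ContDiff ℝ 2 (cap n y) := contDiff_cap
  have d1 : ∀ z, HasDerivAt (fun z => smoothTransition (k * z + b)) (S₁ (k * z + b) * k) z :=
    fun z => by
      have := (h1 (k * z + b)).comp z (((hasDerivAt_id z).const_mul k).add_const b)
      simpa [Function.comp_def] using this
  have d2 : ∀ z, HasDerivAt (fun z => S₁ (k * z + b) * k) (S₂ (k * z + b) * k * k) z :=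
    fun z => by
      have := ((h2 (k * z + b)).comp z (((hasDerivAt_id z).const_mul k).add_const b)).mul_const k
      simpa [Function.comp_def] using this
  have e1 : gsq (fun x => smoothTransition (k * cap n y x + b)) x =
      (S₁ (k * cap n y x + b) * k) ^ 2 * gsq (cap n y) x := by
    simp only [gsq, Finset.mul_sum, ← mul_pow]
    refine Finset.sum_congr rfl fun i _ => ?_
    rw [pd_comp (φ := fun z => smoothTransition (k * z + b)) (d1 _)
      (hc.differentiable (by norm_num) x)]
  have e2 : slap (fun x => smoothTransition (k * cap n y x + b)) x =
      S₂ (k * cap n y x + b) * k * k * gsq (cap n y) x +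
        S₁ (k * cap n y x + b) * k * slap (cap n y) x :=
    slap_comp (φ := fun z => smoothTransition (k * z + b)) d1 (d2 _) hc
  have hz : k * cap n y x + b ∉ Icc (0 : ℝ) 1 →
        gsq (fun x => smoothTransition (k * cap n y x + b)) x = 0 ∧
        slap (fun x => smoothTransition (k * cap n y x + b)) x = 0 := fun h => by
    rw [e1, e2, z1 _ h, z2 _ h]; simp
  by_cases h : k * cap n y x + b ∈ Icc (0 : ℝ) 1
  · have hcap : -1 ≤ cap n y x := by
      have := h.1
      by_contra! hlt
      have := mul_lt_mul_of_pos_left hlt hk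
      linarith
    have g0 : 0 ≤ gsq (cap n y) x := gsq_nonneg
    have g1 := gsq_cap_le_ten (by linarith) hcap
    have s1 : |slap (cap n y) x| ≤ n + 1 := by
      rw [slap_cap, abs_neg, abs_of_nonneg (by positivity)]
      refine mul_le_of_le_one_left (by positivity) ?_
      exact inv_le_one_of_one_le₀ (by linarith)
    have a1 := b1 (k * cap n y x + b)
    have a2 := b2 (k * cap n y x + b)
    refine ⟨?_, ?_, hz⟩
    · rw [e1, mul_pow, ← sq_abs]
      have : |S₁ (k * cap n y x + b)| ^ 2 * k ^ 2 * gsq (cap n y) x ≤ B ^ 2 * k ^ 2 * 10 := by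
        gcongr
      have : 0 ≤ 10 * (B * k ^ 2) + B * k * (n + 1) := by positivity
      nlinarith
    · rw [e2]
      refine (abs_add_le _ _).trans ?_
      rw [abs_mul, abs_mul, abs_mul, abs_mul, abs_mul, abs_of_pos hk, abs_of_nonneg g0]
      have u1 : |S₂ (k * cap n y x + b)| * k * k * gsq (cap n y) x ≤ B * k * k * 10 := by gcongr
      have u2 : |S₁ (k * cap n y x + b)| * k * |slap (cap n y) x| ≤ B * k * (n + 1) := by gcongr
      have : 0 ≤ 10 * (k * B) ^ 2 := by positivity
      nlinarith
  · obtain ⟨q1, q2⟩ := hz h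
    refine ⟨?_, ?_, hz⟩
    · rw [q1]; positivity
    · rw [q2, abs_zero]; positivity

/-- The energy weight. -/
noncomputable def capWt (n : ℕ) (M y : ℝ) (x : EuclideanSpace ℝ (Fin (n + 1))) : ℝ :=
  smoothTransition (2 * cap n y x + 1) * exp (-(4 * M) * ‖x‖ ^ 2)

lemma contDiff_cutoff {k b : ℝ} :
    ContDiff ℝ 2 fun x => smoothTransition (k * cap n y x + b) :=
  (smoothTransition.contDiff (n := 2)).comp ((contDiff_const.mul contDiff_cap).add contDiff_const)

lemma contDiff_capWt : ContDiff ℝ 2 (capWt n M y) :=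
  contDiff_cutoff.mul (contDiff_const.mul (contDiff_id.norm_sq ℝ)).exp

lemma capWt_nonneg : 0 ≤ capWt n M y x := mul_nonneg (smoothTransition.nonneg _) (exp_pos _).le

lemma integrable_exp_neg_mul_norm_sq (hM : 0 < M) :
    Integrable fun x : EuclideanSpace ℝ (Fin (n + 1)) => exp (-M * ‖x‖ ^ 2) := by
  have h := (GaussianFourier.integrable_cexp_neg_mul_sq_norm_add (b := (M : ℂ)) (by simpa using hM) 0
    (0 : EuclideanSpace ℝ (Fin (n + 1)))).re
  refine h.congr (ae_of_all _ fun x => ?_)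
  simp only [zero_mul, add_zero]
  rw [show -(M : ℂ) * (‖x‖ : ℂ) ^ 2 = ((-M * ‖x‖ ^ 2 : ℝ) : ℂ) by push_cast; ring,
    ← Complex.ofReal_exp]
  exact Complex.ofReal_re _

lemma exists_capWt_energy_bound (n : ℕ) (hM : 0 < M) : ∃ D, 0 ≤ D ∧ ∀ y, 1 ≤ y →
    ∀ f : EuclideanSpace ℝ (Fin (n + 1)) → ℝ, (∀ x, f x ^ 2 ≤ (M * exp (M * ‖x‖ ^ 2)) ^ 2) →
      ∫ x, f x ^ 2 * (|slap (capWt n M y) x| + (2 * M + M ^ 2) * capWt n M y x) ≤ D ∧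
      ∫ x, capWt n M y x * f x ^ 2 ≤ D := by
  obtain ⟨C, hC, hcut⟩ := exists_cutoff_bound n (k := 2) (b := 1) (by norm_num) (by norm_num)
  set C' := C + 8 * M * (C + 1) + (64 * M ^ 2 + 8 * M * (n + 1)) + (2 * M + M ^ 2) + 1 with hC'
  have hC'0 : 0 ≤ C' := by positivity
  set Q := M ^ 2 * C' * (1 + M⁻¹) with hQ
  have hI := (integrable_exp_neg_mul_norm_sq (n := n) hM).const_mul Q
  have hIpos : 0 ≤ ∫ x : EuclideanSpace ℝ (Fin (n + 1)), Q * exp (-M * ‖x‖ ^ 2) :=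
    integral_nonneg fun x => by positivity
  refine ⟨_, hIpos, fun y hy f hf => ?_⟩
  have hexp : ∀ x : EuclideanSpace ℝ (Fin (n + 1)),
      f x ^ 2 * (C' * (1 + ‖x‖ ^ 2) * exp (-(4 * M) * ‖x‖ ^ 2)) ≤ Q * exp (-M * ‖x‖ ^ 2) :=
    fun x => by
      have h1 : 1 + ‖x‖ ^ 2 ≤ (1 + M⁻¹) * exp (M * ‖x‖ ^ 2) := by
        have := add_one_le_exp (M * ‖x‖ ^ 2)
        have e : ‖x‖ ^ 2 = M⁻¹ * (M * ‖x‖ ^ 2) := by field_simp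
        have h2 : M⁻¹ * (M * ‖x‖ ^ 2) ≤ M⁻¹ * exp (M * ‖x‖ ^ 2) := by
          gcongr; linarith
        have h3 : 1 ≤ exp (M * ‖x‖ ^ 2) := one_le_exp (by positivity)
        linarith
      calc _ ≤ (M * exp (M * ‖x‖ ^ 2)) ^ 2 * (C' * ((1 + M⁻¹) * exp (M * ‖x‖ ^ 2)) *
            exp (-(4 * M) * ‖x‖ ^ 2)) := by
            have := hf x
            gcongr
        _ = Q * (exp (M * ‖x‖ ^ 2) * exp (M * ‖x‖ ^ 2) * exp (M * ‖x‖ ^ 2) *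
            exp (-(4 * M) * ‖x‖ ^ 2)) := by rw [hQ]; ring
        _ = _ := by
            rw [← exp_add, ← exp_add, ← exp_add]
            congr 2; ring
  have hW1 : ∀ x, capWt n M y x ≤ exp (-(4 * M) * ‖x‖ ^ 2) := fun x =>
    mul_le_of_le_one_left (exp_pos _).le (smoothTransition.le_one _)
  have hslap : ∀ x, |slap (capWt n M y) x| + (2 * M + M ^ 2) * capWt n M y x ≤
      C' * (1 + ‖x‖ ^ 2) * exp (-(4 * M) * ‖x‖ ^ 2) := fun x => by
    obtain ⟨g1, s1, -⟩ := hcut y hy x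
    set σ : EuclideanSpace ℝ (Fin (n + 1)) → ℝ := fun x => smoothTransition (2 * cap n y x + 1)
      with hσ
    have hn : ContDiff ℝ 2 fun x : EuclideanSpace ℝ (Fin (n + 1)) => ‖x - 0‖ ^ 2 :=
      contDiff_norm_sub_sq 0
    have dE : ∀ z : ℝ, HasDerivAt (fun z => exp (-(4 * M) * z)) (-(4 * M) * exp (-(4 * M) * z)) z :=
      fun z => by
        have := ((hasDerivAt_id z).const_mul (-(4 * M))).exp
        simpa [mul_comm] using this
    have dE2 : ∀ z : ℝ, HasDerivAt (fun z => -(4 * M) * exp (-(4 * M) * z))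
        (-(4 * M) * (-(4 * M) * exp (-(4 * M) * z))) z := fun z => (dE z).const_mul _
    set e : EuclideanSpace ℝ (Fin (n + 1)) → ℝ := fun x => exp (-(4 * M) * ‖x - 0‖ ^ 2) with he
    have hpde : ∀ i, pd i e x = -(4 * M) * e x * (2 * x i) := fun i => by
      simp only [he]
      rw [pd_comp (φ := fun z => exp (-(4 * M) * z)) (dE _) (hn.differentiable (by norm_num) x),
        pd_norm_sub_sq]
      simp
    have hse : slap e x = e x * (64 * M ^ 2 * ‖x‖ ^ 2 - 8 * M * (n + 1)) := by
      simp only [he]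
      rw [slap_comp (φ := fun z => exp (-(4 * M) * z)) dE (dE2 _) hn, gsq_norm_sub_sq,
        slap_norm_sub_sq]
      push_cast
      simp only [sub_zero]
      ring
    have he0 : 0 < e x := exp_pos _
    have hWe : capWt n M y = fun x => σ x * e x := by
      funext x; simp [capWt, hσ, he]
    have hσ0 : 0 ≤ σ x := smoothTransition.nonneg _
    have hσ1 : σ x ≤ 1 := smoothTransition.le_one _
    have hsum : |2 * ∑ i, pd i σ x * pd i e x| ≤ e x * (8 * M * (C + ‖x‖ ^ 2)) := by
      have h1 : 2 * ∑ i, pd i σ x * pd i e x = -(16 * M * e x) * ∑ i, pd i σ x * x i := by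
        simp only [hpde, Finset.mul_sum]
        exact Finset.sum_congr rfl fun i _ => by ring
      have h2 : |∑ i, pd i σ x * x i| ≤ (C + ‖x‖ ^ 2) / 2 := by
        calc _ ≤ ∑ i, |pd i σ x * x i| := Finset.abs_sum_le_sum_abs _ _
          _ ≤ ∑ i, (pd i σ x ^ 2 + x i ^ 2) / 2 := Finset.sum_le_sum fun i _ => by
              rw [abs_le]
              constructor <;> nlinarith [sq_nonneg (pd i σ x + x i), sq_nonneg (pd i σ x - x i)]
          _ = (gsq σ x + ‖x‖ ^ 2) / 2 := by
              rw [← Finset.sum_div, Finset.sum_add_distrib, EuclideanSpace.norm_sq_eq, gsq]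
              simp
          _ ≤ _ := by gcongr
      rw [h1, abs_mul, abs_neg, abs_of_pos (by positivity)]
      calc _ ≤ 16 * M * e x * ((C + ‖x‖ ^ 2) / 2) := by gcongr
        _ = _ := by ring
    have hE2 : |σ x * slap e x| ≤ e x * (64 * M ^ 2 * ‖x‖ ^ 2 + 8 * M * (n + 1)) := by
      rw [abs_mul, abs_of_nonneg hσ0, hse, abs_mul, abs_of_pos he0]
      refine (mul_le_of_le_one_left (by positivity) hσ1).trans ?_
      gcongr
      rw [abs_le]
      have : 0 ≤ 64 * M ^ 2 * ‖x‖ ^ 2 := by positivity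
      have : 0 ≤ 8 * M * ((n : ℝ) + 1) := by positivity
      constructor <;> linarith
    have hE1 : |slap σ x * e x| ≤ e x * C := by
      rw [abs_mul, abs_of_pos he0, mul_comm]; gcongr
    have hWx := hW1 x
    have hcE : ContDiff ℝ 2 e := (contDiff_const.mul hn).exp
    have hsl : |slap (capWt n M y) x| ≤ e x * C + e x * (8 * M * (C + ‖x‖ ^ 2)) +
        e x * (64 * M ^ 2 * ‖x‖ ^ 2 + 8 * M * (n + 1)) := by
      rw [hWe, slap_mul contDiff_cutoff hcE]
      exact (abs_add_le _ _).trans (add_le_add ((abs_add_le _ _).trans (add_le_add hE1 hsum)) hE2)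
    have hex : exp (-(4 * M) * ‖x‖ ^ 2) = e x := by simp [he]
    rw [hex] at hWx ⊢
    have h3 : (2 * M + M ^ 2) * capWt n M y x ≤ (2 * M + M ^ 2) * e x := by gcongr
    have h4 : e x * C + e x * (8 * M * (C + ‖x‖ ^ 2)) +
        e x * (64 * M ^ 2 * ‖x‖ ^ 2 + 8 * M * (n + 1)) + (2 * M + M ^ 2) * e x ≤
        C' * (1 + ‖x‖ ^ 2) * e x := by
      have : C + 8 * M * (C + ‖x‖ ^ 2) + (64 * M ^ 2 * ‖x‖ ^ 2 + 8 * M * (n + 1)) +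
          (2 * M + M ^ 2) ≤ C' * (1 + ‖x‖ ^ 2) := by
        have r1 : 0 ≤ ‖x‖ ^ 2 := by positivity
        have r2 : 0 ≤ (C + 8 * M * C + 8 * M * (n + 1) + (2 * M + M ^ 2) + 1) * ‖x‖ ^ 2 := by
          positivity
        rw [hC']
        nlinarith
      have := mul_le_mul_of_nonneg_right this he0.le
      linarith
    linarith
  constructor
  · refine integral_mono_of_nonneg (ae_of_all _ fun x => ?_) hI (ae_of_all _ fun x => ?_)
    · have := capWt_nonneg (n := n) (M := M) (y := y) (x := x)
      simp only [Pi.zero_apply]; positivity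
    · exact (mul_le_mul_of_nonneg_left (hslap x) (sq_nonneg _)).trans (hexp x)
  · refine integral_mono_of_nonneg (ae_of_all _ fun x => ?_) hI (ae_of_all _ fun x => ?_)
    · have := capWt_nonneg (n := n) (M := M) (y := y) (x := x)
      simp only [Pi.zero_apply]; positivity
    · refine le_trans ?_ (hexp x)
      simp only [mul_comm (capWt n M y x)]
      refine mul_le_mul_of_nonneg_left ((hW1 x).trans ?_) (sq_nonneg _)
      refine le_mul_of_one_le_left (exp_pos _).le ?_
      have : 1 ≤ C' := by rw [hC']; linarith [show 0 ≤ C + 8 * M * (C + 1) +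
        (64 * M ^ 2 + 8 * M * (n + 1)) + (2 * M + M ^ 2) by positivity]
      nlinarith [sq_nonneg ‖x‖]

end Cutoffs

section ScalarWeight

/-- The logarithm of the radial part of the Carleman weight at squared distance `R`. -/
noncomputable def logWt (α lam R s : ℝ) : ℝ := α * (-log s + lam * s) - R / (4 * s)

variable {α lam R s τ y : ℝ}

lemma logWt_sub (hs : 0 < s) (hτ : 0 < τ) (hR : R = 4 * α * τ * (1 - lam * τ)) :
    logWt α lam R τ - logWt α lam R s =
      α * ((τ / s - 1) - log (τ / s) - lam * s * (τ / s - 1) ^ 2) := by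
  rw [logWt, logWt, log_div hτ.ne' hs.ne', hR]
  field_simp
  ring

lemma logWt_le (hα : 0 ≤ α) (hs : 0 < s) (hτ : 0 < τ) (hR : R = 4 * α * τ * (1 - lam * τ))
    (hls : lam * s ≤ 1 / 4) (hlτ : lam * τ ≤ 1 / 4) : logWt α lam R s ≤ logWt α lam R τ := by
  rw [← sub_nonneg, logWt_sub hs hτ hR]
  refine mul_nonneg hα ?_
  have hz : 0 < τ / s := div_pos hτ hs
  have hlz : lam * s * (τ / s) = lam * τ := by field_simp
  set z := τ / s
  obtain ⟨q, hq, hqz⟩ : ∃ q, 0 < q ∧ z = q ^ 2 := ⟨√z, sqrt_pos.2 hz, (sq_sqrt hz.le).symm⟩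
  have hlog : log z ≤ 2 * (q - 1) := by
    rw [hqz, log_pow]
    have := log_le_sub_one_of_pos hq
    push_cast
    linarith
  have h1 : lam * s * (q + 1) ^ 2 ≤ 1 := by
    rw [hqz] at hlz
    rcases le_total (lam * s) 0 with h | h
    · nlinarith [sq_nonneg (q + 1)]
    · have h3 : lam * s * (2 * q) ≤ lam * s * (q ^ 2 + 1) :=
        mul_le_mul_of_nonneg_left (by nlinarith [sq_nonneg (q - 1)]) h
      nlinarith
  have h2 : lam * s * (z - 1) ^ 2 ≤ (q - 1) ^ 2 := by
    calc _ = (lam * s * (q + 1) ^ 2) * (q - 1) ^ 2 := by rw [hqz]; ring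
      _ ≤ 1 * (q - 1) ^ 2 := by gcongr
      _ = _ := one_mul _
  rw [hqz] at hlog h2 ⊢
  linarith [sq_nonneg (q - 1)]

lemma logWt_sub_le (hα : 0 ≤ α) (hlam : 0 ≤ lam) (hs : 0 < s) (hτ : 0 < τ)
    (hR : R = 4 * α * τ * (1 - lam * τ)) (hy : 0 < y) (hαy : α ≤ y ^ 2 / (2 * τ)) (hsτ : s ≤ τ)
    (hys : τ * y ≤ s * (y + 1)) : logWt α lam R τ - 1 / (2 * τ) ≤ logWt α lam R s := by
  have h := logWt_sub hs hτ hR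
  have hz1 : 1 ≤ τ / s := by rwa [one_le_div hs]
  have hz2 : τ / s - 1 ≤ 1 / y := by
    rw [sub_le_iff_le_add, div_le_iff₀ hs, div_add_one hy.ne', div_mul_eq_mul_div, le_div_iff₀ hy]
    linarith
  set z := τ / s
  have hz : 0 < z := by linarith
  have hlog := one_sub_inv_le_log_of_pos hz
  have h1 : (z - 1) - log z ≤ (z - 1) ^ 2 := by
    have : (z - 1) - (1 - z⁻¹) ≤ (z - 1) ^ 2 := by
      have e : (z - 1) - (1 - z⁻¹) = (z - 1) ^ 2 * z⁻¹ := by field_simp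
      rw [e]
      exact mul_le_of_le_one_right (sq_nonneg _) (inv_le_one_of_one_le₀ hz1)
    linarith
  have h2 : (z - 1) ^ 2 ≤ 1 / y ^ 2 := by
    rw [← one_div_pow]
    gcongr
  have h3 : 0 ≤ lam * s * (z - 1) ^ 2 := by positivity
  have h4 : α * ((z - 1) - log z - lam * s * (z - 1) ^ 2) ≤ y ^ 2 / (2 * τ) * (1 / y ^ 2) :=
    (mul_le_mul_of_nonneg_left (by linarith) hα).trans
      (mul_le_mul_of_nonneg_right hαy (by positivity))
  have h5 : y ^ 2 / (2 * τ) * (1 / y ^ 2) = 1 / (2 * τ) := by field_simp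
  linarith

lemma le_logWt (hα : 0 ≤ α) (hlam : 0 ≤ lam) (hτ : 0 < τ) (hR : R = 4 * α * τ * (1 - lam * τ)) :
    α * (-log τ - 1) ≤ logWt α lam R τ := by
  have : logWt α lam R τ = α * (-log τ - 1) + α * (2 * (lam * τ)) := by
    rw [logWt, hR]; field_simp; ring
  rw [this]
  have : 0 ≤ α * (2 * (lam * τ)) := by positivity
  linarith

variable {d : ℕ} {c x : EuclideanSpace ℝ (Fin d)} {a t Z : ℝ}

lemma wt_le_exp_logWt (ha : 0 < a) (ht : 0 ≤ t) (hs : t + a ≤ 1) (hr : R + Z ≤ ‖x - c‖ ^ 2) :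
    wt c a α lam x t ≤ exp (d / 2 * -log a + logWt α lam R (t + a) - Z / (4 * (t + a))) := by
  have hs0 : 0 < t + a := by linarith
  rw [wt, logWt, exp_le_exp]
  have h1 : (R + Z) / (4 * (t + a)) ≤ ‖x - c‖ ^ 2 / (4 * (t + a)) := by gcongr
  rw [add_div] at h1
  have h2 : log a ≤ log (t + a) := log_le_log ha (by linarith)
  have h3 : log (t + a) ≤ 0 := log_nonpos hs0.le hs
  have h4 : (d / 2 : ℝ) * log a ≤ d / 2 * log (t + a) := by gcongr
  linarith

lemma exp_logWt_le_wt (hs0 : 0 < t + a) (hs : t + a ≤ 1) (hr : ‖x - c‖ ^ 2 ≤ R) :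
    (t + a) * exp (logWt α lam R (t + a)) ≤ wt c a α lam x t := by
  nth_rw 1 [← exp_log hs0]
  rw [wt, logWt, ← exp_add, exp_le_exp]
  have h1 : ‖x - c‖ ^ 2 / (4 * (t + a)) ≤ R / (4 * (t + a)) := by gcongr
  have h3 : log (t + a) ≤ 0 := log_nonpos hs0.le hs
  have h4 : (d / 2 : ℝ) * log (t + a) ≤ 0 := mul_nonpos_of_nonneg_of_nonpos (by positivity) h3
  linarith

lemma wt_zero_le (ha : 0 < a) (ha1 : a ≤ 1) (hα : 0 ≤ α) (hla : lam * a ≤ 1)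
    (hr : Z ≤ ‖x - c‖ ^ 2) :
    wt c a α lam x 0 ≤ exp (d / 2 * -log a + α * (-log a + 1)) * exp (-(Z / (4 * a))) := by
  have h := wt_le_exp_logWt (α := α) (lam := lam) (t := 0) (R := 0) (Z := Z) (x := x) (c := c) ha
    le_rfl (by linarith) (by linarith)
  refine h.trans ?_
  rw [← exp_add, exp_le_exp, logWt]
  simp only [zero_add, zero_div, sub_zero]
  have : α * (lam * a) ≤ α * 1 := by gcongr
  linarith

end ScalarWeight

section Mass

variable {d : ℕ} {p f g W w : EuclideanSpace ℝ (Fin d) → ℝ} {B : Set (EuclideanSpace ℝ (Fin d))}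

lemma mul_setIntegral_sq_le (hB : MeasurableSet B) {m : ℝ}
    (hf : Integrable fun x => f x ^ 2) (hpf : Integrable fun x => p x * f x ^ 2)
    (hp : ∀ x, 0 ≤ p x) (hpm : ∀ x ∈ B, m ≤ p x) (hfg : ∀ x ∈ B, f x = g x) :
    m * ∫ x in B, g x ^ 2 ≤ ∫ x, p x * f x ^ 2 := by
  have h1 : ∫ x in B, g x ^ 2 = ∫ x in B, f x ^ 2 :=
    setIntegral_congr_fun hB fun x hx => by simp only [hfg x hx]
  rw [h1, ← integral_const_mul]
  calc _ ≤ ∫ x in B, p x * f x ^ 2 :=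
        setIntegral_mono_on (hf.const_mul m).integrableOn hpf.integrableOn hB fun x hx =>
          mul_le_mul_of_nonneg_right (hpm x hx) (sq_nonneg _)
    _ ≤ _ := setIntegral_le_integral hpf (ae_of_all _ fun x => mul_nonneg (hp x) (sq_nonneg _))

lemma integral_mul_sq_le (hB : MeasurableSet B) {Q R : ℝ}
    (hg : IntegrableOn (fun x => g x ^ 2) B) (hpf : Integrable fun x => p x * f x ^ 2)
    (hW : Integrable fun x => W x * w x ^ 2) (hW0 : ∀ x, 0 ≤ W x) (hR : 0 ≤ R)
    (hin : ∀ x ∈ B, p x * f x ^ 2 ≤ Q * g x ^ 2)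
    (hout : ∀ x ∉ B, p x * f x ^ 2 ≤ R * (W x * w x ^ 2)) :
    ∫ x, p x * f x ^ 2 ≤ Q * (∫ x in B, g x ^ 2) + R * ∫ x, W x * w x ^ 2 := by
  have hg' : Integrable (B.indicator fun x => g x ^ 2) := (integrable_indicator_iff hB).2 hg
  have h1 := hg'.const_mul Q
  have h2 := hW.const_mul R
  rw [← integral_indicator hB, ← integral_const_mul, ← integral_const_mul, ← integral_add h1 h2]
  refine integral_mono hpf (h1.add h2) fun x => ?_
  have h3 : 0 ≤ R * (W x * w x ^ 2) := mul_nonneg hR (mul_nonneg (hW0 x) (sq_nonneg _))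
  by_cases hx : x ∈ B
  · simp only [indicator_of_mem hx]
    have := hin x hx
    linarith
  · simp only [indicator_of_notMem hx, mul_zero, zero_add]
    exact hout x hx

variable {n : ℕ} {T M : ℝ} {H : Set (EuclideanSpace ℝ (Fin d))}
  {u : EuclideanSpace ℝ (Fin d) → ℝ → ℝ}

lemma integrableOn_ball_sq (hux : ∀ t ∈ Icc (0 : ℝ) T, ContDiffOn ℝ 2 (fun x => u x t) H)
    (hgrow : ∀ x ∈ H, ∀ t ∈ Icc (0 : ℝ) T, |u x t| ≤ M * exp (M * ‖x‖ ^ 2)) (hM : 0 < M)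
    {c : EuclideanSpace ℝ (Fin d)} {r : ℝ} (hc : ball c r ⊆ H) :
    (∀ x ∈ ball c r, ∀ t ∈ Icc (0 : ℝ) T, ‖u x t ^ 2‖ ≤ (M * exp (M * (‖c‖ + r) ^ 2)) ^ 2) ∧
    ∀ t ∈ Icc (0 : ℝ) T, IntegrableOn (fun x => u x t ^ 2) (ball c r) := by
  have hb : ∀ x ∈ ball c r, ∀ t ∈ Icc (0 : ℝ) T,
      ‖u x t ^ 2‖ ≤ (M * exp (M * (‖c‖ + r) ^ 2)) ^ 2 := fun x hx t ht => by
    rw [norm_pow, Real.norm_eq_abs]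
    have h1 := hgrow x (hc hx) t ht
    have h2 : ‖x‖ ≤ ‖c‖ + r := by
      have := norm_add_le c (x - c)
      rw [add_sub_cancel] at this
      have h3 : ‖x - c‖ < r := by rwa [← dist_eq_norm]
      linarith
    have h3 : M * exp (M * ‖x‖ ^ 2) ≤ M * exp (M * (‖c‖ + r) ^ 2) := by gcongr
    have := h1.trans h3
    gcongr
  refine ⟨hb, fun t ht => ?_⟩
  refine IntegrableOn.of_bound measure_ball_lt_top
    (((hux t ht).continuousOn.mono hc).pow 2 |>.aestronglyMeasurable measurableSet_ball)
    ((M * exp (M * (‖c‖ + r) ^ 2)) ^ 2) ?_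
  filter_upwards [ae_restrict_mem measurableSet_ball] with x hx using hb x hx t ht

lemma exists_mass_lower_bound (hT : 0 < T) (hM : 0 < M)
    (hux : ∀ t ∈ Icc (0 : ℝ) T, ContDiffOn ℝ 2 (fun x => u x t) H)
    (hut : ∀ x ∈ H, ContDiffOn ℝ 1 (u x) (Icc (0 : ℝ) T))
    (hgrow : ∀ x ∈ H, ∀ t ∈ Icc (0 : ℝ) T, |u x t| ≤ M * exp (M * ‖x‖ ^ 2))
    {c : EuclideanSpace ℝ (Fin d)} {r : ℝ} (hc : ball c r ⊆ H)
    (hpos : 0 < ∫ x in ball c r, u x 0 ^ 2) :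
    ∃ c₀ δ, 0 < c₀ ∧ 0 < δ ∧ δ ≤ T ∧ ∀ t ∈ Icc 0 δ, c₀ ≤ ∫ x in ball c r, u x t ^ 2 := by
  obtain ⟨hb, hi⟩ := integrableOn_ball_sq hux hgrow hM hc
  have h0 : (0 : ℝ) ∈ Icc 0 T := ⟨le_rfl, hT.le⟩
  have hcont : ContinuousWithinAt (fun t => ∫ x in ball c r, u x t ^ 2) (Icc 0 T) 0 := by
    refine continuousWithinAt_of_dominated
      (bound := fun _ => (M * exp (M * (‖c‖ + r) ^ 2)) ^ 2) ?_ ?_ ?_ ?_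
    · filter_upwards [self_mem_nhdsWithin] with t ht using (hi t ht).aestronglyMeasurable
    · filter_upwards [self_mem_nhdsWithin] with t ht
      filter_upwards [ae_restrict_mem measurableSet_ball] with x hx using hb x hx t ht
    · exact integrableOn_const measure_ball_lt_top.ne
    · filter_upwards [ae_restrict_mem measurableSet_ball] with x hx
      exact ((hut x (hc hx)).continuousOn 0 h0).pow 2
  set F := fun t => ∫ x in ball c r, u x t ^ 2
  have hev : ∀ᶠ t in 𝓝[Icc 0 T] 0, F 0 / 2 < F t :=
    hcont.eventually (lt_mem_nhds (half_lt_self hpos))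
  obtain ⟨ε, hε, hball⟩ := Metric.mem_nhdsWithin_iff.1 hev
  refine ⟨F 0 / 2, min (ε / 2) T, half_pos hpos, lt_min (half_pos hε) hT, min_le_right _ _,
    fun t ht => (hball ⟨?_, ht.1, ht.2.trans (min_le_right _ _)⟩ : F 0 / 2 < F t).le⟩
  have := ht.2.trans (min_le_left _ _)
  rw [mem_ball_zero_iff, Real.norm_eq_abs, abs_of_nonneg ht.1]
  linarith

end Mass

section CapWeights

variable {n : ℕ} {M y a t τ α lam : ℝ} {x : EuclideanSpace ℝ (Fin (n + 1))}

lemma capWt_eq_exp (hx : 0 ≤ cap n y x) : capWt n M y x = exp (-(4 * M) * ‖x‖ ^ 2) := by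
  rw [capWt, smoothTransition.one_of_one_le (by linarith), one_mul]

lemma exp_le_capWt (hM : 0 < M) (hy : 0 < y) (hx : 0 ≤ cap n y x) :
    exp (-(64 * M * y ^ 2)) ≤ capWt n M y x := by
  rw [capWt_eq_exp hx, exp_le_exp]
  have h1 : ‖x‖ ^ 2 ≤ (4 * y) ^ 2 := by
    gcongr
    exact norm_le_of_cap hy (by linarith)
  have h2 : 4 * M * ‖x‖ ^ 2 ≤ 4 * M * (4 * y) ^ 2 := by gcongr
  linarith

lemma wt_le_capWt_of_cap_le_one (hy : 9 / 2 ≤ y) (hα : 0 ≤ α) (hτ : 0 < τ)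
    (hτ1 : 129 * τ ≤ 1) (hτM : 32 * M * (129 * τ) ≤ 1) (hlam : 0 ≤ lam)
    (hτl : 4 * lam * (129 * τ) ≤ 1) (hR : (y - 3) ^ 2 = 4 * α * τ * (1 - lam * τ)) (ha : 0 < a)
    (ht : 0 ≤ t) (hs : t + a ≤ 129 * τ) (hM : 0 < M) (h0 : 0 ≤ cap n y x) (h1 : cap n y x ≤ 1) :
    wt (y • EuclideanSpace.single (Fin.last n) (1 : ℝ)) a α lam x t ≤
      exp ((n + 1 : ℕ) / 2 * -log a + logWt α lam ((y - 3) ^ 2) τ - (2 * y - 9) / (516 * τ)) *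
        capWt n M y x := by
  have hs0 : 0 < t + a := by linarith
  have hr : (y - 3) ^ 2 + (2 * y - 9 + ‖x‖ ^ 2 / 2) ≤
      ‖x - y • EuclideanSpace.single (Fin.last n) (1 : ℝ)‖ ^ 2 := by
    rw [norm_sub_sq_eq_cap (by linarith)]
    have : 2 * y * (cap n y x + 1) ≤ 2 * y * (1 + 1) := by gcongr
    linarith
  refine (wt_le_exp_logWt ha ht (hs.trans hτ1) hr).trans ?_
  rw [capWt_eq_exp h0, ← exp_add, exp_le_exp]
  have hls : lam * (t + a) ≤ lam * (129 * τ) := by gcongr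
  have hlτ : 0 ≤ lam * τ := by positivity
  have h2 := logWt_le hα hs0 hτ hR (by linarith) (by linarith)
  have h3 : (2 * y - 9) / (516 * τ) ≤ (2 * y - 9) / (4 * (t + a)) := by
    have : 0 ≤ 2 * y - 9 := by linarith
    rw [show 516 * τ = 4 * (129 * τ) by ring]
    gcongr
  have h4 : 4 * M * ‖x‖ ^ 2 ≤ ‖x‖ ^ 2 / 2 / (4 * (t + a)) := by
    rw [le_div_iff₀ (by positivity)]
    have h5 : 32 * M * (t + a) ≤ 32 * M * (129 * τ) := by gcongr
    have h6 : (32 * M * (t + a)) * ‖x‖ ^ 2 ≤ 1 * ‖x‖ ^ 2 := by gcongr; linarith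
    linarith
  rw [add_div]
  linarith

lemma wt_le_capWt_of_late (hy : 0 < y) (hα : y ^ 2 / (16 * τ) ≤ α) (hτ : 0 < τ)
    (hτ1 : 129 * τ ≤ 1) (hτM : 32 * M * (129 * τ) ≤ 1) (hlam : 0 ≤ lam)
    (hτl : 4 * lam * (129 * τ) ≤ 1) (hR : (y - 3) ^ 2 = 4 * α * τ * (1 - lam * τ)) (ha : 0 < a)
    (ht : 64 * τ ≤ t) (hs : t + a ≤ 129 * τ) (hM : 0 < M) (h0 : 0 ≤ cap n y x) :
    wt (y • EuclideanSpace.single (Fin.last n) (1 : ℝ)) a α lam x t ≤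
      exp ((n + 1 : ℕ) / 2 * -log a + logWt α lam ((y - 3) ^ 2) τ - 2 * α) * capWt n M y x := by
  have hα0 : 0 ≤ α := le_trans (by positivity) hα
  refine (wt_le_exp_logWt (R := 0) (Z := 0) ha (by linarith) (hs.trans hτ1)
    (by simp)).trans ?_
  refine le_trans ?_ (mul_le_mul_of_nonneg_left (exp_le_capWt hM hy h0) (exp_pos _).le)
  rw [← exp_add, exp_le_exp, logWt]
  have h1 := le_logWt hα0 hlam hτ hR
  have h2 : log (64 * τ) ≤ log (t + a) := log_le_log (by positivity) (by linarith)
  have h3 : log (64 * τ) = 6 * log 2 + log τ := by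
    rw [log_mul (by norm_num) hτ.ne', show (64 : ℝ) = 2 ^ 6 by norm_num, log_pow]
    norm_num
  have h4 := log_two_gt_d9
  have hls : lam * (t + a) ≤ lam * (129 * τ) := by gcongr
  have h5 : α * (-log (t + a) + lam * (t + a)) ≤ α * (-log τ - 1 - (2 + 3 / 4)) := by
    gcongr
    linarith
  have h6 : 64 * M * y ^ 2 ≤ 1 / 4 * α := by
    rw [div_le_iff₀ (by positivity)] at hα
    have h7 : 32 * M * (129 * τ) * α ≤ 1 * α := by gcongr
    have h8 : 64 * M * y ^ 2 ≤ 64 * M * (α * (16 * τ)) := by gcongr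
    linarith
  simp only [zero_div, sub_zero]
  linarith

lemma of_mem_ball_four (hy : 7 ≤ y)
    (hx : x ∈ ball ((4 : ℝ) • EuclideanSpace.single (Fin.last n) (1 : ℝ)) 1) :
    1 ≤ cap n y x ∧
      ‖x - y • EuclideanSpace.single (Fin.last n) (1 : ℝ)‖ ^ 2 ≤ (y - 3) ^ 2 := by
  set e : EuclideanSpace ℝ (Fin (n + 1)) := EuclideanSpace.single (Fin.last n) (1 : ℝ) with he
  have hn : ‖e‖ = 1 := by simp [he]
  have h1 : ‖x - (4 : ℝ) • e‖ < 1 := by rwa [← dist_eq_norm]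
  have h2 : (4 - x (Fin.last n)) ≤ ‖x - (4 : ℝ) • e‖ := by
    have := PiLp.norm_apply_le (x - (4 : ℝ) • e) (Fin.last n)
    refine le_trans ?_ this
    rw [Real.norm_eq_abs, ← neg_sub]
    simpa [he] using neg_le_abs (x (Fin.last n) - 4)
  have h3 : ‖x‖ ≤ 5 := by
    have := norm_add_le (x - (4 : ℝ) • e) ((4 : ℝ) • e)
    rw [sub_add_cancel, norm_smul, hn] at this
    norm_num at this
    linarith
  constructor
  · have h4 : ‖x‖ ^ 2 / (4 * y) ≤ 1 := by
      rw [div_le_one (by linarith)]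
      have : ‖x‖ ^ 2 ≤ 5 ^ 2 := by gcongr
      linarith
    rw [cap]
    linarith
  · gcongr
    have h5 : x - y • e = (x - (4 : ℝ) • e) - (y - 4) • e := by rw [sub_smul]; abel
    have := norm_sub_le (x - (4 : ℝ) • e) ((y - 4) • e)
    rw [← h5, norm_smul, hn, mul_one, Real.norm_eq_abs, abs_of_nonneg (by linarith)] at this
    linarith

end CapWeights

section CarlemanAtHeight

variable {n : ℕ} {T M : ℝ} {H : Set (EuclideanSpace ℝ (Fin (n + 1)))}
  {u : EuclideanSpace ℝ (Fin (n + 1)) → ℝ → ℝ}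

set_option maxHeartbeats 1000000 in
lemma exists_carleman_at_height (hT : 0 < T) (hM : 0 < M)
    (hH : H = {x : EuclideanSpace ℝ (Fin (n + 1)) | 0 < x (Fin.last n)})
    (hux : ∀ t ∈ Icc (0 : ℝ) T, ContDiffOn ℝ 2 (fun x => u x t) H)
    (hut : ∀ x ∈ H, ContDiffOn ℝ 1 (u x) (Icc (0 : ℝ) T))
    (hpde : ∀ x ∈ H, ∀ t ∈ Icc (0 : ℝ) T,
      |slap (fun y => u y t) x + derivWithin (u x) (Icc (0 : ℝ) T) t| ≤
        M * (|u x t| + ‖gradient (fun y => u y t) x‖))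
    (hgrow : ∀ x ∈ H, ∀ t ∈ Icc (0 : ℝ) T, |u x t| ≤ M * exp (M * ‖x‖ ^ 2))
    {τ lam c₀ : ℝ} (hτ : 0 < τ) (hτ1 : 129 * τ ≤ 1) (hτT : 129 * τ ≤ T)
    (hτM : 32 * M * (129 * τ) ≤ 1) (hlM : 256 * M ^ 2 ≤ lam) (hlam1 : 1 ≤ lam)
    (hτl : 4 * lam * (129 * τ) ≤ 1)
    (hmass : ∀ t ∈ Icc 0 τ, c₀ ≤
      ∫ x in ball ((4 : ℝ) • EuclideanSpace.single (Fin.last n) (1 : ℝ)) 1, u x t ^ 2) :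
    ∃ A D, 0 ≤ A ∧ 0 ≤ D ∧ ∀ y a ρ α, 7 ≤ y → 0 < a → a ≤ τ / 2 → 0 < ρ →
      ball (y • EuclideanSpace.single (Fin.last n) (1 : ℝ)) ρ ⊆ H →
      1 ≤ α → y ^ 2 / (16 * τ) ≤ α → α ≤ y ^ 2 / (2 * τ) →
      (y - 3) ^ 2 = 4 * α * τ * (1 - lam * τ) →
      τ / (y + 1) * (1 / 4 * exp (logWt α lam ((y - 3) ^ 2) τ - 1 / (2 * τ)) * c₀) ≤
        A * exp ((n + 1 : ℕ) / 2 * -log a + logWt α lam ((y - 3) ^ 2) τ -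
          (2 * y - 9) / (516 * τ)) +
        A * exp ((n + 1 : ℕ) / 2 * -log a + logWt α lam ((y - 3) ^ 2) τ - 2 * α) +
        α * (exp ((n + 1 : ℕ) / 2 * -log a + α * (-log a + 1)) / a *
          (∫ x in ball (y • EuclideanSpace.single (Fin.last n) (1 : ℝ)) ρ, u x 0 ^ 2) +
          exp ((n + 1 : ℕ) / 2 * -log a + α * (-log a + 1)) / a *
          exp (64 * M * y ^ 2 - ρ ^ 2 / (4 * a)) * D) := by
  have hlam0 : 0 ≤ lam := by linarith
  have hlτ0 : 0 ≤ lam * τ := by positivity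
  have hls : ∀ a ≤ τ / 2, lam * (128 * τ + a) ≤ 1 := fun a haτ => by
    have : lam * a ≤ lam * (τ / 2) := by gcongr
    linarith
  have hla : ∀ a ≤ τ / 2, lam * a ≤ 1 := fun a haτ => by
    have : lam * a ≤ lam * (τ / 2) := by gcongr
    linarith
  have hwin : ∀ y, 7 ≤ y → τ / 2 ≤ τ * y / (y + 1) ∧ τ * y / (y + 1) ≤ τ := fun y hy => by
    have : τ * 1 ≤ τ * y := by gcongr; linarith
    constructor
    · rw [le_div_iff₀ (by linarith)]; linarith
    · rw [div_le_iff₀ (by linarith)]; linarith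
  obtain ⟨C, hC, hcut⟩ := exists_cutoff_bound n (k := 1) (b := 0) (by norm_num) (by norm_num)
  obtain ⟨D, hD, hcap⟩ := exists_capWt_energy_bound n hM
  obtain ⟨S₁, -, B, hB, dS, -, bS, -, zS, -⟩ := exists_smoothTransition_deriv
  set C₁ := C + C ^ 2 with hC₁
  have hC₁0 : 0 ≤ C₁ := by positivity
  set C₂ := (B / (64 * τ)) ^ 2 with hC₂
  refine ⟨192 * C₁ * (M ^ 2 + 1) * D + 16 * C₂ * D, D, by positivity, hD, ?_⟩
  intro y a ρ α hy ha haτ hρ hball hα1 hαl hαu hR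
  have hy0 : 0 < y := by linarith
  have hHo : IsOpen H := by
    rw [hH]
    exact isOpen_lt continuous_const (EuclideanSpace.proj (𝕜 := ℝ) (Fin.last n)).continuous
  have hSH : {x | -(7 / 8 : ℝ) ≤ cap n y x} ⊆ H := fun x hx => by
    rw [hH]
    exact last_pos_of_cap hy0 (lt_of_lt_of_le (by norm_num) hx)
  obtain ⟨U, w, w', hsol, hwu, hwM⟩ := exists_isSol (V := {x | -(3 / 4 : ℝ) < cap n y x})
    (θ := fun x => smoothTransition (8 * cap n y x + 7)) hT hM hHo hux hut hpde hgrow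
    (isCompact_cap_ge hy0 (by norm_num)) hSH
    (isOpen_lt continuous_const (contDiff_cap (k := 0)).continuous)
    (fun x hx => le_trans (by norm_num) (le_of_lt hx : -(3 / 4 : ℝ) ≤ cap n y x))
    contDiff_cutoff (fun x => smoothTransition.nonneg _) (fun x => smoothTransition.le_one _)
    (fun x hx => smoothTransition.zero_of_nonpos (by
      have : cap n y x < -(7 / 8 : ℝ) := not_le.1 hx
      linarith))
    (fun x hx => smoothTransition.one_of_one_le (by
      have : -(3 / 4 : ℝ) < cap n y x := hx
      linarith))
  set η : EuclideanSpace ℝ (Fin (n + 1)) → ℝ := fun x => smoothTransition (1 * cap n y x + 0)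
    with hη
  set χ : ℝ → ℝ := fun t => smoothTransition (2 - t / (64 * τ)) with hχ
  set e : EuclideanSpace ℝ (Fin (n + 1)) := EuclideanSpace.single (Fin.last n) (1 : ℝ) with he
  have hχ' : ∀ t, HasDerivAt χ (S₁ (2 - t / (64 * τ)) * -(1 / (64 * τ))) t := fun t => by
    have h1 : HasDerivAt (fun t : ℝ => 2 - t / (64 * τ)) (-(1 / (64 * τ))) t :=
      ((hasDerivAt_id t).div_const _).const_sub 2
    exact (dS _).comp t h1
  have hχ1 : ∀ t ≤ 64 * τ, χ t = 1 := fun t ht => smoothTransition.one_of_one_le (by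
    have : t / (64 * τ) ≤ 1 := (div_le_one (by positivity)).2 ht
    linarith)
  have hηle : ∀ x, 0 ≤ η x ∧ η x ≤ 1 := fun x => ⟨smoothTransition.nonneg _,
    smoothTransition.le_one _⟩
  have hηK : ∀ x ∉ {x | 0 ≤ cap n y x}, η x = 0 := fun x hx =>
    smoothTransition.zero_of_nonpos (by
      have : cap n y x < 0 := not_le.1 hx
      linarith)
  have hη2 : ContDiff ℝ 2 η := contDiff_cutoff
  have hKf : IsCompact {x | 0 ≤ cap n y x} := isCompact_cap_ge hy0 (by norm_num)
  have hfc : ∀ t, Continuous fun x => η x * χ t * w x t := fun t =>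
    (hη2.continuous.mul continuous_const).mul (hsol.smooth t).continuous
  have hfi : ∀ t, ∀ p : EuclideanSpace ℝ (Fin (n + 1)) → ℝ, Continuous p →
      Integrable fun x => p x * (η x * χ t * w x t) ^ 2 := fun t p hp => by
    refine (hp.mul ((hfc t).pow 2)).integrable_of_hasCompactSupport (HasCompactSupport.intro hKf
      fun x hx => ?_)
    simp [hηK x hx]
  have hpc : ∀ t, 0 ≤ t → Continuous fun x => wt (y • e) a α lam x t := fun t ht => by
    simp only [wt]
    fun_prop
  have hα0 : 0 ≤ α := by linarith
  obtain ⟨hwin1, hwin2⟩ := hwin y hy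
  have hwc : ∀ x ∈ {x | 0 ≤ cap n y x}, exp (-(64 * M * y ^ 2)) ≤ capWt n M y x :=
    fun x hx => exp_le_capWt hM hy0 hx
  have hmain := hsol.cut_carleman (K := {x | -(1 / 2 : ℝ) ≤ cap n y x})
    (Kf := {x | 0 ≤ cap n y x}) (W := capWt n M y) (η := η)
    (S := {x | cap n y x ≤ 1}) (T' := 128 * τ) (χ := χ) (τ₂ := 64 * τ) (c := y • e)
    (a := a) (α := α) (lam := lam) (C₁ := C₁) (C₂ := C₂) (D := D)
    (P₁ := exp ((n + 1 : ℕ) / 2 * -log a + logWt α lam ((y - 3) ^ 2) τ -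
          (2 * y - 9) / (516 * τ)))
    (P₂ := exp ((n + 1 : ℕ) / 2 * -log a + logWt α lam ((y - 3) ^ 2) τ - 2 * α))
    (t₁ := τ * y / (y + 1) - a) (t₂ := τ - a)
    (L := 1 / 4 * exp (logWt α lam ((y - 3) ^ 2) τ - 1 / (2 * τ)) * c₀)
    (isCompact_cap_ge hy0 (by norm_num))
    (fun x hx => lt_of_lt_of_le (by norm_num : -(3 / 4 : ℝ) < -(1 / 2)) hx)
    contDiff_capWt (fun x => capWt_nonneg)
    (fun x hx => by
      have : cap n y x < -(1 / 2 : ℝ) := not_le.1 hx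
      rw [capWt, smoothTransition.zero_of_nonpos (by linarith), zero_mul])
    hKf (fun x hx => le_trans (by norm_num : -(1 / 2 : ℝ) ≤ 0) hx) (exp_pos _) hwc hη2
    (fun x => (hηle x).1) (fun x => (hηle x).2) hηK hC₁0
    (fun x => (hcut y (by linarith) x).1.trans (by rw [hC₁]; linarith [sq_nonneg C]))
    (fun x => by
      have := (hcut y (by linarith) x).2.1
      calc _ = |slap η x| ^ 2 := (sq_abs _).symm
        _ ≤ C ^ 2 := by gcongr
        _ ≤ _ := by rw [hC₁]; linarith)
    (fun x hx => ((hcut y (by linarith) x).2.2 fun h => hx (by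
      have := h.2
      show cap n y x ≤ 1
      linarith)).1)
    (fun x hx => ((hcut y (by linarith) x).2.2 fun h => hx (by
      have := h.2
      show cap n y x ≤ 1
      linarith)).2)
    (by positivity) (by linarith) (by linarith) hχ' (fun t => smoothTransition.nonneg _)
    (fun t => smoothTransition.le_one _)
    (smoothTransition.zero_of_nonpos (le_of_eq (by field_simp; norm_num)))
    (fun t => by
      have : S₁ (2 - t / (64 * τ)) ^ 2 ≤ B ^ 2 := sq_le_sq' (abs_le.1 (bS _)).1 (abs_le.1 (bS _)).2
      calc _ = S₁ (2 - t / (64 * τ)) ^ 2 * (1 / (64 * τ)) ^ 2 := by ring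
        _ ≤ B ^ 2 * (1 / (64 * τ)) ^ 2 := by gcongr
        _ = C₂ := by rw [hC₂]; ring)
    (fun t ht => by
      rw [zS _ fun h => ?_, zero_mul]
      have : t / (64 * τ) < 1 := (div_lt_one (by positivity)).2 ht
      linarith [h.2])
    (fun t => (hcap y (by linarith) (fun x => w x t) fun x => hwM x t).1)
    (fun t => (hcap y (by linarith) (fun x => w x t) fun x => hwM x t).2)
    ha hα1 hlM (hls a haτ) (by linarith) (exp_pos _).le (exp_pos _).le
    (fun t ht x hx hx' => wt_le_capWt_of_cap_le_one (by linarith) hα0 hτ hτ1 hτM hlam0 hτl hR ha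
      ht.1.le (by linarith [ht.2]) hM hx' hx)
    (fun t ht ht' x hx => wt_le_capWt_of_late hy0 hαl hτ hτ1 hτM hlam0 hτl hR ha
      ht' (by linarith [ht.2]) hM hx)
    (by linarith) (by linarith)
    (by linarith)
    (fun t ht => by
      obtain ⟨ht1, ht2⟩ := ht
      have hs1 : τ * y ≤ (t + a) * (y + 1) := by
        rw [← div_le_iff₀ (by linarith)]; linarith
      have hs0 : 0 < t + a := by
        have : 0 < τ * y / (y + 1) := by positivity
        linarith
      have hs2 : t + a ≤ τ := by linarith
      have ht0 : 0 ≤ t := by linarith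
      have hlog := logWt_sub_le hα0 hlam0 hs0 hτ hR hy0 hαu hs2 hs1
      have htm := hmass t ⟨ht0, by linarith⟩
      refine (mul_le_mul_of_nonneg_left htm (by positivity)).trans ?_
      refine mul_setIntegral_sq_le (g := fun x => u x t) measurableSet_ball ?_ ?_ ?_ ?_ ?_
      · simpa using hfi t (fun _ => 1) continuous_const
      · exact hfi t _ ((hpc t ht0).mul continuous_const)
      · intro x
        have := wt_pos (c := y • e) (a := a) (α := α) (lam := lam) (x := x) (t := t)
        positivity
      · intro x hx
        have h1 := exp_logWt_le_wt (α := α) (lam := lam) hs0 (by linarith)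
          (of_mem_ball_four hy hx).2
        have h2 : exp (logWt α lam ((y - 3) ^ 2) τ - 1 / (2 * τ)) ≤
            exp (logWt α lam ((y - 3) ^ 2) (t + a)) := exp_le_exp.2 hlog
        have h3 : 1 ≤ α * lam := one_le_mul_of_one_le_of_one_le hα1 hlam1
        calc _ ≤ (α * lam) / 4 * exp (logWt α lam ((y - 3) ^ 2) (t + a)) := by gcongr
          _ = ((t + a) * exp (logWt α lam ((y - 3) ^ 2) (t + a))) *
              (α * lam / 4 / (t + a)) := by field_simp
          _ ≤ _ := by gcongr
      · intro x hx
        have h1 := (of_mem_ball_four hy hx).1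
        have h2 : η x = 1 := smoothTransition.one_of_one_le (by linarith)
        rw [h2, hχ1 t (by linarith), hwu x (show -(3 / 4 : ℝ) < cap n y x by linarith) t
          ⟨ht0, by linarith⟩]
        ring)
  have h0T : (0 : ℝ) ∈ Icc 0 T := ⟨le_rfl, hT.le⟩
  have hwt : ∀ x, ∀ Z ≤ ‖x - y • e‖ ^ 2, wt (y • e) a α lam x 0 / a ≤
      exp ((n + 1 : ℕ) / 2 * -log a + α * (-log a + 1)) / a * exp (-(Z / (4 * a))) :=
    fun x Z hZ => by
      rw [div_mul_eq_mul_div]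
      have := wt_zero_le (α := α) (lam := lam) ha (by linarith) hα0
        (hla a haτ) hZ
      gcongr
  have hfw : ∀ x, (η x * χ 0 * w x 0) ^ 2 ≤ w x 0 ^ 2 := fun x => by
    rw [hχ1 0 (by positivity), mul_one, mul_pow]
    exact mul_le_of_le_one_left (sq_nonneg _) (pow_le_one₀ (hηle x).1 (hηle x).2)
  have hcwi : Integrable fun x => capWt n M y x * w x 0 ^ 2 := by
    obtain ⟨S, hS, hwS⟩ := hsol.supp
    refine ((contDiff_capWt (n := n)).continuous.mul
      ((hsol.smooth 0).continuous.pow 2)).integrable_of_hasCompactSupport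
        (HasCompactSupport.intro hS fun x hx => ?_)
    simp [hwS x hx]
  have hinit := integral_mul_sq_le (p := fun x => wt (y • e) a α lam x 0 / a)
    (f := fun x => η x * χ 0 * w x 0) (g := fun x => u x 0) (W := capWt n M y)
    (w := fun x => w x 0) (B := ball (y • e) ρ)
    (Q := exp ((n + 1 : ℕ) / 2 * -log a + α * (-log a + 1)) / a)
    (R := exp ((n + 1 : ℕ) / 2 * -log a + α * (-log a + 1)) / a *
          exp (64 * M * y ^ 2 - ρ ^ 2 / (4 * a))) measurableSet_ball
    ((integrableOn_ball_sq hux hgrow hM hball).2 0 h0T)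
    (hfi 0 _ ((hpc 0 le_rfl).div_const _))
    hcwi
    (fun x => capWt_nonneg) (by positivity)
    (fun x hx => by
      by_cases hxK : 0 ≤ cap n y x
      · have h1 := hwt x 0 (sq_nonneg _)
        rw [zero_div, neg_zero, exp_zero, mul_one] at h1
        rw [← hwu x (show -(3 / 4 : ℝ) < cap n y x by linarith) 0 h0T]
        exact mul_le_mul h1 (hfw x) (sq_nonneg _) (by positivity)
      · rw [hηK x hxK, zero_mul, zero_mul]
        simp only [ne_eq, OfNat.ofNat_ne_zero, not_false_eq_true, zero_pow, mul_zero]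
        positivity)
    (fun x hx => by
      by_cases hxK : 0 ≤ cap n y x
      · rw [mem_ball, not_lt, dist_eq_norm] at hx
        refine (mul_le_mul (hwt x (ρ ^ 2) (by gcongr)) (hfw x) (sq_nonneg _)
          (by positivity)).trans ?_
        have h2 : 1 ≤ exp (64 * M * y ^ 2) * capWt n M y x := by
          have := mul_le_mul_of_nonneg_left (hwc x hxK) (exp_pos (64 * M * y ^ 2)).le
          rwa [← exp_add, add_neg_cancel, exp_zero] at this
        have h3 : w x 0 ^ 2 ≤ exp (64 * M * y ^ 2) * capWt n M y x * w x 0 ^ 2 :=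
          le_mul_of_one_le_left (sq_nonneg _) h2
        refine (mul_le_mul_of_nonneg_left h3 (by positivity)).trans (le_of_eq ?_)
        rw [sub_eq_add_neg (64 * M * y ^ 2), exp_add (64 * M * y ^ 2)]
        ring
      · rw [hηK x hxK, zero_mul, zero_mul]
        have := capWt_nonneg (n := n) (M := M) (y := y) (x := x)
        simp only [ne_eq, OfNat.ofNat_ne_zero, not_false_eq_true, zero_pow, mul_zero]
        positivity)
  have hD0 := (hcap y (by linarith) (fun x => w x 0) fun x => hwM x 0).2
  rw [show τ - a - (τ * y / (y + 1) - a) = τ / (y + 1) by field_simp; ring] at hmain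
  set P₁ := exp ((n + 1 : ℕ) / 2 * -log a + logWt α lam ((y - 3) ^ 2) τ -
          (2 * y - 9) / (516 * τ))
  set P₂ := exp ((n + 1 : ℕ) / 2 * -log a + logWt α lam ((y - 3) ^ 2) τ - 2 * α)
  have hP₁ : 0 ≤ P₁ := (exp_pos _).le
  have hP₂ : 0 ≤ P₂ := (exp_pos _).le
  refine hmain.trans (add_le_add ?_ (mul_le_mul_of_nonneg_left (hinit.trans
    (add_le_add_right (mul_le_mul_of_nonneg_left hD0 (by positivity)) _)) hα0))
  have h1 : 0 ≤ 16 * C₂ * D * P₁ := by positivity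
  have h2 : 0 ≤ 192 * C₁ * (M ^ 2 + 1) * D * P₂ := by positivity
  linarith

end CarlemanAtHeight

section LowerBound

variable {n : ℕ} {T M : ℝ} {H : Set (EuclideanSpace ℝ (Fin (n + 1)))}
  {u : EuclideanSpace ℝ (Fin (n + 1)) → ℝ → ℝ}

lemma eventually_exp_small (k : ℕ) {A D κ b : ℝ} (hκ : 0 < κ) (hb : 0 < b) :
    ∃ Y, ∀ y ≥ Y, A * y ^ k * exp (-b * y) + D * exp (-y) + exp (-y) ≤ κ / y := by
  have h1 : Tendsto (fun y : ℝ => y ^ (k + 1) * exp (-b * y)) atTop (𝓝 0) := by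
    have := tendsto_rpow_mul_exp_neg_mul_atTop_nhds_zero (k + 1 : ℕ) b hb
    simpa only [rpow_natCast] using this
  have h2 : Tendsto (fun y : ℝ => y ^ 1 * exp (-y)) atTop (𝓝 0) :=
    tendsto_pow_mul_exp_neg_atTop_nhds_zero 1
  have h3 := (h1.const_mul A).add (h2.const_mul (D + 1))
  rw [mul_zero, mul_zero, add_zero] at h3
  obtain ⟨Y, hY⟩ := eventually_atTop.1 (h3.eventually (gt_mem_nhds hκ))
  refine ⟨max Y 1, fun y hy => ?_⟩
  have hy0 : 0 < y := one_pos.trans_le ((le_max_right _ _).trans hy)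
  rw [le_div_iff₀ hy0]
  refine le_trans (le_of_eq ?_) (hY y ((le_max_left _ _).trans hy)).le
  ring

/-- Absorption of the error terms in the Carleman inequality. -/
lemma absorb_errors {k : ℕ} {A D M m c₀ a y α τ θ I q C₁ : ℝ} (hy : 9 ≤ y) (hA : 0 ≤ A)
    (hD : 0 ≤ D) (hθ : 0 ≤ θ) (hI : 0 ≤ I) (hτ : 0 < τ) (hm : 0 ≤ m) (hM : 0 ≤ M) (hc₀ : 0 ≤ c₀)
    (ha : 0 < a) (ha1 : a ≤ 1) (hα0 : 0 ≤ α) (hαl : y ^ 2 / (16 * τ) ≤ α)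
    (hαu : α ≤ y ^ 2 / (2 * τ)) (hk : exp (m * -log a) ≤ y ^ k)
    (hC₁ : C₁ = 1 / τ + 1 + m + 64 * M) (hq : (C₁ + 1) * (y ^ 2 * (1 - log a)) ≤ q)
    (hmain : τ / (y + 1) * (1 / 4 * exp (θ - 1 / (2 * τ)) * c₀) ≤
      A * exp (m * -log a + θ - (2 * y - 9) / (516 * τ)) + A * exp (m * -log a + θ - 2 * α) +
      α * (exp (m * -log a + α * (-log a + 1)) / a * I +
        exp (m * -log a + α * (-log a + 1)) / a * exp (64 * M * y ^ 2 - q) * D))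
    (hY : 2 * A * y ^ k * exp (-(1 / (516 * τ)) * y) + D * exp (-y) + exp (-y) ≤
      τ * c₀ * exp (-(1 / (2 * τ))) / 8 / y) :
    exp (-((C₁ + 1) * (y ^ 2 * (1 - log a)))) ≤ I := by
  have hl : 0 ≤ -log a := neg_nonneg.2 (log_nonpos ha.le ha1)
  have hinv : 1 / a = exp (-log a) := by rw [exp_neg, exp_log ha, one_div]
  obtain ⟨l, hll⟩ : ∃ l, l = -log a := ⟨_, rfl⟩
  rw [show 1 - log a = 1 + l by rw [hll]; ring] at hq ⊢
  rw [← hll] at hl hinv hk hmain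
  have hy0 : 0 < y := by linarith
  have hyy : y ≤ y ^ 2 * (1 + l) := by
    have : y * 1 ≤ y * (y * (1 + l)) := by
      gcongr
      exact one_le_mul_of_one_le_of_one_le (by linarith) (by linarith)
    linarith
  have hyy1 : 1 + l ≤ y ^ 2 * (1 + l) :=
    le_mul_of_one_le_left (by linarith) (one_le_pow₀ (by linarith))
  have hy2 : y ^ 2 ≤ y ^ 2 * (1 + l) := le_mul_of_one_le_right (by positivity) (by linarith)
  have hE1 : 1 ≤ exp θ := one_le_exp hθ
  set X := y ^ 2 * (1 + l) with hX
  have hX0 : 0 ≤ X := by positivity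
  have hleft : τ * c₀ * exp (-(1 / (2 * τ))) / 8 / y * exp θ ≤
      τ / (y + 1) * (1 / 4 * exp (θ - 1 / (2 * τ)) * c₀) := by
    have h1 : τ / (2 * y) ≤ τ / (y + 1) := by gcongr; linarith
    calc _ = τ / (2 * y) * (1 / 4 * (exp θ * exp (-(1 / (2 * τ)))) * c₀) := by ring
      _ ≤ τ / (y + 1) * (1 / 4 * (exp θ * exp (-(1 / (2 * τ)))) * c₀) := by gcongr
      _ = _ := by rw [← exp_add, ← sub_eq_add_neg]
  have hP : ∀ z, 1 / (516 * τ) * y ≤ z →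
      A * exp (m * l + θ - z) ≤ A * y ^ k * exp (-(1 / (516 * τ)) * y) * exp θ := fun z hz => by
    calc _ = A * (exp (m * l) * exp (-z) * exp θ) := by rw [← exp_add, ← exp_add]; ring_nf
      _ ≤ A * (y ^ k * exp (-(1 / (516 * τ)) * y) * exp θ) := by
          gcongr
          linarith
      _ = _ := by ring
  have hP1 := hP ((2 * y - 9) / (516 * τ)) (by
    rw [div_mul_eq_mul_div]
    gcongr
    linarith)
  have hP2 := hP (2 * α) (by
    have : 1 / (516 * τ) * y ≤ y ^ 2 / (16 * τ) := by
      rw [div_mul_eq_mul_div]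
      gcongr
      · nlinarith
      · norm_num
    linarith)
  have hK : α * (exp (m * l + α * (l + 1)) / a) ≤ exp ((C₁ - 64 * M) * X) := by
    have h1 : α ≤ exp α := by linarith [add_one_le_exp α]
    have h2 : α * (1 + l) ≤ y ^ 2 / (2 * τ) * (1 + l) := by gcongr
    have h3 : y ^ 2 / (2 * τ) * (1 + l) = 1 / (2 * τ) * X := by rw [hX]; ring
    have h4 : α ≤ 1 / (2 * τ) * X := by
      rw [← h3]
      exact (le_mul_of_one_le_right hα0 (by linarith)).trans h2
    have h5 : m * l ≤ m * X := by gcongr; linarith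
    have h6 : 1 / (2 * τ) * X + 1 / (2 * τ) * X = 1 / τ * X := by field_simp; ring
    calc _ = α * (exp (m * l + α * (l + 1)) * (1 / a)) := by rw [mul_one_div]
      _ ≤ exp α * (exp (m * l + α * (l + 1)) * (1 / a)) := by gcongr
      _ = exp (α + (m * l + α * (l + 1) + l)) := by rw [hinv, ← exp_add, ← exp_add]
      _ ≤ _ := by
          rw [exp_le_exp, hC₁]
          linarith
  have h64 : 64 * M * y ^ 2 ≤ 64 * M * X := by gcongr
  have hMX : 0 ≤ 64 * M * X := by positivity
  have hin1 : α * (exp (m * l + α * (l + 1)) / a) ≤ exp (C₁ * X) :=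
    hK.trans (exp_le_exp.2 (by linarith))
  have hin2 : α * (exp (m * l + α * (l + 1)) / a) * exp (64 * M * y ^ 2 - q) ≤ exp (-y) := by
    refine (mul_le_mul_of_nonneg_right hK (exp_pos _).le).trans ?_
    rw [← exp_add, exp_le_exp]
    linarith
  have hin3 : α * (exp (m * l + α * (l + 1)) / a) * I ≤ exp (C₁ * X) * I := by gcongr
  have hin4 : α * (exp (m * l + α * (l + 1)) / a) * exp (64 * M * y ^ 2 - q) * D ≤
      exp (-y) * D := by gcongr
  have htot : τ * c₀ * exp (-(1 / (2 * τ))) / 8 / y * exp θ ≤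
      (2 * A * y ^ k * exp (-(1 / (516 * τ)) * y) + D * exp (-y) + exp (C₁ * X) * I) * exp θ := by
    have h1 : exp (-y) * D ≤ exp (-y) * D * exp θ := le_mul_of_one_le_right (by positivity) hE1
    have h2 : exp (C₁ * X) * I ≤ exp (C₁ * X) * I * exp θ :=
      le_mul_of_one_le_right (by positivity) hE1
    linarith
  have hfin := le_of_mul_le_mul_right htot (exp_pos _)
  have h1 : exp (-y) ≤ exp (C₁ * X) * I := by linarith
  calc _ ≤ exp (-(C₁ * X)) * exp (-y) := by
        rw [← exp_add, exp_le_exp]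
        linarith
    _ ≤ exp (-(C₁ * X)) * (exp (C₁ * X) * I) := by gcongr
    _ = I := by rw [← mul_assoc, ← exp_add, neg_add_cancel, exp_zero, one_mul]

lemma exists_lower_bound (hT : 0 < T) (hM : 0 < M)
    (hH : H = {x : EuclideanSpace ℝ (Fin (n + 1)) | 0 < x (Fin.last n)})
    (hux : ∀ t ∈ Icc (0 : ℝ) T, ContDiffOn ℝ 2 (fun x => u x t) H)
    (hut : ∀ x ∈ H, ContDiffOn ℝ 1 (u x) (Icc (0 : ℝ) T))
    (hpde : ∀ x ∈ H, ∀ t ∈ Icc (0 : ℝ) T,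
      |slap (fun y => u y t) x + derivWithin (u x) (Icc (0 : ℝ) T) t| ≤
        M * (|u x t| + ‖gradient (fun y => u y t) x‖))
    (hgrow : ∀ x ∈ H, ∀ t ∈ Icc (0 : ℝ) T, |u x t| ≤ M * exp (M * ‖x‖ ^ 2))
    (hpos : 0 < ∫ x in ball ((4 : ℝ) • EuclideanSpace.single (Fin.last n) (1 : ℝ)) 1,
      u x 0 ^ 2) :
    ∃ τ C Y, 0 < τ ∧ τ ≤ 1 ∧ 1 ≤ C ∧ ∀ y a ρ, Y ≤ y → 0 < a → a ≤ τ / 2 → 0 < ρ →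
      ball (y • EuclideanSpace.single (Fin.last n) (1 : ℝ)) ρ ⊆ H → -log a ≤ 4 * log y →
      C * (y ^ 2 * (1 - log a)) ≤ ρ ^ 2 / a →
      exp (-(C * (y ^ 2 * (1 - log a)))) ≤
        ∫ x in ball (y • EuclideanSpace.single (Fin.last n) (1 : ℝ)) ρ, u x 0 ^ 2 := by
  have hball4 : ball ((4 : ℝ) • EuclideanSpace.single (Fin.last n) (1 : ℝ)) 1 ⊆ H := fun x hx => by
    rw [hH]
    exact last_pos_of_cap (y := 7) (by norm_num) (by linarith [(of_mem_ball_four le_rfl hx).1])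
  obtain ⟨c₀, δ, hc₀, hδ, -, hmass⟩ := exists_mass_lower_bound hT hM hux hut hgrow hball4 hpos
  set lam := 256 * M ^ 2 + 1 with hlam
  have hlam1 : 1 ≤ lam := by rw [hlam]; linarith [sq_nonneg M]
  have hlam0 : 0 < lam := one_pos.trans_le hlam1
  obtain ⟨τ, hτ, hτ1, hτT, hτM, hτl, hτδ⟩ : ∃ τ, 0 < τ ∧ 129 * τ ≤ 1 ∧ 129 * τ ≤ T ∧
      32 * M * (129 * τ) ≤ 1 ∧ 4 * lam * (129 * τ) ≤ 1 ∧ τ ≤ δ := by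
    obtain ⟨τ, hτ⟩ := exists_between (show (0 : ℝ) < min (min (1 / 129) (T / 129))
      (min (min (1 / (32 * M * 129)) (1 / (4 * lam * 129))) δ) by positivity)
    simp only [lt_min_iff] at hτ
    obtain ⟨h0, ⟨h1, h2⟩, ⟨h3, h4⟩, h5⟩ := hτ
    rw [lt_div_iff₀ (by positivity)] at h1 h2 h3 h4
    exact ⟨τ, h0, by linarith, by linarith, by linarith, by linarith, h5.le⟩
  obtain ⟨A, D, hA, hD, hcarl⟩ := exists_carleman_at_height hT hM hH hux hut hpde hgrow hτ hτ1 hτT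
    hτM (by rw [hlam]; linarith) hlam1 hτl fun t ht => hmass t ⟨ht.1, ht.2.trans hτδ⟩
  set m : ℝ := (n + 1 : ℕ) / 2 with hm
  have hm0 : 0 ≤ m := by positivity
  obtain ⟨Y, hY⟩ := eventually_exp_small (2 * (n + 1)) (A := 2 * A) (D := D)
    (κ := τ * c₀ * exp (-(1 / (2 * τ))) / 8) (b := 1 / (516 * τ)) (by positivity) (by positivity)
  set C₁ := 1 / τ + 1 + m + 64 * M with hC₁
  have hC₁1 : 1 ≤ C₁ := by
    have : 0 ≤ 1 / τ + m + 64 * M := by positivity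
    linarith
  refine ⟨τ, 4 * (C₁ + 1), max Y 9, hτ, by linarith, by linarith, ?_⟩
  intro y a ρ hy ha haτ hρ hball hlog hCa
  have hy9 : 9 ≤ y := (le_max_right _ _).trans hy
  have hy0 : 0 < y := by linarith
  have ha1 : a ≤ 1 := by linarith
  have hlτ : lam * τ ≤ 1 / 2 := by
    have : 0 < lam * τ := by positivity
    linarith
  have hκ : 0 < 1 - lam * τ := by linarith
  set α := (y - 3) ^ 2 / (4 * τ * (1 - lam * τ)) with hα
  have hαl : y ^ 2 / (16 * τ) ≤ α := by
    have h1 : (y / 2) ^ 2 ≤ (y - 3) ^ 2 := by gcongr; linarith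
    have h2 : 4 * τ * (1 - lam * τ) ≤ 4 * τ * 1 := by
      gcongr
      have : 0 < lam * τ := by positivity
      linarith
    calc y ^ 2 / (16 * τ) = (y / 2) ^ 2 / (4 * τ * 1) := by field_simp; norm_num
      _ ≤ _ := by rw [hα]; gcongr
  have hαu : α ≤ y ^ 2 / (2 * τ) := by
    have h1 : (y - 3) ^ 2 ≤ y ^ 2 := by gcongr <;> linarith
    have h2 : 4 * τ * (1 / 2) ≤ 4 * τ * (1 - lam * τ) := by gcongr; linarith
    calc α ≤ y ^ 2 / (4 * τ * (1 / 2)) := by rw [hα]; gcongr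
      _ = _ := by ring_nf
  have hα1 : 1 ≤ α := by
    refine le_trans ?_ hαl
    rw [le_div_iff₀ (by positivity)]
    have : 1 ≤ y ^ 2 := one_le_pow₀ (by linarith)
    linarith
  have hR : (y - 3) ^ 2 = 4 * α * τ * (1 - lam * τ) := by
    rw [hα, show 4 * ((y - 3) ^ 2 / (4 * τ * (1 - lam * τ))) * τ * (1 - lam * τ) =
      (y - 3) ^ 2 / (4 * τ * (1 - lam * τ)) * (4 * τ * (1 - lam * τ)) by ring,
      div_mul_cancel₀ _ (by positivity)]
  have hθ : 0 ≤ logWt α lam ((y - 3) ^ 2) τ := by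
    refine le_trans ?_ (le_logWt (by linarith) hlam0.le hτ hR)
    have h1 : log τ ≤ -1 := by
      rw [log_le_iff_le_exp hτ, exp_neg, le_inv_comm₀ hτ (exp_pos _)]
      refine exp_one_lt_d9.le.trans ?_
      rw [le_inv_comm₀ (by norm_num) hτ]
      norm_num
      linarith
    exact mul_nonneg (by linarith) (by linarith)
  have hk : exp (m * -log a) ≤ y ^ (2 * (n + 1)) := by
    have h1 : m * -log a ≤ m * (4 * log y) := by gcongr
    have h2 : m * (4 * log y) = (2 * (n + 1) : ℕ) * log y := by rw [hm]; push_cast; ring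
    rw [← exp_log (pow_pos hy0 _), log_pow, exp_le_exp]
    linarith
  have hX : 0 ≤ y ^ 2 * (1 - log a) :=
    mul_nonneg (sq_nonneg _) (by linarith [log_nonpos ha.le ha1])
  have h4 : ρ ^ 2 / (4 * a) = ρ ^ 2 / a / 4 := by rw [mul_comm, div_div]
  have hfin := absorb_errors hy9 hA hD hθ (integral_nonneg fun x => sq_nonneg (u x 0)) hτ hm0 hM.le
    hc₀.le ha ha1 (by linarith) hαl hαu hk hC₁ (q := ρ ^ 2 / (4 * a)) (by rw [h4]; linarith)
    (hcarl y a ρ α (by linarith) ha haτ hρ hball hα1 hαl hαu hR)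
    (hY y ((le_max_left _ _).trans hy))
  refine le_trans (exp_le_exp.2 ?_) hfin
  have : 0 ≤ C₁ * (y ^ 2 * (1 - log a)) := by positivity
  linarith

lemma one_sub_log_le_two_div_sqrt {a : ℝ} (ha : 0 < a) : 1 - log a ≤ 2 / √a := by
  have hs : 0 < √a := sqrt_pos.2 ha
  have h1 := log_le_sub_one_of_pos (inv_pos.2 hs)
  rw [log_inv, log_sqrt ha.le] at h1
  rw [div_eq_mul_inv]
  linarith

lemma exp_le_sqrt_of_exp_le {I z w : ℝ} (h : exp (-z) ≤ I) (hzw : z ≤ 2 * w) :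
    exp (-w) ≤ √I := by
  refine le_sqrt_of_sq_le (le_trans ?_ h)
  rw [← exp_nat_mul]
  exact exp_le_exp.2 (by push_cast; linarith)

lemma ball_smul_single_last_subset {n : ℕ} {y ρ : ℝ} (h : ρ ≤ y) :
    ball (y • EuclideanSpace.single (Fin.last n) (1 : ℝ)) ρ ⊆
      {x : EuclideanSpace ℝ (Fin (n + 1)) | 0 < x (Fin.last n)} := by
  intro x hx
  rw [mem_ball, dist_eq_norm] at hx
  have h1 := PiLp.norm_apply_le (x - y • EuclideanSpace.single (Fin.last n) (1 : ℝ)) (Fin.last n)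
  have h2 : |x (Fin.last n) - y| < ρ := by
    refine lt_of_le_of_lt ?_ hx
    simpa using h1
  have := (abs_lt.1 h2).1
  change 0 < x (Fin.last n)
  linarith

end LowerBound

/-- quantitative lower bounds within the half space `ℝⁿ₊` (here the space has
dimension `n+1 ≥ 1`, the half space is `{x : x_{last} > 0}` and `eN` is the last coordinate
vector): if `u` is `C^{2,1}` on `ℝⁿ₊ × [0,T]`, satisfies `|Δu + ∂ₜu| ≤ M(|u| + |∇u|)` and
`|u| ≤ M e^{M|x|²}` there, and `‖u(·,0)‖_{L²(B₁(4eN))} > 0`, then there is `N > 0` such that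
for every real `y ≥ N`, `‖u(·,0)‖_{L²(B_{y/2}(y eN))} ≥ e^{-Ny²}` and
`‖u(·,0)‖_{L²(B₁(y eN))} ≥ e^{-Ny² log y}`. -/
theorem stmt_2 (n : ℕ) (T M : ℝ) (hT : 0 < T) (hM : 0 < M)
    (H : Set (EuclideanSpace ℝ (Fin (n + 1))))
    (hH : H = {x : EuclideanSpace ℝ (Fin (n + 1)) | 0 < x (Fin.last n)})
    (eN : EuclideanSpace ℝ (Fin (n + 1)))
    (heN : eN = EuclideanSpace.single (Fin.last n) 1)
    (u : EuclideanSpace ℝ (Fin (n + 1)) → ℝ → ℝ)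
    (hux : ∀ t ∈ Icc (0 : ℝ) T, ContDiffOn ℝ 2 (fun x => u x t) H)
    (hut : ∀ x ∈ H, ContDiffOn ℝ 1 (u x) (Icc (0 : ℝ) T))
    (hpde : ∀ x ∈ H, ∀ t ∈ Icc (0 : ℝ) T,
      |slap (fun y => u y t) x + derivWithin (u x) (Icc (0 : ℝ) T) t| ≤
        M * (|u x t| + ‖gradient (fun y => u y t) x‖))
    (hgrow : ∀ x ∈ H, ∀ t ∈ Icc (0 : ℝ) T, |u x t| ≤ M * Real.exp (M * ‖x‖ ^ 2))
    (hpos : 0 < ∫ x in ball ((4 : ℝ) • eN) 1, u x 0 ^ 2) :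
    ∃ N > 0, ∀ y : ℝ, N ≤ y →
      Real.sqrt (∫ x in ball (y • eN) (y / 2), u x 0 ^ 2) ≥ Real.exp (-N * y ^ 2) ∧
      Real.sqrt (∫ x in ball (y • eN) 1, u x 0 ^ 2) ≥
        Real.exp (-N * y ^ 2 * Real.log y) := by
  subst heN
  obtain ⟨τ, C, Y, hτ, hτ1, hC, hbound⟩ := exists_lower_bound hT hM hH hux hut hpde hgrow hpos
  set b := min (τ / 2) (1 / (64 * C ^ 2)) with hb
  have hb0 : 0 < b := by rw [hb]; positivity
  have hbτ : b ≤ τ / 2 := min_le_left _ _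
  have hbC : C * (1 - log b) ≤ 1 / (4 * b) := by
    have hs : 0 < √b := sqrt_pos.2 hb0
    have hs8 : √b ≤ 1 / (8 * C) := by
      rw [sqrt_le_left (by positivity), div_pow, mul_pow]
      refine (min_le_right _ _).trans_eq ?_
      norm_num
    have hs1 : 8 * C * √b ≤ 1 := by
      rw [le_div_iff₀ (by positivity)] at hs8
      linarith
    have hbs : b = √b * √b := (mul_self_sqrt hb0.le).symm
    calc C * (1 - log b) ≤ C * (2 / √b) := by
          gcongr
          exact one_sub_log_le_two_div_sqrt hb0
      _ = 8 * C * √b / (4 * b) := by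
          rw [hbs, sqrt_mul_self (sqrt_nonneg b)]
          field_simp
          norm_num
      _ ≤ 1 / (4 * b) := by gcongr
  refine ⟨max (max Y 3) (max (max (1 / b) (5 * C)) (max (2 / τ) (C * (1 - log b)))),
    lt_max_of_lt_left (lt_max_of_lt_right (by norm_num)), fun y hy => ?_⟩
  set N := max (max Y 3) (max (max (1 / b) (5 * C)) (max (2 / τ) (C * (1 - log b)))) with hN
  have hNN := le_refl N
  nth_rw 1 [hN] at hNN
  simp only [max_le_iff] at hNN
  obtain ⟨⟨hNY, hN3⟩, ⟨hNb, hNC⟩, hNτ, hNl⟩ := hNN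
  have hy3 : 3 ≤ y := hN3.trans hy
  have hy0 : 0 < y := by linarith
  have hlog1 : 1 ≤ log y := by
    rw [le_log_iff_exp_le hy0]
    linarith [exp_one_lt_d9]
  constructor
  · have hlb : -log b ≤ 4 * log y := by
      have h1 : log (1 / b) ≤ log y := log_le_log (by positivity) (hNb.trans hy)
      rw [one_div, log_inv] at h1
      linarith
    have h := hbound y b (y / 2) (hNY.trans hy) hb0 hbτ (by linarith)
      (hH ▸ ball_smul_single_last_subset (by linarith)) hlb ?_
    · rw [ge_iff_le, neg_mul]
      refine exp_le_sqrt_of_exp_le h ?_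
      have h1 : C * (1 - log b) * y ^ 2 ≤ N * y ^ 2 := by gcongr
      have h2 : 0 ≤ N * y ^ 2 := by positivity
      linarith
    · calc C * (y ^ 2 * (1 - log b)) = C * (1 - log b) * y ^ 2 := by ring
        _ ≤ 1 / (4 * b) * y ^ 2 := by gcongr
        _ = (y / 2) ^ 2 / b := by ring
  · set a := (5 * C * (y ^ 2 * log y))⁻¹ with ha
    have hlog0 : 0 < log y := one_pos.trans_le hlog1
    have ha0 : 0 < a := by rw [ha]; positivity
    have hla : -log a ≤ 4 * log y := by
      rw [ha, log_inv, log_mul (x := 5 * C) (by positivity) (by positivity),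
        log_mul (x := y ^ 2) (by positivity) (by positivity), log_pow, neg_neg]
      have h1 : log (5 * C) ≤ log y := log_le_log (by positivity) (hNC.trans hy)
      have h2 : log (log y) ≤ log y := log_le_log hlog0 (log_le_self hy0.le)
      push_cast
      linarith
    have hCy : C * (y ^ 2 * (1 - log a)) ≤ 5 * C * (y ^ 2 * log y) := by
      calc C * (y ^ 2 * (1 - log a)) ≤ C * (y ^ 2 * (5 * log y)) := by gcongr; linarith
        _ = _ := by ring
    have haτ : a ≤ τ / 2 := by
      rw [ha, inv_le_comm₀ (by positivity) (by positivity), inv_div]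
      calc 2 / τ ≤ y := hNτ.trans hy
        _ ≤ y ^ 2 := le_self_pow₀ (by linarith) two_ne_zero
        _ = 1 * (y ^ 2 * 1) := by ring
        _ ≤ _ := by gcongr; linarith
    have h := hbound y a 1 (hNY.trans hy) ha0 haτ one_pos
      (hH ▸ ball_smul_single_last_subset (by linarith)) hla
      (by rwa [ha, one_pow, one_div, inv_inv])
    rw [ge_iff_le, neg_mul, neg_mul]
    refine exp_le_sqrt_of_exp_le h ?_
    have h1 : 5 * C * (y ^ 2 * log y) ≤ N * (y ^ 2 * log y) := by gcongr
    have h2 : 0 ≤ N * (y ^ 2 * log y) := by positivity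
    linarith
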